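/- arXiv:2108.10500 — 2 statements merged into one kernel-verified Lean document; each statement's English description precedes it below -/
import Mathlib

section
/- Let N ≥ 2 be an integer and y₁ < y₂ < ⋯ < y_{2N} be real numbers, and fix t, s with y_{2N−1} < t < s < y_{2N}. Then there exists a holomorphic function h on the open upper half-plane ℍ = {z ∈ ℂ : Im z > 0} satisfying: (1) Re h extends continuously to (−∞, y₁) ∪ (y_{2N}, +∞) with boundary value 0; (2) there exists a constant c ∈ ℝ such that for every 1 ≤ i ≤ N−1, Re h extends continuously to (y_{2i}, y_{2i+1}) with boundary value identically c; (3) for each 1 ≤ i ≤ N−1, Im h extends continuously to (y_{2i−1}, y_{2i}) with a constant boundary value; (4) Im h extends continuously with boundary value 0 on (y₁, y₂) ∪ (y_{2N−1}, t) ∪ (s, y_{2N}) and with boundary value 1 on (t, s); (5) Im h is bounded on ℍ and extends continuously to cl(ℍ) ∖ {t, s}. -/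
open Set Metric Filter Complex Topology

noncomputable section

/-- The open upper half-plane in `ℂ`. -/
def UHP : Set ℂ := {z | 0 < z.im}

/-- The mixed boundary-value problem for the holomorphic observable `h(·, t, s; y₁,…,y_{2N})`,
with the Dirichlet-1 window `(t,s)` contained in `(y_{2N-1}, y_{2N})`.
Boundary values are understood as limits within the upper half-plane. -/
def SolvesBVP (N : ℕ) (y : ℕ → ℝ) (t s : ℝ) (h : ℂ → ℂ) : Prop :=
  -- holomorphic on ℍ
  DifferentiableOn ℂ h UHP ∧
  -- (1) Re h = 0 on (-∞, y₁) ∪ (y_{2N}, +∞)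
  (∀ p : ℝ, (p < y 1 ∨ y (2 * N) < p) →
    Tendsto (fun z => (h z).re) (𝓝[UHP] (p : ℂ)) (𝓝 0)) ∧
  -- (2) Re h equals one common constant on all (y_{2i}, y_{2i+1}), 1 ≤ i ≤ N-1
  (∃ c : ℝ, ∀ i : ℕ, 1 ≤ i → i ≤ N - 1 → ∀ p ∈ Set.Ioo (y (2 * i)) (y (2 * i + 1)),
    Tendsto (fun z => (h z).re) (𝓝[UHP] (p : ℂ)) (𝓝 c)) ∧
  -- (3) Im h is constant on each (y_{2i-1}, y_{2i}), 1 ≤ i ≤ N-1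
  (∀ i : ℕ, 1 ≤ i → i ≤ N - 1 → ∃ c : ℝ, ∀ p ∈ Set.Ioo (y (2 * i - 1)) (y (2 * i)),
    Tendsto (fun z => (h z).im) (𝓝[UHP] (p : ℂ)) (𝓝 c)) ∧
  -- (4) Im h = 0 on (y₁,y₂) ∪ (y_{2N-1},t) ∪ (s,y_{2N}) and Im h = 1 on (t,s)
  (∀ p ∈ Set.Ioo (y 1) (y 2) ∪ Set.Ioo (y (2 * N - 1)) t ∪ Set.Ioo s (y (2 * N)),
    Tendsto (fun z => (h z).im) (𝓝[UHP] (p : ℂ)) (𝓝 0)) ∧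
  (∀ p ∈ Set.Ioo t s, Tendsto (fun z => (h z).im) (𝓝[UHP] (p : ℂ)) (𝓝 1)) ∧
  -- (5) Im h is bounded on ℍ and continuous up to cl(ℍ) \ {t, s}
  (∃ C : ℝ, ∀ z ∈ UHP, |(h z).im| ≤ C) ∧
  (∃ g : ℂ → ℝ, ContinuousOn g (closure UHP \ {(t : ℂ), (s : ℂ)}) ∧
    ∀ z ∈ UHP, g z = (h z).im)

/-- The mixed boundary-value problem for the holomorphic observable `h̃(·, t, s; y₁,…,y_{2N})`,
with the Dirichlet-1 window `(t,s)` contained in `(y₁, y₂)`. -/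
def SolvesBVP' (N : ℕ) (y : ℕ → ℝ) (t s : ℝ) (h : ℂ → ℂ) : Prop :=
  -- holomorphic on ℍ
  DifferentiableOn ℂ h UHP ∧
  -- (1) Re h̃ = 0 on (-∞, y₁) ∪ (y_{2N}, +∞)
  (∀ p : ℝ, (p < y 1 ∨ y (2 * N) < p) →
    Tendsto (fun z => (h z).re) (𝓝[UHP] (p : ℂ)) (𝓝 0)) ∧
  -- (2) Re h̃ equals one common constant on all (y_{2i}, y_{2i+1}), 1 ≤ i ≤ N-1
  (∃ c : ℝ, ∀ i : ℕ, 1 ≤ i → i ≤ N - 1 → ∀ p ∈ Set.Ioo (y (2 * i)) (y (2 * i + 1)),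
    Tendsto (fun z => (h z).re) (𝓝[UHP] (p : ℂ)) (𝓝 c)) ∧
  -- (3) Im h̃ is constant on each (y_{2i-1}, y_{2i}), 2 ≤ i ≤ N
  (∀ i : ℕ, 2 ≤ i → i ≤ N → ∃ c : ℝ, ∀ p ∈ Set.Ioo (y (2 * i - 1)) (y (2 * i)),
    Tendsto (fun z => (h z).im) (𝓝[UHP] (p : ℂ)) (𝓝 c)) ∧
  -- (4) Im h̃ = 0 on (y_{2N-1},y_{2N}) ∪ (y₁,t) ∪ (s,y₂) and Im h̃ = 1 on (t,s)
  (∀ p ∈ Set.Ioo (y (2 * N - 1)) (y (2 * N)) ∪ Set.Ioo (y 1) t ∪ Set.Ioo s (y 2),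
    Tendsto (fun z => (h z).im) (𝓝[UHP] (p : ℂ)) (𝓝 0)) ∧
  (∀ p ∈ Set.Ioo t s, Tendsto (fun z => (h z).im) (𝓝[UHP] (p : ℂ)) (𝓝 1)) ∧
  -- (5) Im h̃ is bounded on ℍ and continuous up to cl(ℍ) \ {t, s}
  (∃ C : ℝ, ∀ z ∈ UHP, |(h z).im| ≤ C) ∧
  (∃ g : ℂ → ℝ, ContinuousOn g (closure UHP \ {(t : ℂ), (s : ℂ)}) ∧
    ∀ z ∈ UHP, g z = (h z).im)

/-- The closed upper half-plane. -/
def CUHP : Set ℂ := {z | 0 ≤ z.im}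

lemma mem_UHP {z : ℂ} : z ∈ UHP ↔ 0 < z.im := Iff.rfl

lemma mem_CUHP {z : ℂ} : z ∈ CUHP ↔ 0 ≤ z.im := Iff.rfl

lemma closure_UHP : closure UHP = CUHP := by
  have := Complex.closure_setOfPred_lt_im 0
  exact this

lemma isOpen_UHP : IsOpen UHP := isOpen_lt continuous_const Complex.continuous_im

lemma isClosed_CUHP : IsClosed CUHP := isClosed_le continuous_const Complex.continuous_im

lemma convex_UHP : Convex ℝ UHP := convex_halfSpace_im_gt 0

lemma UHP_sub : UHP ⊆ CUHP := fun z (hz : 0 < z.im) => (le_of_lt hz : 0 ≤ z.im)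

lemma real_mem_CUHP (p : ℝ) : (p : ℂ) ∈ CUHP := by simp [CUHP]

/-- Bound on compact sets from local bounds. -/
lemma compact_bound {F : ℂ → ℂ}
    (hb : ∀ p ∈ CUHP, ∃ C : ℝ, ∀ᶠ z in 𝓝[UHP] p, ‖F z‖ * √z.im ≤ C) (M : ℝ) :
    ∃ C : ℝ, ∀ z ∈ UHP, ‖z‖ ≤ M → ‖F z‖ * √z.im ≤ C := by
  have hK : IsCompact (closedBall (0:ℂ) M ∩ CUHP) :=
    (isCompact_closedBall 0 M).inter_right isClosed_CUHP
  have := hK.induction_on (p := fun S => ∃ C : ℝ, ∀ z ∈ S ∩ UHP, ‖F z‖ * √z.im ≤ C)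
    ⟨0, by simp⟩ (fun s t hst ⟨C, hC⟩ => ⟨C, fun z hz => hC z ⟨hst hz.1, hz.2⟩⟩)
    (fun s t ⟨C, hC⟩ ⟨C', hC'⟩ => ⟨max C C', by
      rintro z ⟨hz | hz, hz'⟩
      · exact (hC z ⟨hz, hz'⟩).trans (le_max_left _ _)
      · exact (hC' z ⟨hz, hz'⟩).trans (le_max_right _ _)⟩)
    (by
      intro p hp
      obtain ⟨C, hC⟩ := hb p hp.2
      refine ⟨{z | z ∈ UHP → ‖F z‖ * √z.im ≤ C}, ?_, C, fun z hz => hz.1 hz.2⟩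
      exact mem_nhdsWithin_of_mem_nhds (eventually_nhdsWithin_iff.1 hC))
  obtain ⟨C, hC⟩ := this
  exact ⟨C, fun z hz hz' => hC z ⟨⟨by simpa using hz', UHP_sub hz⟩, hz⟩⟩

lemma exists_primitive {F : ℂ → ℂ} (hF : DifferentiableOn ℂ F UHP)
    (hb : ∀ p ∈ CUHP, ∃ C : ℝ, ∀ᶠ z in 𝓝[UHP] p, ‖F z‖ * √z.im ≤ C) :
    ∃ H : ℂ → ℂ, ContinuousOn H CUHP ∧ ∀ z ∈ UHP, HasDerivAt H (F z) z := by
  obtain ⟨g, hg⟩ := convex_UHP.exists_forall_hasDerivWithinAt hF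
  have hg' : ∀ z ∈ UHP, HasDerivAt g (F z) z := fun z hz =>
    (hg z hz).hasDerivAt (isOpen_UHP.mem_nhds hz)
  have hFc : ContinuousOn F UHP := hF.continuousOn
  have him : ∀ (z : ℂ) (r : ℝ), (I + r * (z - I)).im = (1 - r) + r * z.im := by
    intro z r; simp; ring
  have hmem : ∀ z ∈ CUHP, ∀ r : ℝ, 0 ≤ r → r < 1 → I + r * (z - I) ∈ UHP := by
    intro z hz r h0 h1
    rw [mem_UHP]
    rw [him]
    have : 0 ≤ r * z.im := mul_nonneg h0 hz
    linarith
  let H : ℂ → ℂ := fun z => ∫ r in (0:ℝ)..1, F (I + r * (z - I)) * (z - I)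
  have hline : ∀ z : ℂ, Continuous (fun r : ℝ => I + (r:ℂ) * (z - I)) := by
    intro z; fun_prop
  refine ⟨H, ?_, ?_⟩
  · intro z0 hz0
    obtain ⟨C, hC⟩ := compact_bound hb (‖z0‖ + 2)
    refine intervalIntegral.continuousWithinAt_of_dominated_interval
      (bound := fun r => max C 0 * (1 - r) ^ (-(1/2:ℝ)) * (‖z0‖ + 2)) ?_ ?_ ?_ ?_
    · filter_upwards [self_mem_nhdsWithin] with z hz
      rw [uIoc_of_le zero_le_one, ← MeasureTheory.restrict_Ioo_eq_restrict_Ioc]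
      apply ContinuousOn.aestronglyMeasurable _ measurableSet_Ioo
      apply ContinuousOn.mul _ continuousOn_const
      exact hFc.comp (hline z).continuousOn (fun r hr => hmem z hz r hr.1.le hr.2)
    · have : ∀ᶠ z in 𝓝[CUHP] z0, ‖z‖ < ‖z0‖ + 1 :=
        (continuous_norm.continuousAt.eventually_lt_const (by simp)).filter_mono
          nhdsWithin_le_nhds
      filter_upwards [self_mem_nhdsWithin, this] with z hz hzn
      filter_upwards [MeasureTheory.Measure.ae_ne MeasureTheory.volume (1:ℝ)] with r hr1 hr
      rw [uIoc_of_le zero_le_one] at hr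
      have hr' : r < 1 := lt_of_le_of_ne hr.2 hr1
      have hw := hmem z hz r hr.1.le hr'
      have hnw : ‖I + (r:ℂ) * (z - I)‖ ≤ ‖z0‖ + 2 := by
        have : I + (r:ℂ) * (z - I) = ((1 - r : ℝ):ℂ) * I + (r:ℂ) * z := by
          push_cast; ring
        rw [this]
        refine (norm_add_le _ _).trans ?_
        rw [norm_mul, norm_mul, Complex.norm_real, Complex.norm_real, Complex.norm_I,
          Real.norm_of_nonneg hr.1.le, Real.norm_of_nonneg (by linarith)]
        nlinarith [norm_nonneg z, norm_nonneg z0, hr.1]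
      have h1 := hC _ hw hnw
      have h2 : (1 - r) ≤ (I + (r:ℂ) * (z - I)).im := by
        rw [him]; have := mul_nonneg hr.1.le hz; linarith
      have h3 : √(1 - r) ≤ √(I + (r:ℂ) * (z - I)).im := Real.sqrt_le_sqrt h2
      have h4 : 0 < √(1 - r) := Real.sqrt_pos.2 (by linarith)
      have h5 : ‖F (I + (r:ℂ) * (z - I))‖ ≤ max C 0 * (1 - r) ^ (-(1/2:ℝ)) := by
        rw [Real.rpow_neg (by linarith), ← Real.sqrt_eq_rpow, ← div_eq_mul_inv, le_div_iff₀ h4]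
        calc _ ≤ ‖F (I + (r:ℂ) * (z - I))‖ * √(I + (r:ℂ) * (z - I)).im := by gcongr
          _ ≤ C := h1
          _ ≤ _ := le_max_left _ _
      rw [norm_mul]
      have h6 : ‖z - I‖ ≤ ‖z0‖ + 2 := by
        refine (norm_sub_le _ _).trans ?_
        rw [Complex.norm_I]; linarith
      gcongr
    · apply IntervalIntegrable.mul_const
      apply IntervalIntegrable.const_mul
      have := (intervalIntegral.intervalIntegrable_rpow' (a := 0) (b := 1)
        (r := -(1/2:ℝ)) (by norm_num)).comp_sub_left 1
      simpa using this.symm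
    · filter_upwards [MeasureTheory.Measure.ae_ne MeasureTheory.volume (1:ℝ)] with r hr1 hr
      rw [uIoc_of_le zero_le_one] at hr
      have hr' : r < 1 := lt_of_le_of_ne hr.2 hr1
      apply ContinuousAt.continuousWithinAt
      have hw := hmem z0 hz0 r hr.1.le hr'
      have := hFc.continuousAt (isOpen_UHP.mem_nhds hw)
      apply ContinuousAt.mul _ (by fun_prop)
      exact ContinuousAt.comp (f := fun z : ℂ => I + (r:ℂ) * (z - I)) this (by fun_prop)
  · intro z hz
    have key : ∀ z ∈ UHP, H z = g z - g I := by
      intro z hz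
      have hmem' : ∀ r ∈ uIcc (0:ℝ) 1, I + (r:ℂ) * (z - I) ∈ UHP := by
        intro r hr
        rw [uIcc_of_le zero_le_one] at hr
        rw [mem_UHP]
        rw [him]
        have hz' : 0 < z.im := hz
        rcases hr.1.eq_or_lt with h | h
        · rw [← h]; simp
        · have := mul_pos h hz'; linarith [hr.2]
      have := intervalIntegral.integral_eq_sub_of_hasDerivAt (a := (0:ℝ)) (b := 1)
        (f := fun r : ℝ => g (I + (r:ℂ) * (z - I)))
        (f' := fun r : ℝ => F (I + (r:ℂ) * (z - I)) * (z - I)) ?_ ?_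
      · simpa [H] using this
      · intro r hr
        have h1 : HasDerivAt (fun r : ℝ => I + (r:ℂ) * (z - I)) (1 * (z - I)) r :=
          ((Complex.ofRealCLM.hasDerivAt (x := r)).mul_const (z - I)).const_add I
        have := (hg' _ (hmem' r hr)).comp_of_eq r h1 rfl
        simpa [Function.comp_def] using this
      · apply ContinuousOn.intervalIntegrable
        apply ContinuousOn.mul _ continuousOn_const
        exact hFc.comp (hline z).continuousOn hmem'
    have h1 : HasDerivAt (fun z => g z - g I) (F z) z := (hg' z hz).sub_const _
    refine h1.congr_of_eventuallyEq ?_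
    filter_upwards [isOpen_UHP.mem_nhds hz] with w hw using key w hw

lemma boundary_deriv {F H : ℂ → ℂ} (hc : ContinuousOn H CUHP)
    (hd : ∀ z ∈ UHP, HasDerivAt H (F z) z) {p : ℝ} (hp : ContinuousWithinAt F UHP p) :
    HasDerivAt (fun x : ℝ => H x) (F p) p := by
  let L : ℂ → (ℂ →L[ℝ] ℂ) := fun w => (ContinuousLinearMap.toSpanSingleton ℂ w).restrictScalars ℝ
  have hL : Continuous L := by
    have : L = fun w => (ContinuousLinearMap.mul ℝ ℂ w) := by
      ext w; simp [L, mul_comm]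
    rw [this]
    exact (ContinuousLinearMap.mul ℝ ℂ).continuous
  have hfd : ∀ z ∈ UHP, HasFDerivAt (𝕜 := ℝ) H (L (F z)) z := fun z hz =>
    (hd z hz).hasFDerivAt.restrictScalars ℝ
  have := hasFDerivWithinAt_closure_of_tendsto_fderiv (f := H) (s := UHP) (x := (p:ℂ))
    (f' := L (F p)) (fun z hz => (hfd z hz).differentiableAt.differentiableWithinAt)
    convex_UHP isOpen_UHP
    (fun z hz => (hc z (by rwa [closure_UHP] at hz)).mono UHP_sub)
    (by
      have h1 : Tendsto (fun z => L (F z)) (𝓝[UHP] (p:ℂ)) (𝓝 (L (F p))) :=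
        (hL.tendsto _).comp hp
      refine h1.congr' ?_
      filter_upwards [self_mem_nhdsWithin] with z hz using (hfd z hz).fderiv.symm)
  rw [closure_UHP] at this
  have h2 := this.comp_hasDerivWithinAt (f := fun x : ℝ => (x:ℂ)) (t := CUHP) (s := univ) p
    (Complex.ofRealCLM.hasDerivAt (x := p)).hasDerivWithinAt (fun x _ => real_mem_CUHP x)
  have h3 := hasDerivWithinAt_univ.1 h2
  simpa [L, Function.comp_def] using h3

lemma lim_infty {h h' : ℂ → ℂ} (hd : ∀ z ∈ UHP, HasDerivAt h (h' z) z)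
    (hO : h' =O[Bornology.cobounded ℂ ⊓ 𝓟 UHP] fun z => (z ^ 2)⁻¹) :
    ∃ l : ℂ, Tendsto h (Bornology.cobounded ℂ ⊓ 𝓟 UHP) (𝓝 l) := by
  obtain ⟨C, hC⟩ := hO.bound
  rw [eventually_inf_principal] at hC
  obtain ⟨M, hM⟩ : ∃ M : ℝ, ∀ z : ℂ, M ≤ ‖z‖ → z ∈ UHP → ‖h' z‖ ≤ C * ‖(z ^ 2)⁻¹‖ := by
    rw [← comap_norm_atTop, eventually_comap, eventually_atTop] at hC
    obtain ⟨M, hM⟩ := hC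
    exact ⟨M, fun z hz hz' => hM _ hz z rfl hz'⟩
  let M' := max M 1
  have hM'0 : 0 < M' := lt_of_lt_of_le one_pos (le_max_right _ _)
  let S : Set ℂ := ball 0 (M'⁻¹) ∩ UHP
  have hS : Convex ℝ S := (convex_ball _ _).inter convex_UHP
  have hinv : ∀ w ∈ UHP, -w⁻¹ ∈ UHP := by
    intro w hw
    have hw' : 0 < w.im := hw
    have : w ≠ 0 := by rintro rfl; simp at hw'
    rw [mem_UHP]
    rw [Complex.neg_im, Complex.inv_im, neg_div, neg_neg]
    exact div_pos hw' (Complex.normSq_pos.2 this)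
  let g : ℂ → ℂ := fun w => h (-w⁻¹)
  have hgd : ∀ w ∈ S, HasDerivWithinAt g (h' (-w⁻¹) * (w ^ 2)⁻¹) S w := by
    intro w hw
    have hw0 : w ≠ 0 := by rintro rfl; exact absurd hw.2 (by simp [UHP])
    have h1 := (hasDerivAt_inv hw0).neg
    have h2 := (hd _ (hinv w hw.2)).comp_of_eq w h1 rfl
    simp only [neg_neg] at h2
    exact h2.hasDerivWithinAt
  have hbd : ∀ w ∈ S, ‖h' (-w⁻¹) * (w ^ 2)⁻¹‖ ≤ C := by
    intro w hw
    have hw0 : w ≠ 0 := by rintro rfl; exact absurd hw.2 (by simp [UHP])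
    have hwn : 0 < ‖w‖ := norm_pos_iff.2 hw0
    have h1 : ‖w‖ < M'⁻¹ := by simpa using hw.1
    have h2 : M' < ‖w‖⁻¹ := by rwa [lt_inv_comm₀ hM'0 hwn]
    have h3 := hM (-w⁻¹) (by rw [norm_neg, norm_inv]; exact (le_max_left _ _).trans h2.le)
      (hinv w hw.2)
    rw [norm_mul]
    have h4 : ‖((-w⁻¹) ^ 2)⁻¹‖ = ‖w‖ ^ 2 := by simp
    rw [h4] at h3
    rw [norm_inv, norm_pow, ← div_eq_mul_inv, div_le_iff₀ (by positivity)]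
    exact h3
  have hlip := hS.lipschitzOnWith_of_nnnorm_hasDerivWithin_le (C := C.toNNReal) hgd (by
    intro w hw
    rw [← NNReal.coe_le_coe]
    exact (hbd w hw).trans (Real.le_coe_toNNReal C))
  have hne : (𝓝[S] (0:ℂ)).NeBot := by
    have : 𝓝[S] (0:ℂ) = 𝓝[UHP] 0 := by
      simp only [S]
      rw [inter_comm]
      exact nhdsWithin_inter_of_mem' (mem_nhdsWithin_of_mem_nhds (ball_mem_nhds _ (inv_pos.2 hM'0)))
    rw [this]
    apply mem_closure_iff_nhdsWithin_neBot.1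
    rw [closure_UHP]; simp [CUHP]
  have hcau : Cauchy (map g (𝓝[S] (0:ℂ))) :=
    (cauchy_nhds.mono nhdsWithin_le_nhds).map_of_le hlip.uniformContinuousOn
      (le_principal_iff.2 self_mem_nhdsWithin)
  obtain ⟨l, hl⟩ := CompleteSpace.complete hcau
  refine ⟨l, ?_⟩
  have h1 : Tendsto (fun z : ℂ => -z⁻¹) (Bornology.cobounded ℂ ⊓ 𝓟 UHP) (𝓝[S] 0) := by
    rw [tendsto_nhdsWithin_iff]
    have h2 : Tendsto (fun z : ℂ => -z⁻¹) (Bornology.cobounded ℂ ⊓ 𝓟 UHP) (𝓝 0) := by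
      have := (tendsto_inv₀_cobounded (α := ℂ)).neg
      rw [neg_zero] at this
      exact this.mono_left inf_le_left
    refine ⟨h2, ?_⟩
    filter_upwards [h2 (ball_mem_nhds _ (inv_pos.2 hM'0)), mem_inf_of_right (mem_principal_self UHP)]
      with z hz hz'
    exact ⟨hz, hinv z hz'⟩
  have h2 : Tendsto g (𝓝[S] 0) (𝓝 l) := hl
  refine (h2.comp h1).congr ?_
  intro z
  simp [g]

/-- Branch of `log (z - a)` (up to a constant) cut along the downward vertical ray. -/
def lg (a : ℝ) (z : ℂ) : ℂ := Complex.log (-I * (z - a))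

/-- Branch of the square root of `-I (z - a)`. -/
def rt (a : ℝ) (z : ℂ) : ℂ := Complex.exp (lg a z / 2)

/-- Branch of `√((z - a)(z - b))` asymptotic to `z`. -/
def DD (a b : ℝ) (z : ℂ) : ℂ := I * (rt a z * rt b z)

/-- The product of all the square roots. -/
def RR (N : ℕ) (a b : ℕ → ℝ) (z : ℂ) : ℂ := ∏ m ∈ Finset.range N, DD (a m) (b m) z

/-- Ordered configuration of intervals. -/
structure Cfg (N : ℕ) (a b : ℕ → ℝ) : Prop where
  ab : ∀ m < N, a m < b m
  ba : ∀ m m', m < m' → m' < N → b m < a m'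

lemma slit {a : ℝ} {z : ℂ} (hz : z ∈ CUHP) (hza : z ≠ a) : -I * (z - a) ∈ slitPlane := by
  rw [mem_slitPlane_iff]
  have h : 0 ≤ z.im := hz
  rcases h.lt_or_eq with h | h
  · left; simpa using h
  · right
    intro h2
    apply hza
    apply Complex.ext
    · have : z.re - a = 0 := by simpa [sub_eq_zero, eq_comm] using h2
      simp; linarith
    · simp [← h]

lemma lg_hasDerivAt {a : ℝ} {z : ℂ} (hz : z ∈ CUHP) (hza : z ≠ a) :
    HasDerivAt (lg a) (1 / (z - a)) z := by
  have h1 : HasDerivAt (fun z : ℂ => -I * (z - a)) (-I * 1) z :=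
    ((hasDerivAt_id z).sub_const _).const_mul _
  have := h1.clog (slit hz hza)
  have e : 1 / (z - a) = -I * 1 / (-I * (z - a)) := by
    have h0 : z - a ≠ 0 := sub_ne_zero.2 hza
    have hI : I ≠ 0 := I_ne_zero
    rw [mul_div_mul_left _ _ (neg_ne_zero.2 hI)]
  rw [e]
  exact this

lemma lg_gt {a x : ℝ} (h : a < x) : lg a x = Real.log (x - a) - Real.pi / 2 * I := by
  have : -I * ((x:ℂ) - a) = ((x - a : ℝ) : ℂ) * (-I) := by push_cast; ring
  rw [lg, this, Complex.log_ofReal_mul (by linarith) (by simp), Complex.log_neg_I]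
  ring

lemma lg_lt {a x : ℝ} (h : x < a) : lg a x = Real.log (a - x) + Real.pi / 2 * I := by
  have : -I * ((x:ℂ) - a) = ((a - x : ℝ) : ℂ) * I := by push_cast; ring
  rw [lg, this, Complex.log_ofReal_mul (by linarith) (by simp), Complex.log_I]

lemma lg_im_le (a : ℝ) (z : ℂ) : |(lg a z).im| ≤ Real.pi := by
  rw [lg, Complex.log_im]; exact Complex.abs_arg_le_pi _

lemma rt_ne (a : ℝ) (z : ℂ) : rt a z ≠ 0 := Complex.exp_ne_zero _

lemma rt_diff {a : ℝ} {z : ℂ} (hz : z ∈ CUHP) (hza : z ≠ a) : DifferentiableAt ℂ (rt a) z :=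
  ((lg_hasDerivAt hz hza).differentiableAt.div_const 2).cexp

lemma rt_norm {a : ℝ} {z : ℂ} (hza : z ≠ a) : ‖rt a z‖ = √‖z - a‖ := by
  have h0 : 0 < ‖z - a‖ := norm_pos_iff.2 (sub_ne_zero.2 hza)
  have h1 : (lg a z / 2).re = Real.log ‖z - a‖ / 2 := by
    have : (lg a z / 2).re = (lg a z).re / 2 := by simp
    rw [this, lg, Complex.log_re]; simp
  rw [rt, Complex.norm_exp, h1, Real.sqrt_eq_rpow, Real.rpow_def_of_pos h0]
  ring_nf

lemma rt_ge {a : ℝ} {z : ℂ} (hz : z ∈ UHP) : √z.im ≤ ‖rt a z‖ := by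
  have hz' : 0 < z.im := hz
  have : z ≠ a := by rintro rfl; simp at hz'
  rw [rt_norm this]
  apply Real.sqrt_le_sqrt
  have := Complex.abs_im_le_norm (z - a)
  simp at this
  exact (le_abs_self _).trans this

lemma DD_ne (a b : ℝ) (z : ℂ) : DD a b z ≠ 0 :=
  mul_ne_zero I_ne_zero (mul_ne_zero (rt_ne _ _) (rt_ne _ _))

lemma DD_diff {a b : ℝ} {z : ℂ} (hz : z ∈ CUHP) (hza : z ≠ a) (hzb : z ≠ b) :
    DifferentiableAt ℂ (DD a b) z :=
  ((rt_diff hz hza).mul (rt_diff hz hzb)).const_mul I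

lemma DD_eq (a b : ℝ) (z : ℂ) : DD a b z = I * Complex.exp ((lg a z + lg b z) / 2) := by
  rw [DD, rt, rt, ← Complex.exp_add]; ring_nf

lemma DD_gt {a b x : ℝ} (ha : a < x) (hb : b < x) : ∃ ρ : ℝ, 0 < ρ ∧ DD a b x = ρ := by
  refine ⟨Real.exp ((Real.log (x - a) + Real.log (x - b)) / 2), Real.exp_pos _, ?_⟩
  rw [DD_eq, lg_gt ha, lg_gt hb]
  have : ((Real.log (x - a) - Real.pi / 2 * I : ℂ) + (Real.log (x - b) - Real.pi / 2 * I)) / 2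
    = ((Real.log (x - a) + Real.log (x - b)) / 2 : ℝ) + -(Real.pi / 2 * I) := by
    push_cast; ring
  rw [this, Complex.exp_add, Complex.exp_neg, Complex.exp_pi_div_two_mul_I, Complex.ofReal_exp]
  field_simp

lemma DD_lt {a b x : ℝ} (ha : x < a) (hb : x < b) : ∃ ρ : ℝ, 0 < ρ ∧ DD a b x = -ρ := by
  refine ⟨Real.exp ((Real.log (a - x) + Real.log (b - x)) / 2), Real.exp_pos _, ?_⟩
  rw [DD_eq, lg_lt ha, lg_lt hb]
  have : ((Real.log (a - x) + Real.pi / 2 * I : ℂ) + (Real.log (b - x) + Real.pi / 2 * I)) / 2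
    = ((Real.log (a - x) + Real.log (b - x)) / 2 : ℝ) + (Real.pi / 2 * I) := by
    push_cast; ring
  rw [this, Complex.exp_add, Complex.exp_pi_div_two_mul_I, Complex.ofReal_exp]
  linear_combination (Complex.exp ((Real.log (a - x) + Real.log (b - x)) / 2 : ℝ)) * Complex.I_mul_I

lemma DD_mid {a b x : ℝ} (ha : a < x) (hb : x < b) : ∃ ρ : ℝ, 0 < ρ ∧ DD a b x = I * ρ := by
  refine ⟨Real.exp ((Real.log (x - a) + Real.log (b - x)) / 2), Real.exp_pos _, ?_⟩
  rw [DD_eq, lg_gt ha, lg_lt hb]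
  have : ((Real.log (x - a) - Real.pi / 2 * I : ℂ) + (Real.log (b - x) + Real.pi / 2 * I)) / 2
    = ((Real.log (x - a) + Real.log (b - x)) / 2 : ℝ) := by
    push_cast; ring
  rw [this, Complex.ofReal_exp]

lemma DD_norm {a b : ℝ} {z : ℂ} (hza : z ≠ a) (hzb : z ≠ b) :
    ‖DD a b z‖ = √‖z - a‖ * √‖z - b‖ := by
  rw [DD, norm_mul, norm_mul, rt_norm hza, rt_norm hzb, Complex.norm_I, one_mul]

lemma DD_inv_isBigO (a b : ℝ) :
    (fun z => (DD a b z)⁻¹) =O[Bornology.cobounded ℂ] fun z : ℂ => z⁻¹ := by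
  apply Asymptotics.IsBigO.of_bound 2
  have h1 : ∀ᶠ z : ℂ in Bornology.cobounded ℂ, 2 * |a| + 2 * |b| + 1 ≤ ‖z‖ :=
    (tendsto_norm_cobounded_atTop (E := ℂ)).eventually_ge_atTop _
  filter_upwards [h1] with z hz
  have ha := abs_nonneg a
  have hb := abs_nonneg b
  have key : ∀ c : ℝ, 2 * |c| + 1 ≤ ‖z‖ → z ≠ c ∧ √(‖z‖ / 2) ≤ √‖z - c‖ := by
    intro c hc
    have h2 : ‖z‖ / 2 ≤ ‖z - c‖ := by
      have := norm_sub_norm_le z (c:ℂ)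
      rw [Complex.norm_real, Real.norm_eq_abs] at this
      linarith
    refine ⟨?_, Real.sqrt_le_sqrt h2⟩
    rintro rfl
    rw [Complex.norm_real, Real.norm_eq_abs] at hc
    linarith [abs_nonneg c]
  obtain ⟨ha1, ha2⟩ := key a (by linarith)
  obtain ⟨hb1, hb2⟩ := key b (by linarith)
  have hz0 : 0 < ‖z‖ := by linarith
  rw [norm_inv, norm_inv, DD_norm ha1 hb1]
  have h3 : ‖z‖ / 2 ≤ √‖z - a‖ * √‖z - b‖ := by
    calc ‖z‖ / 2 = √(‖z‖ / 2) * √(‖z‖ / 2) := (Real.mul_self_sqrt (by positivity)).symm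
      _ ≤ _ := by gcongr
  calc (√‖z - a‖ * √‖z - b‖)⁻¹ ≤ (‖z‖ / 2)⁻¹ := by gcongr
    _ = 2 * ‖z‖⁻¹ := by field_simp

lemma RR_ne (N : ℕ) (a b : ℕ → ℝ) (z : ℂ) : RR N a b z ≠ 0 :=
  Finset.prod_ne_zero_iff.2 fun _ _ => DD_ne _ _ _

/-- `z` is not one of the marked points. -/
def Off (N : ℕ) (a b : ℕ → ℝ) (z : ℂ) : Prop := ∀ m < N, z ≠ a m ∧ z ≠ b m

lemma off_of_UHP {N : ℕ} {a b : ℕ → ℝ} {z : ℂ} (hz : z ∈ UHP) : Off N a b z := by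
  have h : 0 < z.im := hz
  intro m _
  constructor <;> (rintro rfl; simp at h)

lemma RR_diff {N : ℕ} {a b : ℕ → ℝ} {z : ℂ} (hz : z ∈ CUHP) (ho : Off N a b z) :
    DifferentiableAt ℂ (RR N a b) z := by
  unfold RR
  apply DifferentiableAt.fun_finsetProd
  intro m hm
  have := ho m (Finset.mem_range.1 hm)
  exact DD_diff hz this.1 this.2

lemma RR_inv_isBigO (N : ℕ) (a b : ℕ → ℝ) :
    (fun z => (RR N a b z)⁻¹) =O[Bornology.cobounded ℂ] fun z : ℂ => (z ^ N)⁻¹ := by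
  have := Asymptotics.IsBigO.finsetProd (s := Finset.range N) (l := Bornology.cobounded ℂ)
    (f := fun m z => (DD (a m) (b m) z)⁻¹) (g := fun _ (z : ℂ) => z⁻¹)
    (fun m _ => DD_inv_isBigO (a m) (b m))
  simpa [RR, Finset.prod_inv_distrib] using this

lemma local_bound_of_cont {G : ℂ → ℂ} {p : ℂ} (h : ContinuousAt G p) :
    ∃ C : ℝ, 0 ≤ C ∧ ∀ᶠ z in 𝓝[UHP] p, ‖G z‖ ≤ C := by
  refine ⟨‖G p‖ + 1, by positivity, ?_⟩
  exact (h.norm.eventually_le_const (by simp)).filter_mono nhdsWithin_le_nhds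

lemma sqrt_im_bound (p : ℂ) : ∃ C : ℝ, 0 ≤ C ∧ ∀ᶠ z in 𝓝[UHP] p, √z.im ≤ C := by
  refine ⟨√p.im + 1, by positivity, ?_⟩
  have : ContinuousAt (fun z : ℂ => √z.im) p :=
    (Real.continuous_sqrt.comp Complex.continuous_im).continuousAt
  exact (this.eventually_le_const (by simp)).filter_mono nhdsWithin_le_nhds

lemma RR_inv_bound {N : ℕ} {a b : ℕ → ℝ} (hc : Cfg N a b) {p : ℂ} (hp : p ∈ CUHP) :
    ∃ C : ℝ, 0 ≤ C ∧ ∀ᶠ z in 𝓝[UHP] p, ‖(RR N a b z)⁻¹‖ * √z.im ≤ C := by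
  by_cases ho : Off N a b p
  · obtain ⟨C, hC0, hC⟩ := local_bound_of_cont ((RR_diff hp ho).inv (RR_ne _ _ _ _)).continuousAt
    obtain ⟨C', hC0', hC'⟩ := sqrt_im_bound p
    refine ⟨C * C', by positivity, ?_⟩
    filter_upwards [hC, hC'] with z h1 h2
    exact mul_le_mul h1 h2 (Real.sqrt_nonneg _) hC0
  · have key : ∀ m < N, ∀ v w : ℝ, (∀ z, DD (a m) (b m) z = I * (rt v z * rt w z)) → p ≠ w →
        (∀ m' < N, m' ≠ m → p ≠ a m' ∧ p ≠ b m') →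
        ∃ C : ℝ, 0 ≤ C ∧ ∀ᶠ z in 𝓝[UHP] p, ‖(RR N a b z)⁻¹‖ * √z.im ≤ C := by
      intro m hm v w hD hpw hoth
      let G : ℂ → ℂ := fun z => rt w z * ∏ m' ∈ (Finset.range N).erase m, DD (a m') (b m') z
      have hG0 : G p ≠ 0 :=
        mul_ne_zero (rt_ne _ _) (Finset.prod_ne_zero_iff.2 fun _ _ => DD_ne _ _ _)
      have hGd : DifferentiableAt ℂ G p := by
        apply (rt_diff hp hpw).mul
        apply DifferentiableAt.fun_finsetProd
        intro m' hm'
        rw [Finset.mem_erase, Finset.mem_range] at hm'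
        have := hoth m' hm'.2 hm'.1
        exact DD_diff hp this.1 this.2
      obtain ⟨C, hC0, hC⟩ := local_bound_of_cont (hGd.inv hG0).continuousAt
      refine ⟨C, hC0, ?_⟩
      filter_upwards [hC, self_mem_nhdsWithin] with z h1 hz
      have h2 : RR N a b z = I * rt v z * G z := by
        rw [RR, ← Finset.mul_prod_erase _ _ (Finset.mem_range.2 hm), hD]
        simp only [G]; ring
      have h3 := rt_ge (a := v) hz
      have h4 : 0 < ‖rt v z‖ := norm_pos_iff.2 (rt_ne _ _)
      have h1' : ‖G z‖⁻¹ ≤ C := by simpa using h1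
      calc ‖(RR N a b z)⁻¹‖ * √z.im ≤ ‖(RR N a b z)⁻¹‖ * ‖rt v z‖ := by gcongr
        _ = ‖G z‖⁻¹ := by
          rw [h2, norm_inv, norm_mul, norm_mul, Complex.norm_I]
          by_cases hg : ‖G z‖ = 0
          · simp [hg]
          · field_simp
        _ ≤ C := h1'
    have hd : ∀ m < N, ∀ m' < N, m' ≠ m → ∀ v ∈ Icc (a m) (b m), v ≠ a m' ∧ v ≠ b m' := by
      intro m hm m' hm' hne v hv
      have h1 := hc.ab m hm
      have h2 := hc.ab m' hm'
      rcases lt_or_gt_of_ne hne with h | h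
      · have := hc.ba m' m h hm
        exact ⟨by linarith [hv.1] |> fun (q : a m' < v) => q.ne', by linarith [hv.1] |> fun (q : b m' < v) => q.ne'⟩
      · have := hc.ba m m' h hm'
        exact ⟨by linarith [hv.2] |> fun (q : v < a m') => q.ne, by linarith [hv.2] |> fun (q : v < b m') => q.ne⟩
    simp only [Off, not_forall] at ho
    obtain ⟨m, hm, hno⟩ := ho
    have hab := hc.ab m hm
    by_cases h : p = a m
    · refine key m hm (a m) (b m) (fun z => rfl) ?_ ?_
      · rw [h]; exact_mod_cast hab.ne
      · intro m' hm' hne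
        have := hd m hm m' hm' hne (a m) ⟨le_rfl, hab.le⟩
        rw [h]; exact_mod_cast this
    · have h' : p = b m := by tauto
      refine key m hm (b m) (a m) (fun z => by rw [DD, mul_comm (rt _ _)]) h ?_
      intro m' hm' hne
      have := hd m hm m' hm' hne (b m) ⟨hab.le, le_rfl⟩
      rw [h']; exact_mod_cast this

lemma RR_analytic {N : ℕ} {a b : ℕ → ℝ} {z : ℂ} (hz : z ∈ CUHP) (ho : Off N a b z) :
    AnalyticAt ℂ (RR N a b) z := by
  have hl : ∀ c : ℝ, z ≠ c → AnalyticAt ℂ (rt c) z := by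
    intro c hzc
    have h1 : AnalyticAt ℂ (lg c) z := by
      unfold lg
      exact AnalyticAt.clog (by fun_prop) (slit hz hzc)
    have h2 : AnalyticAt ℂ (fun w => lg c w / 2) z := h1.div_const
    exact h2.cexp
  unfold RR
  apply Finset.analyticAt_fun_prod
  intro m hm
  have := ho m (Finset.mem_range.1 hm)
  exact analyticAt_const.mul ((hl _ this.1).mul (hl _ this.2))

lemma bound_comb {N : ℕ} {a b : ℕ → ℝ} (hc : Cfg N a b) {p : ℂ} (hp : p ∈ CUHP)
    {A B F : ℂ → ℂ} (hA : ContinuousAt A p) (hB : ContinuousAt B p)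
    (hF : ∀ᶠ z in 𝓝[UHP] p, F z = A z * (RR N a b z)⁻¹ + B z) :
    ∃ C : ℝ, ∀ᶠ z in 𝓝[UHP] p, ‖F z‖ * √z.im ≤ C := by
  obtain ⟨C1, h10, h1⟩ := local_bound_of_cont hA
  obtain ⟨C2, h20, h2⟩ := local_bound_of_cont hB
  obtain ⟨C3, h30, h3⟩ := RR_inv_bound hc hp
  obtain ⟨C4, h40, h4⟩ := sqrt_im_bound p
  refine ⟨C1 * C3 + C2 * C4, ?_⟩
  filter_upwards [hF, h1, h2, h3, h4] with z hz k1 k2 k3 k4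
  rw [hz]
  have h5 : ‖A z * (RR N a b z)⁻¹ + B z‖ ≤ ‖A z‖ * ‖(RR N a b z)⁻¹‖ + ‖B z‖ := by
    refine (norm_add_le _ _).trans ?_
    rw [norm_mul]
  calc _ ≤ (‖A z‖ * ‖(RR N a b z)⁻¹‖ + ‖B z‖) * √z.im := by gcongr
    _ = ‖A z‖ * (‖(RR N a b z)⁻¹‖ * √z.im) + ‖B z‖ * √z.im := by ring
    _ ≤ _ := by gcongr

/-- `H` is a primitive of `F`, continuous up to the boundary. -/
def Prim (N : ℕ) (a b : ℕ → ℝ) (F H : ℂ → ℂ) : Prop :=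
  ContinuousOn H CUHP ∧ (∀ z ∈ UHP, HasDerivAt H (F z) z) ∧
    ∀ p : ℝ, Off N a b p → HasDerivAt (fun x : ℝ => H x) (F p) p

lemma exists_Prim {N : ℕ} {a b : ℕ → ℝ} {F : ℂ → ℂ}
    (hd : ∀ z ∈ CUHP, Off N a b z → DifferentiableAt ℂ F z)
    (hb : ∀ p ∈ CUHP, ¬ Off N a b p → ∃ C : ℝ, ∀ᶠ z in 𝓝[UHP] p, ‖F z‖ * √z.im ≤ C) :
    ∃ H, Prim N a b F H := by
  obtain ⟨H, h1, h2⟩ := exists_primitive (F := F)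
    (fun z hz => (hd z (UHP_sub hz) (off_of_UHP hz)).differentiableWithinAt)
    (by
      intro p hp
      by_cases ho : Off N a b p
      · obtain ⟨C, hC0, hC⟩ := local_bound_of_cont (hd p hp ho).continuousAt
        obtain ⟨C', hC0', hC'⟩ := sqrt_im_bound p
        refine ⟨C * C', ?_⟩
        filter_upwards [hC, hC'] with z h1 h2
        exact mul_le_mul h1 h2 (Real.sqrt_nonneg _) hC0
      · exact hb p hp ho)
  refine ⟨H, h1, h2, fun p hp => ?_⟩
  exact boundary_deriv h1 h2 (hd p (real_mem_CUHP p) hp).continuousAt.continuousWithinAt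

lemma exists_E {N : ℕ} {a b : ℕ → ℝ} (hc : Cfg N a b) (k : ℕ) :
    ∃ H, Prim N a b (fun z => I * z ^ k * (RR N a b z)⁻¹) H := by
  apply exists_Prim
  · intro z hz ho
    exact (by fun_prop : DifferentiableAt ℂ (fun z : ℂ => I * z ^ k) z).mul
      ((RR_diff hz ho).inv (RR_ne _ _ _ _))
  · intro p hp _
    exact bound_comb hc hp (A := fun z => I * z ^ k) (B := fun _ => 0) (by fun_prop) (by fun_prop)
      (Eventually.of_forall fun z => by simp)

/-- The regular part of the pole function. -/
def ff (N : ℕ) (a b : ℕ → ℝ) (q : ℝ) (z : ℂ) : ℂ :=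
  RR N a b q * dslope (fun z => (RR N a b z)⁻¹) (q : ℂ) z

lemma ff_of_ne (N : ℕ) (a b : ℕ → ℝ) (q : ℝ) {z : ℂ} (hz : z ≠ q) :
    ff N a b q z = RR N a b q * (RR N a b z)⁻¹ * (z - q)⁻¹ - (z - q)⁻¹ := by
  rw [ff, dslope_of_ne _ hz, slope_def_field]
  have h1 := RR_ne N a b q
  have h2 := RR_ne N a b z
  have h3 : z - q ≠ 0 := sub_ne_zero.2 hz
  field_simp

lemma exists_K {N : ℕ} {a b : ℕ → ℝ} (hc : Cfg N a b) {q : ℝ} (hq : Off N a b q) :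
    ∃ H, Prim N a b (ff N a b q) H := by
  apply exists_Prim
  · intro z hz ho
    apply DifferentiableAt.const_mul
    by_cases h : z = q
    · subst h
      have h1 : AnalyticAt ℂ (fun z => (RR N a b z)⁻¹) (q:ℂ) := (RR_analytic hz ho).inv (RR_ne _ _ _ _)
      have h2 := h1.eventually_analyticAt
      have h3 := (Complex.differentiableOn_dslope (f := fun z => (RR N a b z)⁻¹) (c := (q:ℂ)) h2).2
        (fun w hw => AnalyticAt.differentiableWithinAt hw)
      exact h3.differentiableAt h2
    · rw [differentiableAt_dslope_of_ne h]
      exact (RR_diff hz ho).inv (RR_ne _ _ _ _)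
  · intro p hp ho
    have hpq : p ≠ q := by rintro rfl; exact ho hq
    have hcont : ContinuousAt (fun z : ℂ => (z - q)⁻¹) p :=
      ContinuousAt.inv₀ (by fun_prop) (sub_ne_zero.2 hpq)
    refine bound_comb hc hp (A := fun z => RR N a b q * (z - q)⁻¹) (B := fun z => -(z - q)⁻¹)
      (continuousAt_const.mul hcont) hcont.neg ?_
    have : ∀ᶠ z : ℂ in 𝓝[UHP] p, z ≠ (q : ℂ) := (eventually_ne_nhds hpq).filter_mono nhdsWithin_le_nhds
    filter_upwards [this] with z hz
    rw [ff_of_ne _ _ _ _ hz]; ring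

lemma Prim.add {N : ℕ} {a b : ℕ → ℝ} {F G H K : ℂ → ℂ} (h1 : Prim N a b F H)
    (h2 : Prim N a b G K) : Prim N a b (fun z => F z + G z) (fun z => H z + K z) :=
  ⟨h1.1.add h2.1, fun z hz => (h1.2.1 z hz).add (h2.2.1 z hz),
    fun p hp => (h1.2.2 p hp).add (h2.2.2 p hp)⟩

lemma Prim.const_mul {N : ℕ} {a b : ℕ → ℝ} {F H : ℂ → ℂ} (h1 : Prim N a b F H) (c : ℂ) :
    Prim N a b (fun z => c * F z) (fun z => c * H z) :=
  ⟨continuousOn_const.mul h1.1, fun z hz => (h1.2.1 z hz).const_mul c,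
    fun p hp => (h1.2.2 p hp).const_mul c⟩

lemma Prim.sum {N : ℕ} {a b : ℕ → ℝ} {ι : Type} (s : Finset ι) {F H : ι → ℂ → ℂ}
    (h : ∀ i ∈ s, Prim N a b (F i) (H i)) :
    Prim N a b (fun z => ∑ i ∈ s, F i z) (fun z => ∑ i ∈ s, H i z) :=
  ⟨continuousOn_finsetSum _ fun i hi => (h i hi).1,
    fun z hz => HasDerivAt.fun_sum fun i hi => (h i hi).2.1 z hz,
    fun p hp => HasDerivAt.fun_sum fun i hi => (h i hi).2.2 p hp⟩

/-- `x` lies outside all closed intervals. -/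
def Out (N : ℕ) (a b : ℕ → ℝ) (x : ℝ) : Prop := ∀ m < N, x < a m ∨ b m < x

lemma Out.off {N : ℕ} {a b : ℕ → ℝ} (hc : Cfg N a b) {x : ℝ} (h : Out N a b x) :
    Off N a b x := by
  intro m hm
  have h1 := hc.ab m hm
  rcases h m hm with h | h
  · exact ⟨by exact_mod_cast h.ne, by exact_mod_cast (h.trans h1).ne⟩
  · exact ⟨by exact_mod_cast (h1.trans h).ne', by exact_mod_cast h.ne'⟩

lemma DD_out {a b x : ℝ} (hab : a < b) (h : x < a ∨ b < x) :
    ∃ δ : ℝ, (b < x → 0 < δ) ∧ (x < a → δ < 0) ∧ DD a b x = δ := by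
  rcases h with h | h
  · obtain ⟨ρ, h1, h2⟩ := DD_lt h (h.trans hab)
    exact ⟨-ρ, fun h3 => by linarith, fun _ => by linarith, by rw [h2]; simp⟩
  · obtain ⟨ρ, h1, h2⟩ := DD_gt (hab.trans h) h
    exact ⟨ρ, fun _ => h1, fun h3 => by linarith, h2⟩

lemma RR_out {N : ℕ} {a b : ℕ → ℝ} (hc : Cfg N a b) {x : ℝ} (h : Out N a b x) :
    ∃ δ : ℕ → ℝ, (∀ m < N, (b m < x → 0 < δ m) ∧ (x < a m → δ m < 0)) ∧
      RR N a b x = ((∏ m ∈ Finset.range N, δ m : ℝ) : ℂ) := by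
  have : ∀ m, ∃ δ : ℝ, m < N → (b m < x → 0 < δ) ∧ (x < a m → δ < 0) ∧ DD (a m) (b m) x = δ := by
    intro m
    by_cases hm : m < N
    · obtain ⟨δ, hδ⟩ := DD_out (hc.ab m hm) (h m hm)
      exact ⟨δ, fun _ => hδ⟩
    · exact ⟨0, fun h => absurd h hm⟩
  choose δ hδ using this
  refine ⟨δ, fun m hm => ⟨(hδ m hm).1, (hδ m hm).2.1⟩, ?_⟩
  rw [RR, Complex.ofReal_prod]
  exact Finset.prod_congr rfl fun m hm => (hδ m (Finset.mem_range.1 hm)).2.2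

lemma RR_out' {N : ℕ} {a b : ℕ → ℝ} (hc : Cfg N a b) {x : ℝ} (h : Out N a b x) :
    ∃ ρ : ℝ, ρ ≠ 0 ∧ RR N a b x = ρ := by
  obtain ⟨δ, _, h2⟩ := RR_out hc h
  refine ⟨_, ?_, h2⟩
  have := RR_ne N a b x
  rw [h2] at this
  exact_mod_cast this

lemma in_out {N : ℕ} {a b : ℕ → ℝ} (hc : Cfg N a b) {x : ℝ} {i : ℕ} (hi : i < N)
    (hx : x ∈ Ioo (a i) (b i)) {m : ℕ} (hm : m < N) (hne : m ≠ i) : x < a m ∨ b m < x := by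
  rcases lt_or_gt_of_ne hne with h | h
  · right; exact (hc.ba m i h hi).trans hx.1
  · left; exact hx.2.trans (hc.ba i m h hm)

lemma in_off {N : ℕ} {a b : ℕ → ℝ} (hc : Cfg N a b) {x : ℝ} {i : ℕ} (hi : i < N)
    (hx : x ∈ Ioo (a i) (b i)) : Off N a b x := by
  intro m hm
  by_cases hne : m = i
  · subst hne
    exact ⟨by exact_mod_cast hx.1.ne', by exact_mod_cast hx.2.ne⟩
  · have h1 := hc.ab m hm
    rcases in_out hc hi hx hm hne with h | h
    · exact ⟨by exact_mod_cast h.ne, by exact_mod_cast (h.trans h1).ne⟩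
    · exact ⟨by exact_mod_cast (h1.trans h).ne', by exact_mod_cast h.ne'⟩

lemma RR_in {N : ℕ} {a b : ℕ → ℝ} (hc : Cfg N a b) {x : ℝ} {i : ℕ} (hi : i < N)
    (hx : x ∈ Ioo (a i) (b i)) : ∃ ρ : ℝ, ρ ≠ 0 ∧ RR N a b x = I * ρ := by
  have : ∀ m, ∃ δ : ℝ, m < N → m ≠ i → DD (a m) (b m) x = δ := by
    intro m
    by_cases hm : m < N ∧ m ≠ i
    · obtain ⟨δ, hδ⟩ := DD_out (hc.ab m hm.1) (in_out hc hi hx hm.1 hm.2)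
      exact ⟨δ, fun _ _ => hδ.2.2⟩
    · exact ⟨0, fun h h' => absurd ⟨h, h'⟩ hm⟩
  choose δ hδ using this
  obtain ⟨σ, _, hσ⟩ := DD_mid hx.1 hx.2
  have h2 : RR N a b x = I * ((σ * ∏ m ∈ (Finset.range N).erase i, δ m : ℝ) : ℂ) := by
    rw [RR, ← Finset.mul_prod_erase _ _ (Finset.mem_range.2 hi), hσ]
    push_cast
    rw [mul_assoc]
    congr 2
    refine Finset.prod_congr rfl fun m hm => ?_
    rw [Finset.mem_erase, Finset.mem_range] at hm
    exact hδ m hm.2 hm.1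
  refine ⟨_, ?_, h2⟩
  have := RR_ne N a b x
  rw [h2] at this
  exact_mod_cast (mul_ne_zero_iff.1 this).2

lemma const_Icc {f : ℝ → ℝ} {u v : ℝ} (hf : ContinuousOn f (Icc u v))
    (hd : ∀ x ∈ Ioo u v, HasDerivAt f 0 x) : ∀ x ∈ Icc u v, f x = f u := by
  intro x hx
  rcases hx.1.eq_or_lt with h | h
  · rw [h]
  · obtain ⟨c, hc, h1⟩ := exists_hasDerivAt_eq_slope f (fun _ => 0) h
      (hf.mono (Icc_subset_Icc_right hx.2)) (fun y hy => hd y ⟨hy.1, hy.2.trans_le hx.2⟩)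
    have : x - u ≠ 0 := by linarith
    field_simp at h1
    linarith

lemma re_deriv {f : ℝ → ℂ} {f' : ℂ} {x : ℝ} (h : HasDerivAt f f' x) :
    HasDerivAt (fun x => (f x).re) f'.re x :=
  (Complex.reCLM.hasFDerivAt (x := f x)).comp_hasDerivAt x h

lemma im_deriv {f : ℝ → ℂ} {f' : ℂ} {x : ℝ} (h : HasDerivAt f f' x) :
    HasDerivAt (fun x => (f x).im) f'.im x :=
  (Complex.imCLM.hasFDerivAt (x := f x)).comp_hasDerivAt x h

lemma gap_out {n : ℕ} {a b : ℕ → ℝ} (hc : Cfg (n + 2) a b) {i : ℕ} (hi : i ≤ n) {x : ℝ}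
    (hx : x ∈ Ioo (b i) (a (i + 1))) : ∀ m < n + 2, (m ≤ i → b m < x) ∧ (i < m → x < a m) := by
  intro m hm
  constructor
  · intro h
    rcases h.eq_or_lt with h | h
    · rw [h]; exact hx.1
    · have := hc.ba m i h (by omega)
      have := hc.ab i (by omega)
      linarith [hx.1]
  · intro h
    rcases (Nat.succ_le_of_lt h).eq_or_lt with h | h
    · rw [← h]; exact hx.2
    · have := hc.ba (i + 1) m h hm
      have := hc.ab (i + 1) (by omega)
      linarith [hx.2]

lemma gap_Out {n : ℕ} {a b : ℕ → ℝ} (hc : Cfg (n + 2) a b) {i : ℕ} (hi : i ≤ n) {x : ℝ}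
    (hx : x ∈ Ioo (b i) (a (i + 1))) : Out (n + 2) a b x := by
  intro m hm
  rcases le_or_gt m i with h | h
  · right; exact (gap_out hc hi hx m hm).1 h
  · left; exact (gap_out hc hi hx m hm).2 h

/-- The polynomial with coefficients `c`. -/
def PP (n : ℕ) (c : Fin (n + 1) → ℝ) : Polynomial ℝ :=
  ∑ k : Fin (n + 1), Polynomial.C (c k) * Polynomial.X ^ (k : ℕ)

lemma PP_eval (n : ℕ) (c : Fin (n + 1) → ℝ) (x : ℝ) :
    (PP n c).eval x = ∑ k : Fin (n + 1), c k * x ^ (k : ℕ) := by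
  simp [PP, Polynomial.eval_finsetSum]

lemma PP_coeff (n : ℕ) (c : Fin (n + 1) → ℝ) (j : Fin (n + 1)) : (PP n c).coeff j = c j := by
  rw [PP, Polynomial.finsetSum_coeff]
  simp only [Polynomial.coeff_C_mul, Polynomial.coeff_X_pow]
  rw [Finset.sum_eq_single j]
  · simp
  · intro k _ hk
    have : ¬ ((j : ℕ) = k) := fun h => hk (Fin.ext h.symm)
    simp [this]
  · simp

lemma PP_natDegree (n : ℕ) (c : Fin (n + 1) → ℝ) : (PP n c).natDegree ≤ n := by
  apply Polynomial.natDegree_sum_le_of_forall_le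
  intro k _
  exact (Polynomial.natDegree_C_mul_X_pow_le _ _).trans (Nat.lt_succ_iff.1 k.2)

lemma PP_factor (n : ℕ) (c : Fin (n + 1) → ℝ) (q : ℕ → ℝ)
    (hinj : Set.InjOn q (Finset.range n)) (hq : ∀ j < n, (PP n c).eval (q j) = 0) :
    PP n c = Polynomial.C (c (Fin.last n)) * ∏ j ∈ Finset.range n,
      (Polynomial.X - Polynomial.C (q j)) := by
  have hmon : (∏ j ∈ Finset.range n, (Polynomial.X - Polynomial.C (q j))).Monic :=
    Polynomial.monic_prod_of_monic _ _ fun j _ => Polynomial.monic_X_sub_C _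
  have hdeg : (∏ j ∈ Finset.range n, (Polynomial.X - Polynomial.C (q j))).natDegree = n := by
    rw [Polynomial.natDegree_prod_of_monic _ _ fun j _ => Polynomial.monic_X_sub_C _]
    simp
  apply Polynomial.eq_of_degree_sub_lt_of_eval_index_eq (Finset.range n) hinj
  · rw [Finset.card_range, Polynomial.degree_lt_iff_coeff_zero]
    intro m hm
    rw [Polynomial.coeff_sub, Polynomial.coeff_C_mul]
    rcases hm.eq_or_lt with h | h
    · subst h
      have h1 := PP_coeff n c (Fin.last n)
      have h2 := hmon.coeff_natDegree
      rw [hdeg] at h2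
      rw [Fin.val_last] at h1
      rw [h1, h2]; ring
    · rw [Polynomial.coeff_eq_zero_of_natDegree_lt ((PP_natDegree n c).trans_lt h),
        Polynomial.coeff_eq_zero_of_natDegree_lt (by rw [hdeg]; exact h)]
      ring
  · intro j hj
    rw [hq j (Finset.mem_range.1 hj), Polynomial.eval_mul, Polynomial.eval_prod]
    rw [Finset.prod_eq_zero hj]
    · simp
    · simp

lemma cont_re {H : ℂ → ℂ} {S : Set ℂ} {A : Set ℝ} (h : ContinuousOn H S)
    (hA : ∀ x ∈ A, (x : ℂ) ∈ S) : ContinuousOn (fun x : ℝ => (H x).re) A :=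
  Complex.continuous_re.comp_continuousOn
    (h.comp Complex.continuous_ofReal.continuousOn hA)

lemma cont_im {H : ℂ → ℂ} {S : Set ℂ} {A : Set ℝ} (h : ContinuousOn H S)
    (hA : ∀ x ∈ A, (x : ℂ) ∈ S) : ContinuousOn (fun x : ℝ => (H x).im) A :=
  Complex.continuous_im.comp_continuousOn
    (h.comp Complex.continuous_ofReal.continuousOn hA)

/-- The functionals to be annihilated. -/
def phi (n : ℕ) (a b : ℕ → ℝ) (j : Fin (n + 1)) (f : ℂ → ℂ) : ℝ :=
  if j = 0 then (f (a (n + 1)) - f (b 0)).im else (f (b j) - f (a j)).re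

lemma inj_lemma {n : ℕ} {a b : ℕ → ℝ} (hc : Cfg (n + 2) a b) (c : Fin (n + 1) → ℝ) {H : ℂ → ℂ}
    (hH : Prim (n + 2) a b
      (fun z => ∑ k : Fin (n + 1), (c k : ℂ) * (I * z ^ (k : ℕ) * (RR (n + 2) a b z)⁻¹)) H)
    (hphi : ∀ j, phi n a b j H = 0) : c = 0 := by
  have hF : ∀ x : ℝ, ∑ k : Fin (n + 1), (c k : ℂ) * (I * (x : ℂ) ^ (k : ℕ) *
      (RR (n + 2) a b x)⁻¹) = I * ((PP n c).eval x : ℝ) * (RR (n + 2) a b x)⁻¹ := by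
    intro x
    rw [PP_eval]
    push_cast
    rw [Finset.mul_sum, Finset.sum_mul]
    exact Finset.sum_congr rfl fun k _ => by ring
  have hder : ∀ x : ℝ, Off (n + 2) a b x → HasDerivAt (fun x : ℝ => H x)
      (I * ((PP n c).eval x : ℝ) * (RR (n + 2) a b x)⁻¹) x := by
    intro x hx
    have := hH.2.2 x hx
    simp only [hF] at this
    exact this
  have hcre : ∀ u v : ℝ, ContinuousOn (fun x : ℝ => (H x).re) (Icc u v) := fun u v =>
    cont_re hH.1 fun x _ => real_mem_CUHP x
  have hcim : ∀ u v : ℝ, ContinuousOn (fun x : ℝ => (H x).im) (Icc u v) := fun u v =>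
    cont_im hH.1 fun x _ => real_mem_CUHP x
  have hin : ∀ i < n + 2, ∀ x ∈ Ioo (a i) (b i), ∃ ρ : ℝ, ρ ≠ 0 ∧
      HasDerivAt (fun x : ℝ => H x) (((PP n c).eval x / ρ : ℝ) : ℂ) x := by
    intro i hi x hx
    obtain ⟨ρ, h1, h2⟩ := RR_in hc hi hx
    refine ⟨ρ, h1, ?_⟩
    have := hder x (in_off hc hi hx)
    rw [h2] at this
    have h3 : (ρ : ℂ) ≠ 0 := by exact_mod_cast h1
    convert this using 1
    push_cast
    field_simp [I_ne_zero]
  have hroot : ∀ j, ∃ q : ℝ, j < n → q ∈ Ioo (a (j + 1)) (b (j + 1)) ∧ (PP n c).eval q = 0 := by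
    intro j
    by_cases hj : j < n
    · have h1 := hphi ⟨j + 1, by omega⟩
      have h2 : (⟨j + 1, by omega⟩ : Fin (n + 1)) ≠ 0 := by
        intro h; simp [Fin.ext_iff] at h
      rw [phi, if_neg h2] at h1
      simp only [Complex.sub_re] at h1
      have hlt := hc.ab (j + 1) (by omega)
      have hd : ∀ x ∈ Ioo (a (j + 1)) (b (j + 1)), HasDerivAt (fun x : ℝ => (H x).re)
          (deriv (fun x : ℝ => (H x).re) x) x := by
        intro x hx
        obtain ⟨ρ, _, h4⟩ := hin (j + 1) (by omega) x hx
        exact (re_deriv h4).differentiableAt.hasDerivAt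
      obtain ⟨q, hq, hq'⟩ := exists_hasDerivAt_eq_zero hlt (hcre _ _) (by linarith) hd
      refine ⟨q, fun _ => ⟨hq, ?_⟩⟩
      obtain ⟨ρ, h3, h4⟩ := hin (j + 1) (by omega) q hq
      rw [(re_deriv h4).deriv, Complex.ofReal_re] at hq'
      exact (div_eq_zero_iff.1 hq').resolve_right h3
    · exact ⟨0, fun h => absurd h hj⟩
  choose q hq using hroot
  have hqlt : ∀ i j, i < j → j < n → q i < q j := by
    intro i j hij hj
    have h1 := (hq i (by omega)).1
    have h2 := (hq j hj).1
    have := hc.ba (i + 1) (j + 1) (by omega) (by omega)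
    linarith [h1.2, h2.1]
  have hinj : Set.InjOn q (Finset.range n) := by
    intro i hi j hj hij
    simp only [Finset.coe_range, mem_Iio] at hi hj
    by_contra hne
    rcases lt_or_gt_of_ne hne with h | h
    · exact (hqlt i j h hj).ne hij
    · exact (hqlt j i h hi).ne' hij
  have hfac := PP_factor n c q hinj (fun j hj => (hq j hj).2)
  by_cases hcn : c (Fin.last n) = 0
  · rw [hcn, Polynomial.C_0, zero_mul] at hfac
    ext j
    rw [← PP_coeff n c j, hfac]; simp
  · exfalso
    set C := c (Fin.last n) with hC
    -- the function `C * Im H`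
    have hneg : ∀ i ≤ n, C * (H (a (i + 1))).im < C * (H (b i)).im := by
      intro i hi
      have hlt := hc.ba i (i + 1) (by omega) (by omega)
      have hderiv : ∀ x ∈ Ioo (b i) (a (i + 1)), ∃ r : ℝ, r < 0 ∧
          HasDerivAt (fun x : ℝ => C * (H x).im) r x := by
        intro x hx
        have hO := gap_Out hc hi hx
        have hg := gap_out hc hi hx
        obtain ⟨δ, hδ, hR⟩ := RR_out hc hO
        have h1 := hder x (hO.off hc)
        rw [hR] at h1
        have h2 : I * ((PP n c).eval x : ℝ) * ((∏ m ∈ Finset.range (n + 2), δ m : ℝ) : ℂ)⁻¹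
          = I * (((PP n c).eval x / ∏ m ∈ Finset.range (n + 2), δ m : ℝ) : ℂ) := by
          push_cast; ring
        rw [h2] at h1
        have h3 := (im_deriv h1).const_mul C
        refine ⟨_, ?_, h3⟩
        rw [Complex.I_mul_im, Complex.ofReal_re, hfac, Finset.prod_range_succ,
          Finset.prod_range_succ', Polynomial.eval_mul, Polynomial.eval_prod]
        simp only [Polynomial.eval_C, Polynomial.eval_sub, Polynomial.eval_X]
        have h0 : 0 < δ 0 := (hδ 0 (by omega)).1 ((hg 0 (by omega)).1 (by omega))
        have hl : δ (n + 1) < 0 := (hδ (n + 1) (by omega)).2 ((hg (n + 1) (by omega)).2 (by omega))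
        have hpos : 0 < ∏ j ∈ Finset.range n, ((x - q j) / δ (j + 1)) := by
          apply Finset.prod_pos
          intro j hj
          have hj' := Finset.mem_range.1 hj
          have hqj := (hq j hj').1
          rcases le_or_gt (j + 1) i with h | h
          · have h5 := (hg (j + 1) (by omega)).1 h
            exact div_pos (by linarith [hqj.2]) ((hδ (j + 1) (by omega)).1 h5)
          · have h5 := (hg (j + 1) (by omega)).2 h
            exact div_pos_of_neg_of_neg (by linarith [hqj.1]) ((hδ (j + 1) (by omega)).2 h5)
        rw [Finset.prod_div_distrib] at hpos
        have hCC : 0 < C * C := mul_self_pos.2 hcn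
        generalize (∏ j ∈ Finset.range n, (x - q j)) = Q at hpos ⊢
        generalize (∏ k ∈ Finset.range n, δ (k + 1)) = Δ at hpos ⊢
        have e : C * (C * Q / (Δ * δ 0 * δ (n + 1))) = (C * C) * (Q / Δ) * (δ 0 * δ (n + 1))⁻¹ := by
          ring
        rw [e]
        exact mul_neg_of_pos_of_neg (mul_pos hCC hpos) (inv_lt_zero.2 (mul_neg_of_pos_of_neg h0 hl))
      have := strictAntiOn_of_deriv_neg (convex_Icc (b i) (a (i + 1)))
        (continuousOn_const.mul (hcim _ _)) (f := fun x : ℝ => C * (H x).im) (by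
          intro x hx
          rw [interior_Icc] at hx
          obtain ⟨r, h1, h2⟩ := hderiv x hx
          rw [h2.deriv]; exact h1)
      exact this (left_mem_Icc.2 hlt.le) (right_mem_Icc.2 hlt.le) hlt
    have hcon : ∀ i < n + 2, (H (b i)).im = (H (a i)).im := by
      intro i hi
      refine const_Icc (f := fun x : ℝ => (H x).im) (hcim (a i) (b i)) ?_ _
        (right_mem_Icc.2 (hc.ab i hi).le)
      intro x hx
      obtain ⟨ρ, _, h4⟩ := hin i hi x hx
      have := im_deriv h4
      rwa [Complex.ofReal_im] at this
    have hchain : ∀ i ≤ n, C * (H (a (i + 1))).im < C * (H (b 0)).im := by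
      intro i
      induction i with
      | zero => intro h; exact hneg 0 h
      | succ i ih =>
        intro h
        have h1 := hneg (i + 1) h
        rw [hcon (i + 1) (by omega)] at h1
        exact h1.trans (ih (by omega))
    have h1 := hphi 0
    rw [phi, if_pos rfl, Complex.sub_im] at h1
    have h2 := hchain n le_rfl
    rw [sub_eq_zero.1 h1] at h2
    exact lt_irrefl _ h2

/-- The explicit logarithmic part. -/
def UU (t s : ℝ) (z : ℂ) : ℂ := (1 / (Real.pi : ℂ)) * (lg s z - lg t z)

lemma pi_ne : (Real.pi : ℂ) ≠ 0 := by exact_mod_cast Real.pi_ne_zero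

lemma UU_deriv {t s : ℝ} {z : ℂ} (hz : z ∈ CUHP) (ht : z ≠ t) (hs : z ≠ s) :
    HasDerivAt (UU t s) ((1 / (Real.pi : ℂ)) * ((z - s)⁻¹ - (z - t)⁻¹)) z := by
  have := ((lg_hasDerivAt hz hs).sub (lg_hasDerivAt hz ht)).const_mul (1 / (Real.pi : ℂ))
  rw [one_div (z - (s:ℂ)), one_div (z - (t:ℂ))] at this
  exact this

lemma UU_im (t s : ℝ) (z : ℂ) : (UU t s z).im = ((lg s z).im - (lg t z).im) / Real.pi := by
  have : UU t s z = ((1 / Real.pi : ℝ) : ℂ) * (lg s z - lg t z) := by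
    rw [UU]; push_cast; ring
  rw [this, Complex.im_ofReal_mul, Complex.sub_im]; ring

lemma lg_gt_im {a x : ℝ} (h : a < x) : (lg a x).im = -(Real.pi / 2) := by
  rw [lg_gt h]
  have : (Real.log (x - a) : ℂ) - Real.pi / 2 * I
    = ((Real.log (x - a) : ℝ) : ℂ) + ((-(Real.pi / 2) : ℝ) : ℂ) * I := by push_cast; ring
  rw [this]; simp

lemma lg_lt_im {a x : ℝ} (h : x < a) : (lg a x).im = Real.pi / 2 := by
  rw [lg_lt h]
  have : (Real.log (a - x) : ℂ) + Real.pi / 2 * I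
    = ((Real.log (a - x) : ℝ) : ℂ) + ((Real.pi / 2 : ℝ) : ℂ) * I := by push_cast; ring
  rw [this]; simp

lemma UU_im_left {t s x : ℝ} (h1 : x < t) (h2 : x < s) : (UU t s x).im = 0 := by
  rw [UU_im, lg_lt_im h1, lg_lt_im h2]; simp

lemma UU_im_right {t s x : ℝ} (h1 : t < x) (h2 : s < x) : (UU t s x).im = 0 := by
  rw [UU_im, lg_gt_im h1, lg_gt_im h2]; simp

lemma UU_im_mid {t s x : ℝ} (h1 : t < x) (h2 : x < s) : (UU t s x).im = 1 := by
  rw [UU_im, lg_gt_im h1, lg_lt_im h2]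
  have := Real.pi_ne_zero
  field_simp; ring

lemma UU_im_bound (t s : ℝ) (z : ℂ) : |(UU t s z).im| ≤ 2 := by
  rw [UU_im, abs_div, abs_of_pos Real.pi_pos, div_le_iff₀ Real.pi_pos]
  have h1 := abs_le.1 (lg_im_le s z)
  have h2 := abs_le.1 (lg_im_le t z)
  rw [abs_le]
  constructor <;> linarith [h1.1, h1.2, h2.1, h2.2]

lemma bigO_pow (n k : ℕ) (hk : k ≤ n) (a b : ℕ → ℝ) :
    (fun z => z ^ k * (RR (n + 2) a b z)⁻¹) =O[Bornology.cobounded ℂ] fun z : ℂ => (z ^ 2)⁻¹ := by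
  have h1 := (Asymptotics.isBigO_refl (fun z : ℂ => z ^ k) (Bornology.cobounded ℂ)).mul
    (RR_inv_isBigO (n + 2) a b)
  refine h1.trans ?_
  apply Asymptotics.IsBigO.of_bound 1
  have h2 : ∀ᶠ z : ℂ in Bornology.cobounded ℂ, 1 ≤ ‖z‖ :=
    (tendsto_norm_cobounded_atTop (E := ℂ)).eventually_ge_atTop _
  filter_upwards [h2] with z hz
  have hz0 : 0 < ‖z‖ := by linarith
  rw [norm_mul, norm_inv, norm_inv, norm_pow, norm_pow, norm_pow, one_mul, ← div_eq_mul_inv,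
    div_le_iff₀ (by positivity), pow_add]
  have h3 : ‖z‖ ^ k ≤ ‖z‖ ^ n := pow_le_pow_right₀ hz hk
  have h4 : (‖z‖ ^ 2)⁻¹ * (‖z‖ ^ n * ‖z‖ ^ 2) = ‖z‖ ^ n := by field_simp
  rw [h4]; exact h3

lemma bigO_pole (n : ℕ) (a b : ℕ → ℝ) (q : ℝ) :
    (fun z => RR (n + 2) a b q * (RR (n + 2) a b z)⁻¹ * (z - q)⁻¹)
      =O[Bornology.cobounded ℂ] fun z : ℂ => (z ^ 2)⁻¹ := by
  have h1 := bigO_pow n 0 (Nat.zero_le _) a b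
  have h2 : (fun z : ℂ => (z - q)⁻¹) =O[Bornology.cobounded ℂ] fun _ => (1:ℂ) := by
    have : Tendsto (fun z : ℂ => z - q) (Bornology.cobounded ℂ) (Bornology.cobounded ℂ) := by
      rw [← tendsto_norm_atTop_iff_cobounded]
      refine tendsto_atTop_mono (fun z => norm_sub_norm_le z (q:ℂ)) ?_
      exact tendsto_atTop_add_const_right _ _ tendsto_norm_cobounded_atTop
    exact ((tendsto_inv₀_cobounded (α := ℂ)).comp this).isBigO_one ℂ
  have h3 := (h1.const_mul_left (RR (n + 2) a b q)).mul h2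
  simpa using h3

theorem core (n : ℕ) {a b : ℕ → ℝ} (hc : Cfg (n + 2) a b) (t s : ℝ) (ht : a (n + 1) < t)
    (hts : t < s) (hs : s < b (n + 1)) :
    ∃ h : ℂ → ℂ, DifferentiableOn ℂ h UHP ∧ ContinuousOn h (CUHP \ {(t : ℂ), (s : ℂ)}) ∧
      (∀ p : ℝ, p < a 0 ∨ b (n + 1) < p → (h p).re = 0) ∧
      (∃ c : ℝ, ∀ i ≤ n, ∀ p ∈ Ioo (b i) (a (i + 1)), (h p).re = c) ∧
      (∀ i ≤ n, ∃ c : ℝ, ∀ p ∈ Ioo (a i) (b i), (h p).im = c) ∧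
      (∀ p ∈ Ioo (a 0) (b 0) ∪ Ioo (a (n + 1)) t ∪ Ioo s (b (n + 1)), (h p).im = 0) ∧
      (∀ p ∈ Ioo t s, (h p).im = 1) ∧
      (∃ C : ℝ, ∀ z ∈ UHP, |(h z).im| ≤ C) := by
  have hsI : s ∈ Ioo (a (n + 1)) (b (n + 1)) := ⟨ht.trans hts, hs⟩
  have htI : t ∈ Ioo (a (n + 1)) (b (n + 1)) := ⟨ht, hts.trans hs⟩
  have hsO : Off (n + 2) a b s := in_off hc (by omega) hsI
  have htO : Off (n + 2) a b t := in_off hc (by omega) htI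
  choose E hE using fun k : ℕ => exists_E hc k
  obtain ⟨Ks, hKs⟩ := exists_K hc hsO
  obtain ⟨Kt, hKt⟩ := exists_K hc htO
  -- linear algebra
  have hEc : ∀ c : Fin (n + 1) → ℝ, Prim (n + 2) a b
      (fun z => ∑ k : Fin (n + 1), (c k : ℂ) * (I * z ^ (k : ℕ) * (RR (n + 2) a b z)⁻¹))
      (fun z => ∑ k : Fin (n + 1), (c k : ℂ) * E k z) := fun c =>
    Prim.sum Finset.univ fun k _ => (hE k).const_mul (c k : ℂ)
  have hphi_lin : ∀ (c : Fin (n + 1) → ℝ) (j : Fin (n + 1)),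
      phi n a b j (fun z => ∑ k : Fin (n + 1), (c k : ℂ) * E k z)
        = ∑ k : Fin (n + 1), phi n a b j (E k) * c k := by
    intro c j
    unfold phi
    split_ifs
    · rw [← Finset.sum_sub_distrib, Complex.im_sum]
      refine Finset.sum_congr rfl fun k _ => ?_
      rw [← mul_sub, Complex.im_ofReal_mul, mul_comm]
    · rw [← Finset.sum_sub_distrib, Complex.re_sum]
      refine Finset.sum_congr rfl fun k _ => ?_
      rw [← mul_sub, Complex.re_ofReal_mul, mul_comm]
  let Mx : Matrix (Fin (n + 1)) (Fin (n + 1)) ℝ := fun j k => phi n a b j (E k)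
  let T := Mx.mulVecLin
  have hT : ∀ c j, T c j = phi n a b j (fun z => ∑ k : Fin (n + 1), (c k : ℂ) * E k z) := by
    intro c j
    rw [hphi_lin]; rfl
  have hTinj : Function.Injective T := by
    rw [injective_iff_map_eq_zero]
    intro c hcz
    refine inj_lemma hc c (hEc c) fun j => ?_
    rw [← hT, hcz]; rfl
  have hTsurj : Function.Surjective T := LinearMap.injective_iff_surjective.1 hTinj
  let K : ℂ → ℂ := fun z => (1 / (Real.pi : ℂ)) * Ks z + (-(1 / (Real.pi : ℂ))) * Kt z
  obtain ⟨c, hcT⟩ := hTsurj (fun j => - phi n a b j (fun z => K z + UU t s z))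
  let W : ℂ → ℂ := fun z => (∑ k : Fin (n + 1), (c k : ℂ) * E k z) + K z
  have hW := (hEc c).add ((hKs.const_mul (1 / (Real.pi : ℂ))).add
    (hKt.const_mul (-(1 / (Real.pi : ℂ)))))
  let h0 : ℂ → ℂ := fun z => W z + UU t s z
  have hphi0 : ∀ j, phi n a b j h0 = 0 := by
    intro j
    have h1 := congrFun hcT j
    rw [hT] at h1
    have h2 : phi n a b j h0 = phi n a b j (fun z => ∑ k : Fin (n + 1), (c k : ℂ) * E k z)
        + phi n a b j (fun z => K z + UU t s z) := by
      simp only [phi, h0, W]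
      split_ifs
      · simp only [Complex.sub_im, Complex.add_im]; ring
      · simp only [Complex.sub_re, Complex.add_re]; ring
    rw [h2, h1]; ring
  -- derivative of `h0`
  let G : ℂ → ℂ := fun z => (∑ k : Fin (n + 1), (c k : ℂ) * (I * z ^ (k : ℕ) *
      (RR (n + 2) a b z)⁻¹)) + (1 / (Real.pi : ℂ)) *
        (RR (n + 2) a b s * (RR (n + 2) a b z)⁻¹ * (z - s)⁻¹ -
          RR (n + 2) a b t * (RR (n + 2) a b z)⁻¹ * (z - t)⁻¹)
  have hGeq : ∀ z : ℂ, z ≠ t → z ≠ s →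
      ((∑ k : Fin (n + 1), (c k : ℂ) * (I * z ^ (k : ℕ) * (RR (n + 2) a b z)⁻¹)) +
      ((1 / (Real.pi : ℂ)) * ff (n + 2) a b s z + (-(1 / (Real.pi : ℂ))) * ff (n + 2) a b t z))
      + (1 / (Real.pi : ℂ)) * ((z - s)⁻¹ - (z - t)⁻¹) = G z := by
    intro z h1 h2
    rw [ff_of_ne _ _ _ _ h1, ff_of_ne _ _ _ _ h2]
    simp only [G]; ring
  have hUHPne : ∀ z ∈ UHP, ∀ r : ℝ, z ≠ r := by
    intro z hz r h
    have h' : 0 < z.im := hz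
    rw [h] at h'; simp at h'
  have hder : ∀ z ∈ UHP, HasDerivAt h0 (G z) z := by
    intro z hz
    have h1 := (hW.2.1 z hz).add (UU_deriv (t := t) (s := s) (UHP_sub hz) (hUHPne z hz t)
      (hUHPne z hz s))
    rw [hGeq z (hUHPne z hz t) (hUHPne z hz s)] at h1
    exact h1
  have hderR : ∀ p : ℝ, Off (n + 2) a b p → p ≠ t → p ≠ s →
      HasDerivAt (fun x : ℝ => h0 x) (G p) p := by
    intro p hp h1 h2
    have h1' : (p : ℂ) ≠ t := by exact_mod_cast h1
    have h2' : (p : ℂ) ≠ s := by exact_mod_cast h2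
    have h3 := (hW.2.2 p hp).add (UU_deriv (real_mem_CUHP p) h1' h2').comp_ofReal
    rw [hGeq p h1' h2'] at h3
    exact h3
  have hUc : ContinuousOn (UU t s) (CUHP \ {(t : ℂ), (s : ℂ)}) := by
    intro z hz
    simp only [Set.mem_sdiff, mem_insert_iff, mem_singleton_iff, not_or] at hz
    exact (UU_deriv hz.1 hz.2.1 hz.2.2).continuousAt.continuousWithinAt
  have hh0c : ContinuousOn h0 (CUHP \ {(t : ℂ), (s : ℂ)}) := (hW.1.mono sdiff_subset).add hUc
  -- limit at infinity
  obtain ⟨l, hl⟩ := lim_infty hder (by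
    refine Asymptotics.IsBigO.mono ?_ inf_le_left
    refine Asymptotics.IsBigO.add ?_ ?_
    · apply Asymptotics.IsBigO.fun_sum
      intro k _
      have := (bigO_pow n k (Nat.lt_succ_iff.1 k.2) a b).const_mul_left ((c k : ℂ) * I)
      refine this.congr_left fun z => by ring
    · exact ((bigO_pole n a b s).sub (bigO_pole n a b t)).const_mul_left _)
  have hlim : ∀ ε > 0, ∃ M : ℝ, ∀ z ∈ UHP, M < ‖z‖ → ‖h0 z - l‖ ≤ ε := by
    intro ε hε
    have h1 := hl (closedBall_mem_nhds l hε)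
    rw [mem_map, mem_inf_principal, ← comap_norm_atTop] at h1
    obtain ⟨A, hA, h2⟩ := mem_comap.1 h1
    obtain ⟨M, hM⟩ := mem_atTop_sets.1 hA
    refine ⟨M, fun z hz hzM => ?_⟩
    have h3 : z ∈ norm ⁻¹' A := hM _ hzM.le
    have h4 := h2 h3 hz
    rwa [mem_preimage, mem_closedBall, dist_eq_norm] at h4
  have hmemD : ∀ p : ℝ, p ≠ t → p ≠ s → (p : ℂ) ∈ CUHP \ {(t : ℂ), (s : ℂ)} := by
    intro p h1 h2
    refine ⟨real_mem_CUHP p, ?_⟩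
    simp only [mem_insert_iff, mem_singleton_iff, not_or]
    exact ⟨by exact_mod_cast h1, by exact_mod_cast h2⟩
  have hUsub : UHP ⊆ CUHP \ {(t : ℂ), (s : ℂ)} := by
    intro z hz
    refine ⟨UHP_sub hz, ?_⟩
    simp only [mem_insert_iff, mem_singleton_iff, not_or]
    exact ⟨hUHPne z hz t, hUHPne z hz s⟩
  have hneb : ∀ p : ℝ, (𝓝[UHP] (p : ℂ)).NeBot := by
    intro p
    apply mem_closure_iff_nhdsWithin_neBot.1
    rw [closure_UHP]; exact real_mem_CUHP p
  have hlimR : ∀ ε > 0, ∃ M : ℝ, ∀ p : ℝ, p ≠ t → p ≠ s → M < |p| → ‖h0 p - l‖ ≤ ε := by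
    intro ε hε
    obtain ⟨M, hM⟩ := hlim ε hε
    refine ⟨M, fun p h1 h2 hp => ?_⟩
    have h3 : Tendsto h0 (𝓝[UHP] (p : ℂ)) (𝓝 (h0 p)) := (hh0c p (hmemD p h1 h2)).mono hUsub
    have := hneb p
    refine le_of_tendsto (h3.sub_const l).norm ?_
    have h4 : ∀ᶠ z : ℂ in 𝓝[UHP] (p : ℂ), M < ‖z‖ :=
      (continuous_norm.continuousAt.eventually_const_lt (by simpa using hp)).filter_mono
        nhdsWithin_le_nhds
    filter_upwards [self_mem_nhdsWithin, h4] with z hz hz'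
    exact hM z hz hz'
  -- order facts
  have ha0 : a 0 < b 0 := hc.ab 0 (by omega)
  have hbt : ∀ i ≤ n, b i < t := fun i hi => (hc.ba i (n + 1) (by omega) (by omega)).trans ht
  have hat : ∀ i ≤ n + 1, a i < t := by
    intro i hi
    rcases hi.eq_or_lt with h | h
    · rw [h]; exact ht
    · exact (hc.ab i (by omega)).trans (hbt i (by omega))
  -- real part of `G` vanishes outside the intervals
  obtain ⟨σ, _, hσ⟩ := RR_in hc (by omega) hsI
  obtain ⟨τ, _, hτ⟩ := RR_in hc (by omega) htI
  have hGout : ∀ p : ℝ, Out (n + 2) a b p → (G p).re = 0 := by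
    intro p hp
    obtain ⟨ρ, _, hρ⟩ := RR_out' hc hp
    have : G p = I * ((∑ k : Fin (n + 1), c k * (p ^ (k : ℕ) * ρ⁻¹) + (1 / Real.pi) *
        (σ * ρ⁻¹ * (p - s)⁻¹ - τ * ρ⁻¹ * (p - t)⁻¹) : ℝ) : ℂ) := by
      simp only [G]
      rw [hρ, hσ, hτ]
      push_cast
      rw [mul_add, Finset.mul_sum]
      congr 1
      · exact Finset.sum_congr rfl fun k _ => by ring
      · ring
    rw [this, Complex.I_mul_re, Complex.ofReal_im, neg_zero]
  have hWin : ∀ i < n + 2, ∀ p ∈ Ioo (a i) (b i), p ≠ t → p ≠ s →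
      HasDerivAt (fun x : ℝ => (W x).im) 0 p := by
    intro i hi p hp h1 h2
    have h1' : (p : ℂ) ≠ t := by exact_mod_cast h1
    have h2' : (p : ℂ) ≠ s := by exact_mod_cast h2
    have h3 := im_deriv (hW.2.2 p (in_off hc hi hp))
    obtain ⟨ρ, hρ0, hρ⟩ := RR_in hc hi hp
    have hρ0' : (ρ : ℂ) ≠ 0 := by exact_mod_cast hρ0
    have hIi : ∀ r : ℝ, I * (r : ℂ) * (I * (ρ : ℂ))⁻¹ = ((r * ρ⁻¹ : ℝ) : ℂ) := by
      intro r
      push_cast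
      field_simp [I_ne_zero]
    convert h3 using 1
    beta_reduce
    rw [ff_of_ne _ _ _ _ h1', ff_of_ne _ _ _ _ h2', hρ, hσ, hτ, hIi, hIi]
    have : (∑ k : Fin (n + 1), (c k : ℂ) * (I * (p : ℂ) ^ (k : ℕ) * (I * (ρ : ℂ))⁻¹))
      = ((∑ k : Fin (n + 1), c k * (p ^ (k : ℕ) * ρ⁻¹) : ℝ) : ℂ) := by
      push_cast
      refine Finset.sum_congr rfl fun k _ => ?_
      have := hIi (p ^ (k : ℕ))
      push_cast at this
      rw [this]
    rw [this]
    norm_cast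
  have hre_gap : ∀ u v : ℝ, (∀ x ∈ Icc u v, x ≠ t ∧ x ≠ s) → (∀ x ∈ Ioo u v, Out (n + 2) a b x) →
      ∀ x ∈ Icc u v, (h0 x).re = (h0 u).re := by
    intro u v h1 h2
    refine const_Icc (f := fun x : ℝ => (h0 x).re)
      (cont_re hh0c fun x hx => hmemD x (h1 x hx).1 (h1 x hx).2) ?_
    intro x hx
    have h3 := h1 x ⟨hx.1.le, hx.2.le⟩
    have h4 := re_deriv (hderR x ((h2 x hx).off hc) h3.1 h3.2)
    rwa [hGout x (h2 x hx)] at h4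
  have hWc : ∀ u v : ℝ, ContinuousOn (fun x : ℝ => (W x).im) (Icc u v) := fun u v =>
    cont_im hW.1 fun x _ => real_mem_CUHP x
  have hW1 : ∀ i ≤ n, ∀ x ∈ Icc (a i) (b i), (W x).im = (W (a i)).im := by
    intro i hi
    refine const_Icc (f := fun x : ℝ => (W x).im) (hWc _ _) ?_
    intro x hx
    have := hbt i hi
    exact hWin i (by omega) x hx (by linarith [hx.2] |> fun (q : x < t) => q.ne)
      (by linarith [hx.2] |> fun (q : x < s) => q.ne)
  have hW2 : ∀ x ∈ Icc (a (n + 1)) t, (W x).im = (W (a (n + 1))).im := by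
    refine const_Icc (f := fun x : ℝ => (W x).im) (hWc _ _) ?_
    intro x hx
    exact hWin (n + 1) (by omega) x ⟨hx.1, hx.2.trans (hts.trans hs)⟩ hx.2.ne (hx.2.trans hts).ne
  have hW3 : ∀ x ∈ Icc t s, (W x).im = (W t).im := by
    refine const_Icc (f := fun x : ℝ => (W x).im) (hWc _ _) ?_
    intro x hx
    exact hWin (n + 1) (by omega) x ⟨ht.trans hx.1, hx.2.trans hs⟩ hx.1.ne' hx.2.ne
  have hW4 : ∀ x ∈ Icc s (b (n + 1)), (W x).im = (W s).im := by
    refine const_Icc (f := fun x : ℝ => (W x).im) (hWc _ _) ?_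
    intro x hx
    exact hWin (n + 1) (by omega) x ⟨(ht.trans hts).trans hx.1, hx.2⟩ (hts.trans hx.1).ne' hx.1.ne'
  have hWt : (W t).im = (W (a (n + 1))).im := hW2 t (right_mem_Icc.2 ht.le)
  have hWs : (W s).im = (W (a (n + 1))).im := (hW3 s (right_mem_Icc.2 hts.le)).trans hWt
  have him0 : ∀ x : ℝ, x < t → (h0 x).im = (W x).im := by
    intro x hx
    simp only [h0, Complex.add_im]
    rw [UU_im_left hx (hx.trans hts), add_zero]
  have hphiz : (h0 (a (n + 1))).im = (h0 (b 0)).im := by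
    have := hphi0 0
    rw [phi, if_pos rfl, Complex.sub_im] at this
    linarith
  have hWan : (W (a (n + 1))).im = (h0 (b 0)).im := by
    rw [← hphiz, him0 _ ht]
  have hphir : ∀ i, 1 ≤ i → i ≤ n → (h0 (b i)).re = (h0 (a i)).re := by
    intro i h1 h2
    have h3 := hphi0 ⟨i, by omega⟩
    have h4 : (⟨i, by omega⟩ : Fin (n + 1)) ≠ 0 := by
      intro h; simp [Fin.ext_iff] at h; omega
    rw [phi, if_neg h4, Complex.sub_re] at h3
    simp only at h3
    linarith
  have hgapc : ∀ i ≤ n, ∀ x ∈ Icc (b i) (a (i + 1)), (h0 x).re = (h0 (b i)).re := by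
    intro i hi
    refine hre_gap _ _ ?_ (fun x hx => gap_Out hc hi hx)
    intro x hx
    have := hat (i + 1) (by omega)
    exact ⟨by linarith [hx.2] |> fun (q : x < t) => q.ne,
      by linarith [hx.2] |> fun (q : x < s) => q.ne⟩
  have hchain : ∀ i ≤ n, (h0 (b i)).re = (h0 (b 0)).re := by
    intro i
    induction i with
    | zero => intro _; rfl
    | succ i ih =>
      intro hi
      rw [hphir (i + 1) (by omega) hi,
        hgapc i (by omega) _ (right_mem_Icc.2 (hc.ba i (i + 1) (by omega) (by omega)).le)]
      exact ih (by omega)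
  have hout1 : ∀ p : ℝ, p < a 0 ∨ b (n + 1) < p → (h0 p).re = l.re := by
    intro p hp
    have hall : ∀ ε > 0, |(h0 p).re - l.re| ≤ ε := by
      intro ε hε
      obtain ⟨M, hM⟩ := hlimR ε hε
      have hfin : ∀ x : ℝ, x ≠ t → x ≠ s → M < |x| → (h0 x).re = (h0 p).re →
          |(h0 p).re - l.re| ≤ ε := by
        intro x h1 h2 h3 h4
        rw [← h4, ← Complex.sub_re]
        exact (Complex.abs_re_le_norm _).trans (hM x h1 h2 h3)
      rcases hp with hp | hp
      · let x : ℝ := min p (-(|M| + 1))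
        have hxp : x ≤ p := min_le_left _ _
        have hxM : x ≤ -(|M| + 1) := min_le_right _ _
        have hlt : ∀ y ≤ p, y < t := fun y hy => by linarith [hat 0 (by omega)]
        refine hfin x (hlt x hxp).ne ((hlt x hxp).trans hts).ne ?_ ?_
        · have := neg_le_abs x
          have := le_abs_self M
          linarith
        · refine (hre_gap x p (fun y hy => ⟨(hlt y hy.2).ne, ((hlt y hy.2).trans hts).ne⟩) ?_ p
            (right_mem_Icc.2 hxp)).symm
          intro y hy m hm
          left
          have : a 0 ≤ a m := by
            rcases Nat.eq_zero_or_pos m with h | h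
            · rw [h]
            · exact (ha0.trans (hc.ba 0 m h hm)).le
          linarith [hy.2]
      · let x : ℝ := max p (|M| + 1)
        have hxp : p ≤ x := le_max_left _ _
        have hxM : |M| + 1 ≤ x := le_max_right _ _
        have hlt : ∀ y, p ≤ y → s < y := fun y hy => by linarith
        refine hfin x (hts.trans (hlt x hxp)).ne' (hlt x hxp).ne' ?_ ?_
        · have := le_abs_self x
          have := le_abs_self M
          linarith
        · refine hre_gap p x (fun y hy => ⟨(hts.trans (hlt y hy.1)).ne', (hlt y hy.1).ne'⟩) ?_ x
            (right_mem_Icc.2 hxp)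
          intro y hy m hm
          right
          have : b m ≤ b (n + 1) := by
            rcases (Nat.le_of_lt_succ hm).eq_or_lt with h | h
            · rw [h]
            · exact ((hc.ba m (n + 1) h (by omega)).trans (hc.ab (n + 1) (by omega))).le
          linarith [hy.1]
    by_contra hne
    have h1 : 0 < |(h0 p).re - l.re| := abs_pos.2 (sub_ne_zero.2 hne)
    linarith [hall _ (half_pos h1)]
  -- the final function
  let κ : ℂ := ⟨l.re, (h0 (b 0)).im⟩
  refine ⟨fun z => h0 z - κ, ?_, ?_, ?_, ?_, ?_, ?_, ?_, ?_⟩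
  · exact fun z hz => ((hder z hz).sub_const κ).differentiableAt.differentiableWithinAt
  · exact hh0c.sub continuousOn_const
  · intro p hp
    rw [Complex.sub_re, hout1 p hp, sub_self]
  · refine ⟨(h0 (b 0)).re - l.re, fun i hi p hp => ?_⟩
    rw [Complex.sub_re, hgapc i hi p ⟨hp.1.le, hp.2.le⟩, hchain i hi]
  · intro i hi
    refine ⟨(W (a i)).im - κ.im, fun p hp => ?_⟩
    rw [Complex.sub_im, him0 p (hp.2.trans (hbt i hi)), hW1 i hi p ⟨hp.1.le, hp.2.le⟩]
  · intro p hp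
    rw [Complex.sub_im]
    change _ - (h0 (b 0)).im = 0
    rw [sub_eq_zero]
    rcases hp with (hp | hp) | hp
    · have h1 := hbt 0 (by omega)
      rw [him0 p (hp.2.trans h1), him0 _ h1, hW1 0 (by omega) p ⟨hp.1.le, hp.2.le⟩,
        hW1 0 (by omega) (b 0) (right_mem_Icc.2 ha0.le)]
    · rw [him0 p hp.2, hW2 p ⟨hp.1.le, hp.2.le⟩, hWan]
    · have : (h0 p).im = (W p).im := by
        simp only [h0, Complex.add_im]
        rw [UU_im_right (hts.trans hp.1) hp.1, add_zero]
      rw [this, hW4 p ⟨hp.1.le, hp.2.le⟩, hWs, hWan]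
  · intro p hp
    rw [Complex.sub_im]
    change _ - (h0 (b 0)).im = 1
    have : (h0 p).im = (W p).im + 1 := by
      simp only [h0, Complex.add_im]
      rw [UU_im_mid hp.1 hp.2]
    rw [this, hW3 p ⟨hp.1.le, hp.2.le⟩, hWt, hWan]
    ring
  · obtain ⟨M, hM⟩ := hlim 1 one_pos
    have hK : IsCompact (closedBall (0:ℂ) M ∩ CUHP) :=
      (isCompact_closedBall 0 M).inter_right isClosed_CUHP
    obtain ⟨B, hB⟩ := hK.exists_bound_of_continuousOn (hW.1.mono inter_subset_right)
    have key : ∀ z ∈ UHP, |(h0 z).im| ≤ (|B| + 2) + (‖l‖ + 1) := by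
      intro z hz
      rcases le_or_gt ‖z‖ M with h | h
      · have h1 : ‖W z‖ ≤ B := hB z ⟨by simpa using h, UHP_sub hz⟩
        have h2 : |(h0 z).im| ≤ |(W z).im| + |(UU t s z).im| := by
          simp only [h0, Complex.add_im]; exact abs_add_le _ _
        have h3 := Complex.abs_im_le_norm (W z)
        have h4 := UU_im_bound t s z
        have h5 := le_abs_self B
        have h6 := norm_nonneg l
        linarith
      · have h1 := hM z hz h
        have h2 := Complex.abs_im_le_norm (h0 z)
        have h3 := norm_sub_norm_le (h0 z) l
        have h5 := abs_nonneg B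
        linarith
    refine ⟨(|B| + 2) + (‖l‖ + 1) + |κ.im|, fun z hz => ?_⟩
    rw [Complex.sub_im]
    exact (abs_sub _ _).trans (by linarith [key z hz])

/-- Existence of the holomorphic observable solving the mixed boundary-value problem
with Dirichlet-1 window `(t,s) ⊂ (y_{2N-1}, y_{2N})`. -/
theorem bvp_exists (N : ℕ) (hN : 2 ≤ N) (y : ℕ → ℝ)
    (hy : ∀ i j : ℕ, 1 ≤ i → i < j → j ≤ 2 * N → y i < y j)
    (t s : ℝ) (ht : y (2 * N - 1) < t) (hts : t < s) (hs : s < y (2 * N)) :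
    ∃ h : ℂ → ℂ, SolvesBVP N y t s h := by
  obtain ⟨n, rfl⟩ : ∃ n, N = n + 2 := ⟨N - 2, by omega⟩
  let a : ℕ → ℝ := fun m => y (2 * m + 1)
  let b : ℕ → ℝ := fun m => y (2 * m + 2)
  have hc : Cfg (n + 2) a b :=
    ⟨fun m hm => hy _ _ (by omega) (by omega) (by omega),
      fun m m' h h' => hy _ _ (by omega) (by omega) (by omega)⟩
  have e1 : 2 * (n + 2) - 1 = 2 * (n + 1) + 1 := by omega
  have e2 : 2 * (n + 2) = 2 * (n + 1) + 2 := by omega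
  rw [e1] at ht
  rw [e2] at hs
  obtain ⟨h, h1, h2, h3, h4, h5, h6, h7, h8⟩ := core n hc t s ht hts hs
  have hat : ∀ i, 1 ≤ i → i ≤ 2 * (n + 1) + 1 → y i < t := by
    intro i hi hi'
    rcases hi'.eq_or_lt with h | h
    · rw [h]; exact ht
    · exact (hy i _ hi h (by omega)).trans ht
  have hlim : ∀ p : ℝ, p ≠ t → p ≠ s → Tendsto h (𝓝[UHP] (p : ℂ)) (𝓝 (h p)) := by
    intro p hp1 hp2
    have hm : (p : ℂ) ∈ CUHP \ {(t : ℂ), (s : ℂ)} := by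
      refine ⟨real_mem_CUHP p, ?_⟩
      simp only [mem_insert_iff, mem_singleton_iff, not_or]
      exact ⟨by exact_mod_cast hp1, by exact_mod_cast hp2⟩
    refine (h2 p hm).mono fun z hz => ⟨UHP_sub hz, ?_⟩
    have hz' : 0 < z.im := hz
    simp only [mem_insert_iff, mem_singleton_iff, not_or]
    constructor <;> (rintro rfl; simp at hz')
  have hre : ∀ p : ℝ, p ≠ t → p ≠ s → ∀ v : ℝ, (h p).re = v →
      Tendsto (fun z => (h z).re) (𝓝[UHP] (p : ℂ)) (𝓝 v) := by
    rintro p hp1 hp2 v rfl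
    exact (Complex.continuous_re.tendsto _).comp (hlim p hp1 hp2)
  have him : ∀ p : ℝ, p ≠ t → p ≠ s → ∀ v : ℝ, (h p).im = v →
      Tendsto (fun z => (h z).im) (𝓝[UHP] (p : ℂ)) (𝓝 v) := by
    rintro p hp1 hp2 v rfl
    exact (Complex.continuous_im.tendsto _).comp (hlim p hp1 hp2)
  refine ⟨h, h1, ?_, ?_, ?_, ?_, ?_, h8, ?_⟩
  · intro p hp
    rw [e2] at hp
    have hne : p ≠ t ∧ p ≠ s := by
      rcases hp with hp | hp
      · have h9 : p < t := hp.trans (hat 1 le_rfl (by omega))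
        exact ⟨h9.ne, (h9.trans hts).ne⟩
      · have h9 : s < p := hs.trans hp
        exact ⟨(hts.trans h9).ne', h9.ne'⟩
    exact hre p hne.1 hne.2 0 (h3 p hp)
  · obtain ⟨c, hc'⟩ := h4
    refine ⟨c, fun i hi1 hi2 p hp => ?_⟩
    obtain ⟨j, rfl⟩ : ∃ j, i = j + 1 := ⟨i - 1, by omega⟩
    have h9 : p < t := hp.2.trans (hat _ (by omega) (by omega))
    exact hre p h9.ne (h9.trans hts).ne c (hc' j (by omega) p hp)
  · intro i hi1 hi2
    obtain ⟨j, rfl⟩ : ∃ j, i = j + 1 := ⟨i - 1, by omega⟩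
    obtain ⟨c, hc'⟩ := h5 j (by omega)
    refine ⟨c, fun p hp => ?_⟩
    have h9 : p < t := hp.2.trans (hat _ (by omega) (by omega))
    exact him p h9.ne (h9.trans hts).ne c (hc' p hp)
  · intro p hp
    rw [e1, e2] at hp
    have hne : p ≠ t ∧ p ≠ s := by
      rcases hp with (hp | hp) | hp
      · have h9 : p < t := hp.2.trans (hat 2 (by omega) (by omega))
        exact ⟨h9.ne, (h9.trans hts).ne⟩
      · exact ⟨hp.2.ne, (hp.2.trans hts).ne⟩
      · exact ⟨(hts.trans hp.1).ne', hp.1.ne'⟩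
    exact him p hne.1 hne.2 0 (h6 p hp)
  · intro p hp
    exact him p hp.1.ne' hp.2.ne 1 (h7 p hp)
  · refine ⟨fun z => (h z).im, ?_, fun z _ => rfl⟩
    rw [closure_UHP]
    exact Complex.continuous_im.comp_continuousOn h2
end
end

section
/- Let N ≥ 2 be an integer and y₁ < y₂ < ⋯ < y_{2N} be real numbers, and fix t, s with y_{2N−1} < t < s < y_{2N}. Suppose h and k are two holomorphic functions on the open upper half-plane ℍ each satisfying: (1) Re of the function extends continuously to (−∞, y₁) ∪ (y_{2N}, +∞) with boundary value 0; (2) there is a constant c ∈ ℝ (possibly different for h and k) such that for every 1 ≤ i ≤ N−1 the real part extends continuously to (y_{2i}, y_{2i+1}) with boundary value identically c; (3) for each 1 ≤ i ≤ N−1 the imaginary part extends continuously to (y_{2i−1}, y_{2i}) with a constant boundary value; (4) the imaginary part extends continuously with boundary value 0 on (y₁, y₂) ∪ (y_{2N−1}, t) ∪ (s, y_{2N}) and with boundary value 1 on (t, s); (5) the imaginary part is bounded on ℍ and extends continuously to cl(ℍ) ∖ {t, s}. Then h = k on ℍ. -/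
open Set Metric Filter Complex Topology

noncomputable section

lemma closure_UHP_s5 : closure UHP = {z : ℂ | 0 ≤ z.im} := Complex.closure_setOfPred_lt_im 0

lemma frontier_UHP {p : ℂ} (hp : p ∈ frontier UHP) : p = (p.re : ℂ) := by
  have h1 : frontier UHP = {z : ℂ | z.im = 0} := Complex.frontier_setOfPred_lt_im 0
  rw [h1] at hp
  exact Complex.ext (by simp) (by simpa using hp)

lemma real_mem_closure_UHP (p : ℝ) : (p : ℂ) ∈ closure UHP := by
  rw [closure_UHP_s5]; simp

instance neBot_UHP (p : ℝ) : (𝓝[UHP] (p : ℂ)).NeBot :=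
  mem_closure_iff_nhdsWithin_neBot.1 (real_mem_closure_UHP p)

lemma strong_max {f : ℂ → ℂ} (hf : DifferentiableOn ℂ f UHP) {B : ℝ}
    (hB : ∀ z ∈ UHP, (f z).im ≤ B) {z₀ : ℂ} (hz₀ : z₀ ∈ UHP) (h0 : (f z₀).im = B) :
    ∀ z ∈ UHP, (f z).im = B := by
  intro z hz
  have hE : DifferentiableOn ℂ (fun z => cexp (-I * f z)) UHP := (hf.const_mul (-I)).cexp
  have hn : ∀ z, ‖cexp (-I * f z)‖ = Real.exp (f z).im := by
    intro z; rw [Complex.norm_exp]; simp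
  have := norm_eqOn_of_isPreconnected_of_isMaxOn convex_UHP.isPreconnected isOpen_UHP hE hz₀
    (by
      intro w hw
      simp only [Set.mem_ofPred_eq, Function.comp, hn]
      exact Real.exp_le_exp.2 (by rw [h0]; exact hB w hw)) hz
  simp only [Function.const, Function.comp, hn] at this
  rw [Real.exp_injective this, h0]

lemma local_max {f : ℂ → ℂ} {U : Set ℂ} (hU : IsOpen U) (hf : DifferentiableOn ℂ f U) {B : ℝ}
    (hB : ∀ z ∈ U, (f z).im ≤ B) {z₀ : ℂ} (hz₀ : z₀ ∈ U) (h0 : (f z₀).im = B) :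
    ∀ᶠ z in 𝓝 z₀, (f z).im = B := by
  have hE : DifferentiableOn ℂ (fun z => cexp (-I * f z)) U := (hf.const_mul (-I)).cexp
  have hn : ∀ z, ‖cexp (-I * f z)‖ = Real.exp (f z).im := by
    intro z; rw [Complex.norm_exp]; simp
  have hnU := hU.mem_nhds hz₀
  have := norm_eventually_eq_of_isLocalMax (f := fun z => cexp (-I * f z)) (c := z₀)
    (by
      filter_upwards [hnU] with w hw
      exact hE.differentiableAt (hU.mem_nhds hw))
    (by
      filter_upwards [hnU] with w hw
      simp only [Function.comp, hn]
      exact Real.exp_le_exp.2 (by rw [h0]; exact hB w hw))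
  filter_upwards [this] with w hw
  simp only [hn] at hw
  rw [Real.exp_injective hw, h0]

/-- A limit at a real point equals limits at nearby real points. -/
lemma limit_unique_near {v : ℂ → ℝ} {a ℓ M : ℝ} (h : Tendsto v (𝓝[UHP] (a : ℂ)) (𝓝 ℓ))
    (hf : ∀ r > 0, ∃ q : ℝ, |q - a| < r ∧ Tendsto v (𝓝[UHP] (q : ℂ)) (𝓝 M)) : ℓ = M := by
  by_contra hne
  have hd : 0 < |M - ℓ| / 2 := by
    have : 0 < |M - ℓ| := abs_pos.2 (sub_ne_zero.2 (Ne.symm hne))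
    linarith
  have h1 : ∀ᶠ z in 𝓝[UHP] (a : ℂ), |v z - ℓ| < |M - ℓ| / 2 := by
    have := (Metric.tendsto_nhds.1 h) _ hd
    simpa [Real.dist_eq] using this
  rw [eventually_nhdsWithin_iff, Metric.eventually_nhds_iff] at h1
  obtain ⟨r, hr, h1⟩ := h1
  obtain ⟨q, hq, hq2⟩ := hf r hr
  have h2 : ∀ᶠ z in 𝓝[UHP] (q : ℂ), |v z - ℓ| ≤ |M - ℓ| / 2 := by
    rw [eventually_nhdsWithin_iff]
    have : ball (a : ℂ) r ∈ 𝓝 (q : ℂ) := isOpen_ball.mem_nhds (by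
      rw [mem_ball, Complex.dist_eq, ← Complex.ofReal_sub, Complex.norm_real]; exact hq)
    filter_upwards [this] with z hz hzU
    exact (h1 hz hzU).le
  have h3 : |M - ℓ| ≤ |M - ℓ| / 2 :=
    le_of_tendsto ((hq2.sub_const ℓ).abs) h2
  linarith

/-- Uniformity on compact real intervals. -/
lemma uniform_level {P : ℂ → Prop} {α β : ℝ}
    (h : ∀ p ∈ Icc α β, ∀ᶠ z in 𝓝[UHP] ((p : ℝ) : ℂ), P z) :
    ∀ᶠ ε : ℝ in 𝓝[>] (0 : ℝ), ∀ x ∈ Icc α β, P ((x : ℝ) + (ε : ℂ) * I) := by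
  have : ∀ x ∈ Icc α β, ∀ᶠ q : ℝ × ℝ in 𝓝[>] (0 : ℝ) ×ˢ 𝓝 x, P (q.2 + q.1 * I) := by
    intro x hx
    have hx' := h x hx
    have ht : Tendsto (fun q : ℝ × ℝ => ((q.2 : ℂ) + q.1 * I)) (𝓝[>] (0 : ℝ) ×ˢ 𝓝 x)
        (𝓝[UHP] (x : ℂ)) := by
      rw [tendsto_nhdsWithin_iff]
      constructor
      · have hc : Continuous (fun q : ℝ × ℝ => ((q.2 : ℂ) + q.1 * I)) := by fun_prop
        have := hc.tendsto (0, x)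
        simp only [ofReal_zero, zero_mul, add_zero] at this
        refine this.mono_left ?_
        rw [nhds_prod_eq]
        exact Filter.prod_mono nhdsWithin_le_nhds le_rfl
      · have : ∀ᶠ q : ℝ × ℝ in 𝓝[>] (0 : ℝ) ×ˢ 𝓝 x, q.1 ∈ Ioi (0 : ℝ) :=
          tendsto_fst.eventually self_mem_nhdsWithin
        filter_upwards [this] with q hq
        simpa [UHP] using hq
    exact ht.eventually hx'
  have h2 := isCompact_Icc.eventually_forall_of_forall_eventually
    (x₀ := (0:ℝ)) (K := Icc α β) (P := fun (e x : ℝ) => 0 < e → P (x + e * I)) (by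
      intro x hx
      have h3 := this x hx
      have h4 : 𝓝[>] (0 : ℝ) ×ˢ 𝓝 x = 𝓝[(Ioi 0) ×ˢ univ] ((0:ℝ), x) := by
        rw [nhdsWithin_prod_eq, nhdsWithin_univ]
      rw [h4, eventually_nhdsWithin_iff] at h3
      filter_upwards [h3] with q hq hq2
      exact hq ⟨hq2, trivial⟩)
  rw [eventually_nhdsWithin_iff]
  filter_upwards [h2] with e he he2 x hx
  exact he x hx he2

/-- Real and imaginary parts of the Cauchy theorem on a rectangle in the upper half plane. -/
lemma rect_identity {f : ℂ → ℂ} {x₁ x₂ e d : ℝ} (hx : x₁ ≤ x₂) (hed : e ≤ d)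
    (hc : ContinuousOn f (Icc x₁ x₂ ×ℂ Icc e d))
    (hf : DifferentiableOn ℂ f (Ioo x₁ x₂ ×ℂ Ioo e d)) :
    ((∫ x in x₁..x₂, (f (x + e * I)).im) - (∫ x in x₁..x₂, (f (x + d * I)).im)
      + (∫ y in e..d, (f (x₂ + y * I)).re) - (∫ y in e..d, (f (x₁ + y * I)).re) = 0) ∧
    ((∫ x in x₁..x₂, (f (x + e * I)).re) - (∫ x in x₁..x₂, (f (x + d * I)).re)
      - (∫ y in e..d, (f (x₂ + y * I)).im) + (∫ y in e..d, (f (x₁ + y * I)).im) = 0) := by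
  have key := integral_boundary_rect_eq_zero_of_continuousOn_of_differentiableOn f
    (x₁ + e * I) (x₂ + d * I) (by simpa [uIcc_of_le hx, uIcc_of_le hed] using hc)
    (by simpa [hx, hed] using hf)
  simp only [add_re, ofReal_re, mul_re, I_re, mul_zero, ofReal_im, I_im, mul_one, sub_self,
    add_zero, add_im, mul_im, zero_add] at key
  have hor : ∀ y ∈ Icc e d, IntervalIntegrable (fun x : ℝ => f (x + y * I)) MeasureTheory.volume
      x₁ x₂ := by
    intro y hy
    apply ContinuousOn.intervalIntegrable
    rw [uIcc_of_le hx]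
    refine hc.comp (by fun_prop) ?_
    intro x hx'
    simp only [mem_reProdIm]
    simpa using ⟨hx', hy⟩
  have ver : ∀ x ∈ Icc x₁ x₂, IntervalIntegrable (fun y : ℝ => f (x + y * I))
      MeasureTheory.volume e d := by
    intro x hx'
    apply ContinuousOn.intervalIntegrable
    rw [uIcc_of_le hed]
    refine hc.comp (by fun_prop) ?_
    intro y hy'
    simp only [mem_reProdIm]
    simpa using ⟨hx', hy'⟩
  have hre : ∀ (g : ℝ → ℂ) (a b : ℝ), IntervalIntegrable g MeasureTheory.volume a b →
      (∫ x in a..b, g x).re = ∫ x in a..b, (g x).re := fun g a b hg =>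
    (Complex.reCLM.intervalIntegral_comp_comm hg).symm
  have him : ∀ (g : ℝ → ℂ) (a b : ℝ), IntervalIntegrable g MeasureTheory.volume a b →
      (∫ x in a..b, g x).im = ∫ x in a..b, (g x).im := fun g a b hg =>
    (Complex.imCLM.intervalIntegral_comp_comm hg).symm
  have i1 := hor e (left_mem_Icc.2 hed)
  have i2 := hor d (right_mem_Icc.2 hed)
  have i3 := ver x₁ (left_mem_Icc.2 hx)
  have i4 := ver x₂ (right_mem_Icc.2 hx)
  rw [← him _ _ _ i1, ← him _ _ _ i2, ← him _ _ _ i3, ← him _ _ _ i4, ← hre _ _ _ i1,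
    ← hre _ _ _ i2, ← hre _ _ _ i3, ← hre _ _ _ i4]
  have kr := congrArg Complex.re key
  have ki := congrArg Complex.im key
  simp only [smul_eq_mul, add_re, sub_re, mul_re, I_re, I_im, zero_mul, one_mul, zero_sub,
    zero_re, add_im, sub_im, mul_im, zero_im, zero_add] at kr ki
  constructor <;> linarith

lemma neumann {φ : ℂ → ℂ} {p ρ c S : ℝ}
    (hφ : DifferentiableOn ℂ φ (ball (p : ℂ) ρ ∩ UHP))
    (hre : ∀ q : ℝ, |q - p| < ρ → Tendsto (fun z => (φ z).re) (𝓝[UHP] (q : ℂ)) (𝓝 c))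
    (him : ∀ q : ℝ, |q - p| < ρ → ∃ ℓ, Tendsto (fun z => (φ z).im) (𝓝[UHP] (q : ℂ)) (𝓝 ℓ))
    (hS : ∀ z ∈ ball (p : ℂ) ρ ∩ UHP, (φ z).im ≤ S)
    (hp : Tendsto (fun z => (φ z).im) (𝓝[UHP] (p : ℂ)) (𝓝 S)) :
    ∀ r ∈ Ioo 0 ρ, (φ (p + r * I)).im = S := by
  intro r hr
  obtain ⟨hr0, hrρ⟩ := hr
  set D : Set ℂ := ball (p : ℂ) ρ ∩ {z | 0 ≤ z.im} with hD
  have hopen : IsOpen (ball (p : ℂ) ρ ∩ UHP) := isOpen_ball.inter isOpen_UHP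
  have htr : ∀ q : ℝ, |q - p| < ρ → ∃ ℓ : ℝ, Tendsto φ (𝓝[UHP] (q : ℂ)) (𝓝 ⟨c, ℓ⟩) := by
    intro q hq
    obtain ⟨ℓ, hℓ⟩ := him q hq
    refine ⟨ℓ, ?_⟩
    have h1 := (Complex.continuous_ofReal.tendsto c).comp (hre q hq)
    have h2 := (Complex.continuous_ofReal.tendsto ℓ).comp hℓ
    have h3 := h1.add (h2.mul_const I)
    have e1 : (c : ℂ) + ℓ * I = ⟨c, ℓ⟩ := (mk_eq_add_mul_I c ℓ).symm
    rw [e1] at h3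
    refine h3.congr ?_
    intro z
    simp [Complex.re_add_im]
  have hin : ∀ z ∈ ball (p : ℂ) ρ ∩ UHP, Tendsto φ (𝓝[UHP] z) (𝓝 (φ z)) := by
    intro z hz
    exact ((hφ.differentiableAt (hopen.mem_nhds hz)).continuousAt.tendsto).mono_left
      nhdsWithin_le_nhds
  set Φ := extendFrom UHP φ with hΦ
  have hΦin : ∀ z ∈ ball (p : ℂ) ρ ∩ UHP, Φ z = φ z := fun z hz =>
    extendFrom_eq (subset_closure hz.2) (hin z hz)
  have hreal : ∀ z ∈ D, z.im = 0 → z = (z.re : ℂ) ∧ |z.re - p| < ρ := by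
    intro z hz hz0
    have e : z = (z.re : ℂ) := Complex.ext (by simp) (by simpa using hz0)
    refine ⟨e, ?_⟩
    have := hz.1
    rw [e, mem_ball, Complex.dist_eq, ← Complex.ofReal_sub, Complex.norm_real] at this
    simpa using this
  have hΦre : ∀ z ∈ D, z.im = 0 → (Φ z).re = c := by
    intro z hz hz0
    obtain ⟨e, h1⟩ := hreal z hz hz0
    obtain ⟨ℓ, hℓ⟩ := htr z.re h1
    rw [e, hΦ, extendFrom_eq (real_mem_closure_UHP z.re) hℓ]
  have hΦc : ContinuousOn Φ D := by
    apply continuousOn_extendFrom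
    · intro z hz; rw [closure_UHP_s5]; exact hz.2
    · intro z hz
      rcases eq_or_lt_of_le (show 0 ≤ z.im from hz.2) with h0 | h0
      · obtain ⟨e, h1⟩ := hreal z hz h0.symm
        obtain ⟨ℓ, hℓ⟩ := htr z.re h1
        rw [e]; exact ⟨_, hℓ⟩
      · exact ⟨_, hin z ⟨hz.1, h0⟩⟩
  -- polar coordinates
  have him_exp : ∀ x y : ℝ, (cexp (x + y * I)).im = Real.exp x * Real.sin y := by
    intro x y; rw [Complex.exp_im]; simp
  have hnorm : ∀ w : ℂ, ‖cexp w‖ = Real.exp w.re := Complex.norm_exp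
  have hmemD : ∀ w : ℂ, w.re < Real.log ρ → 0 ≤ w.im → w.im ≤ Real.pi → (p : ℂ) + cexp w ∈ D := by
    intro w h1 h2 h3
    refine ⟨?_, ?_⟩
    · rw [mem_ball, Complex.dist_eq]
      simp only [add_sub_cancel_left, hnorm]
      exact (Real.lt_log_iff_exp_lt (by linarith)).1 h1
    · simp only [Set.mem_ofPred_eq, add_im, ofReal_im, zero_add, Complex.exp_im]
      exact mul_nonneg (Real.exp_pos _).le (Real.sin_nonneg_of_nonneg_of_le_pi h2 h3)
  have hmemU : ∀ w : ℂ, w.re < Real.log ρ → 0 < w.im → w.im < Real.pi →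
      (p : ℂ) + cexp w ∈ ball (p : ℂ) ρ ∩ UHP := by
    intro w h1 h2 h3
    refine ⟨(hmemD w h1 h2.le h3.le).1, ?_⟩
    simp only [UHP, Set.mem_ofPred_eq, add_im, ofReal_im, zero_add, Complex.exp_im]
    exact mul_pos (Real.exp_pos _) (Real.sin_pos_of_pos_of_lt_pi h2 h3)
  set ψ : ℂ → ℂ := fun w => Φ (p + cexp w) with hψ
  have hψc : ContinuousOn ψ {w | w.re < Real.log ρ ∧ 0 ≤ w.im ∧ w.im ≤ Real.pi} := by
    refine hΦc.comp (by fun_prop) ?_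
    intro w hw
    exact hmemD w hw.1 hw.2.1 hw.2.2
  have hlog : Real.log r < Real.log ρ := Real.log_lt_log hr0 hrρ
  set m : ℝ → ℝ := fun x => ∫ y in (0:ℝ)..Real.pi, (ψ (x + y * I)).im with hm
  have hcontm : ∀ x < Real.log ρ, ContinuousOn (fun y : ℝ => (ψ (x + y * I)).im)
      (Icc 0 Real.pi) := by
    intro x hx
    refine Complex.continuous_im.comp_continuousOn (hψc.comp (by fun_prop) ?_)
    intro y hy
    simpa using ⟨hx, hy.1, hy.2⟩
  have hmconst : ∀ x ≤ Real.log r, m x = m (Real.log r) := by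
    intro x hx
    have key := (rect_identity (f := ψ) hx Real.pi_pos.le
      (hψc.mono (by
        intro w hw
        rw [mem_reProdIm] at hw
        exact ⟨hw.1.2.trans_lt hlog, hw.2.1, hw.2.2⟩))
      (by
        intro w hw
        rw [mem_reProdIm] at hw
        have hw' : w.re < Real.log ρ := hw.1.2.trans hlog
        have h1 := hmemU w hw' hw.2.1 hw.2.2
        have h2 : DifferentiableAt ℂ Φ (p + cexp w) := by
          refine (hφ.differentiableAt (hopen.mem_nhds h1)).congr_of_eventuallyEq ?_
          filter_upwards [hopen.mem_nhds h1] with z hz using hΦin z hz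
        have h3 : DifferentiableAt ℂ (fun w => (p : ℂ) + cexp w) w := by fun_prop
        exact (DifferentiableAt.comp w h2 h3).differentiableWithinAt)).2
    have b1 : ∀ y : ℝ, (y = 0 ∨ y = Real.pi) →
        (∫ x in x..Real.log r, (ψ (x + y * I)).re) = ∫ x in x..Real.log r, c := by
      intro y hy
      apply intervalIntegral.integral_congr
      intro x' hx'
      rw [uIcc_of_le hx] at hx'
      have hy1 : 0 ≤ y ∧ y ≤ Real.pi := by
        rcases hy with h | h <;> subst h
        · exact ⟨le_rfl, Real.pi_pos.le⟩
        · exact ⟨Real.pi_pos.le, le_rfl⟩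
      apply hΦre
      · apply hmemD
        · simpa using hx'.2.trans_lt hlog
        · simpa using hy1.1
        · simpa using hy1.2
      · rw [add_im, him_exp]
        rcases hy with h | h <;> simp [h]
    rw [b1 0 (Or.inl rfl), b1 _ (Or.inr rfl)] at key
    simp only [hm]
    linarith
  -- values on the arcs
  have hle : ∀ x < Real.log ρ, ∀ y ∈ Icc 0 Real.pi, (ψ (x + y * I)).im ≤ S := by
    intro x hx
    have hcl : closure (Ioo 0 Real.pi) = Icc 0 Real.pi := closure_Ioo Real.pi_pos.ne
    have := le_on_closure (s := Ioo 0 Real.pi) (f := fun y : ℝ => (ψ (x + y * I)).im)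
      (g := fun _ => S)
      (by
        intro y hy
        have h1 := hmemU (x + y * I) (by simpa using hx) (by simpa using hy.1) (by simpa using hy.2)
        simp only [hψ]
        rw [hΦin _ h1]
        exact hS _ h1)
      (by rw [hcl]; exact hcontm x hx) continuousOn_const
    rw [hcl] at this
    exact fun y hy => this hy
  have hmlow : Real.pi * S ≤ m (Real.log r) := by
    apply le_of_forall_pos_le_add
    intro ε hε
    have hεπ : 0 < ε / Real.pi := div_pos hε Real.pi_pos
    have h1 : ∀ᶠ z in 𝓝[UHP] (p : ℂ), S - ε / Real.pi < (φ z).im :=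
      hp.eventually (lt_mem_nhds (by linarith))
    rw [eventually_nhdsWithin_iff, Metric.eventually_nhds_iff] at h1
    obtain ⟨δ, hδ, h1⟩ := h1
    set x := min (Real.log r) (Real.log (δ / 2)) with hx
    have hxδ : Real.exp x < δ := by
      calc Real.exp x ≤ Real.exp (Real.log (δ/2)) := Real.exp_le_exp.2 (min_le_right _ _)
        _ = δ / 2 := Real.exp_log (by linarith)
        _ < δ := by linarith
    have hxr : x ≤ Real.log r := min_le_left _ _
    rw [← hmconst x hxr]
    have hintegral : (∫ y in (0:ℝ)..Real.pi, (S - ε / Real.pi)) ≤ m x := by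
      apply intervalIntegral.integral_mono_on_of_le_Ioo Real.pi_pos.le
      · simp
      · apply ContinuousOn.intervalIntegrable
        rw [uIcc_of_le Real.pi_pos.le]
        exact hcontm x (hxr.trans_lt hlog)
      · intro y hy
        have h2 := hmemU (x + y * I) (by simpa using hxr.trans_lt hlog) (by simpa using hy.1)
          (by simpa using hy.2)
        simp only [hψ]
        rw [hΦin _ h2]
        refine (h1 ?_ h2.2).le
        rw [Complex.dist_eq]
        simpa [hnorm] using hxδ
    rw [intervalIntegral.integral_const] at hintegral
    simp only [sub_zero, smul_eq_mul] at hintegral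
    have : Real.pi * (S - ε / Real.pi) = Real.pi * S - ε := by
      field_simp
    linarith
  have heq : (ψ (Real.log r + ((Real.pi / 2 : ℝ) : ℂ) * I)).im = S := by
    by_contra hne
    have hpi := Real.pi_pos
    have hmem : Real.pi / 2 ∈ Icc 0 Real.pi := ⟨by linarith, by linarith⟩
    have hlt := lt_of_le_of_ne (hle _ hlog _ hmem) hne
    have := intervalIntegral.integral_lt_integral_of_continuousOn_of_le_of_exists_lt
      (f := fun y : ℝ => (ψ (Real.log r + y * I)).im) (g := fun _ => S) hpi
      (hcontm _ hlog) continuousOn_const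
      (fun y hy => hle _ hlog y (Ioc_subset_Icc_self hy)) ⟨_, hmem, hlt⟩
    rw [intervalIntegral.integral_const] at this
    simp only [sub_zero, smul_eq_mul] at this
    simp only [hm] at hmlow
    linarith
  have hpt : (p : ℂ) + cexp (Real.log r + ((Real.pi / 2 : ℝ) : ℂ) * I) = p + r * I := by
    rw [Complex.exp_add, ← Complex.ofReal_exp, Real.exp_log hr0]
    push_cast
    rw [Complex.exp_pi_div_two_mul_I]
  simp only [hψ] at heq
  rw [hpt, hΦin] at heq
  · exact heq
  · refine ⟨?_, ?_⟩
    · rw [mem_ball, Complex.dist_eq]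
      simpa [abs_of_pos hr0] using hrρ
    · simpa [UHP] using hr0

/-- Mixed maximum principle. -/
lemma mixed_max {U : Set ℂ} (hUo : IsOpen U) (hUs : U ⊆ UHP) {φ : ℂ → ℂ}
    (hφ : DifferentiableOn ℂ φ U) {B : ℝ}
    (hfr : ∀ p ∈ frontier U, (∀ b > B, ∀ᶠ z in 𝓝[U] p, (φ z).im < b) ∨
      (∃ (q ρ c : ℝ), p = (q : ℂ) ∧ 0 < ρ ∧ ball p ρ ∩ UHP ⊆ U ∧
        (∀ x : ℝ, |x - q| < ρ → Tendsto (fun z => (φ z).re) (𝓝[UHP] (x : ℂ)) (𝓝 c)) ∧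
        (∀ x : ℝ, |x - q| < ρ → ∃ ℓ, Tendsto (fun z => (φ z).im) (𝓝[UHP] (x : ℂ)) (𝓝 ℓ))))
    (hinf : ∀ b > B, ∃ R : ℝ, ∀ z ∈ U, R < ‖z‖ → (φ z).im < b) :
    ∀ z ∈ U, (φ z).im ≤ B := by
  by_contra hcon
  push Not at hcon
  obtain ⟨z₀, hz₀, hz₀B⟩ := hcon
  obtain ⟨b', hb'1, hb'2⟩ := exists_between hz₀B
  obtain ⟨b, hb1, hb2⟩ := exists_between hb'2
  set Nm : Set ℂ := {p | p ∈ frontier U ∧ (∃ (q ρ c : ℝ), p = (q : ℂ) ∧ 0 < ρ ∧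
        ball p ρ ∩ UHP ⊆ U ∧
        (∀ x : ℝ, |x - q| < ρ → Tendsto (fun z => (φ z).re) (𝓝[UHP] (x : ℂ)) (𝓝 c)) ∧
        (∀ x : ℝ, |x - q| < ρ → ∃ ℓ, Tendsto (fun z => (φ z).im) (𝓝[UHP] (x : ℂ)) (𝓝 ℓ)))}
    with hNm
  set V : Set ℂ := U ∪ Nm with hV
  have hVcl : V ⊆ closure U := by
    rintro z (hz | hz)
    · exact subset_closure hz
    · exact frontier_subset_closure hz.1
  set v : ℂ → ℝ := fun z => (φ z).im with hv
  set g := extendFrom U v with hg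
  have hlim : ∀ z ∈ V, ∃ ℓ, Tendsto v (𝓝[U] z) (𝓝 ℓ) := by
    rintro z (hz | hz)
    · exact ⟨v z, (Complex.continuous_im.continuousAt.comp
        (hφ.differentiableAt (hUo.mem_nhds hz)).continuousAt).tendsto.mono_left nhdsWithin_le_nhds⟩
    · obtain ⟨_, q, ρ, c, rfl, hρ, _, _, h2⟩ := hz
      obtain ⟨ℓ, hℓ⟩ := h2 q (by simpa using hρ)
      exact ⟨ℓ, hℓ.mono_left (nhdsWithin_mono _ hUs)⟩
  have hgt : ∀ z ∈ V, Tendsto v (𝓝[U] z) (𝓝 (g z)) := fun z hz => tendsto_extendFrom (hlim z hz)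
  have hgU : ∀ z ∈ U, g z = v z := by
    intro z hz
    exact extendFrom_eq (subset_closure hz) ((Complex.continuous_im.continuousAt.comp
        (hφ.differentiableAt (hUo.mem_nhds hz)).continuousAt).tendsto.mono_left nhdsWithin_le_nhds)
  have hgc : ContinuousOn g V := continuousOn_extendFrom hVcl hlim
  have hne : ∀ z ∈ V, (𝓝[U] z).NeBot := fun z hz => mem_closure_iff_nhdsWithin_neBot.1 (hVcl hz)
  set K : Set ℂ := {z | z ∈ V ∧ b ≤ g z} with hK
  have hKb : Bornology.IsBounded K := by
    obtain ⟨R, hR⟩ := hinf b' hb'1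
    refine (isBounded_closedBall (x := (0:ℂ)) (r := R)).subset ?_
    rintro z ⟨hz, hzb⟩
    by_contra hzR
    have hzR' : R < ‖z‖ := by simpa using hzR
    have := hne z hz
    have h1 : ∀ᶠ w in 𝓝[U] z, v w ≤ b' := by
      rw [eventually_nhdsWithin_iff]
      filter_upwards [(isOpen_lt continuous_const continuous_norm).mem_nhds hzR'] with w hw hwU
      exact (hR w hwU hw).le
    have := le_of_tendsto (hgt z hz) h1
    linarith
  have hKc : IsClosed K := by
    rw [← closure_subset_iff_isClosed]
    intro p hp
    have hKU : K ⊆ closure U := fun z hz => hVcl hz.1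
    have hpU : p ∈ closure U := closure_minimal hKU isClosed_closure hp
    have hneK : (𝓝[K] p).NeBot := mem_closure_iff_nhdsWithin_neBot.1 hp
    by_cases hpV : p ∈ V
    · refine ⟨hpV, ?_⟩
      have h1 : Tendsto g (𝓝[K] p) (𝓝 (g p)) := (hgc p hpV).mono_left
        (nhdsWithin_mono _ (fun z hz => hz.1))
      refine ge_of_tendsto h1 ?_
      filter_upwards [self_mem_nhdsWithin] with z hz using hz.2
    · exfalso
      have hpf : p ∈ frontier U := by
        rw [hUo.frontier_eq]
        exact ⟨hpU, fun h => hpV (Or.inl h)⟩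
      rcases hfr p hpf with h | h
      · have h1 := h b' hb'1
        rw [eventually_nhdsWithin_iff, _root_.eventually_nhds_iff] at h1
        obtain ⟨O, hO, hOo, hpO⟩ := h1
        have h2 : ∀ᶠ z in 𝓝[K] p, z ∈ O ∧ z ∈ K :=
          Filter.Eventually.and (mem_nhdsWithin_of_mem_nhds (hOo.mem_nhds hpO)) self_mem_nhdsWithin
        obtain ⟨z, hzO, hzK⟩ := h2.exists
        have := hne z hzK.1
        have h3 : ∀ᶠ w in 𝓝[U] z, v w ≤ b' := by
          rw [eventually_nhdsWithin_iff]
          filter_upwards [hOo.mem_nhds hzO] with w hw hwU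
          exact (hO w hw hwU).le
        have h4 := le_of_tendsto (hgt z hzK.1) h3
        have h5 := hzK.2
        linarith
      · exact hpV (Or.inr ⟨hpf, h⟩)
  have hKcomp : IsCompact K := Metric.isCompact_of_isClosed_isBounded hKc hKb
  have hz₀K : z₀ ∈ K := ⟨Or.inl hz₀, by rw [hgU z₀ hz₀]; exact hb2.le⟩
  have hgcK : ContinuousOn g K := hgc.mono (fun z hz => hz.1)
  obtain ⟨z₁, hz₁K, hz₁⟩ := hKcomp.exists_isMaxOn ⟨z₀, hz₀K⟩ hgcK
  set S := g z₁ with hSdef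
  have hSmax : ∀ z ∈ V, g z ≤ S := by
    intro z hz
    by_cases h : b ≤ g z
    · exact hz₁ ⟨hz, h⟩
    · have := hz₁K.2
      push Not at h
      linarith
  set T : Set ℂ := K ∩ g ⁻¹' {S} with hT
  have hTc : IsCompact T :=
    hKcomp.of_isClosed_subset (hgcK.preimage_isClosed_of_isClosed hKc isClosed_singleton)
      inter_subset_left
  obtain ⟨w, hwT, hw⟩ := hTc.exists_isMaxOn ⟨z₁, hz₁K, rfl⟩ Complex.continuous_im.continuousOn
  have hTmem : ∀ z ∈ U, v z = S → z ∈ T := by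
    intro z hz hzS
    have h1 : g z = S := by rw [hgU z hz, hzS]
    exact ⟨⟨Or.inl hz, by rw [h1]; exact hz₁K.2⟩, h1⟩
  have hUS : ∀ z ∈ U, (φ z).im ≤ S := by
    intro z hz
    have := hSmax z (Or.inl hz)
    rwa [hgU z hz] at this
  have hwS : g w = S := hwT.2
  rcases hwT.1.1 with hwU | hwN
  · have h1 := local_max hUo hφ hUS hwU (by rw [← hwS, hgU w hwU])
    have h2 : Tendsto (fun e : ℝ => w + e * I) (𝓝[>] (0:ℝ)) (𝓝 w) := by
      have hc : Continuous (fun e : ℝ => w + e * I) := by fun_prop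
      have := hc.tendsto 0
      simp only [ofReal_zero, zero_mul, add_zero] at this
      exact this.mono_left nhdsWithin_le_nhds
    have h3 := h2.eventually (h1.and (hUo.mem_nhds hwU))
    obtain ⟨e, he, he0⟩ := (h3.and self_mem_nhdsWithin).exists
    have h4 := hw (hTmem _ he.2 he.1)
    have he0' : (0:ℝ) < e := he0
    simp at h4
    linarith
  · obtain ⟨hwf, q, ρ, c, rfl, hρ, hb, h1, h2⟩ := hwN
    obtain ⟨ℓ, hℓ⟩ := h2 q (by simpa using hρ)
    have hℓS : ℓ = S := by
      have := hne _ (Or.inr ⟨hwf, q, ρ, c, rfl, hρ, hb, h1, h2⟩ : (q : ℂ) ∈ V)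
      rw [← hwS]
      exact tendsto_nhds_unique (hℓ.mono_left (nhdsWithin_mono _ hUs)) (hgt _ hwT.1.1)
    subst hℓS
    have h3 := neumann (hφ.mono hb) h1 h2 (fun z hz => hUS z (hb hz)) hℓ (ρ / 2)
      ⟨by linarith, by linarith⟩
    have h5 : (q : ℂ) + ((ρ / 2 : ℝ) : ℂ) * I ∈ U := by
      apply hb
      refine ⟨?_, ?_⟩
      · rw [mem_ball, Complex.dist_eq]
        simp only [add_sub_cancel_left, norm_mul, norm_I, mul_one, Complex.norm_real]
        rw [Real.norm_of_nonneg (by linarith)]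
        linarith
      · simp only [UHP, Set.mem_ofPred_eq]
        simpa using hρ
    have h4 := hw (hTmem _ h5 h3)
    simp at h4
    linarith

/-- A bounded solution with zero boundary values near an isolated boundary point. -/
lemma puncture {f : ℂ → ℂ} (hf : DifferentiableOn ℂ f UHP) {C : ℝ}
    (hC : ∀ z ∈ UHP, (f z).im ≤ C) {t ρ : ℝ} (hρ : 0 < ρ)
    (h0 : ∀ q : ℝ, |q - t| ≤ ρ → q ≠ t → Tendsto (fun z => (f z).im) (𝓝[UHP] (q : ℂ)) (𝓝 0)) :
    ∀ b > 0, ∀ᶠ z in 𝓝[UHP] (t : ℂ), (f z).im < b := by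
  intro b hb
  set C' := max C 0 with hC'
  have hC'0 : 0 ≤ C' := le_max_right _ _
  have hC'1 : ∀ z ∈ UHP, (f z).im ≤ C' := fun z hz => (hC z hz).trans (le_max_left _ _)
  have hend : ∀ q : ℝ, |q - t| = ρ → ∃ r > 0, ∀ y : ℝ, 0 < y → y < r →
      (f (q + y * I)).im < b / 2 := by
    intro q hq
    have hqt : q ≠ t := by
      rintro rfl
      simp at hq
      linarith
    have h1 := (h0 q hq.le hqt).eventually (gt_mem_nhds (half_pos hb))
    rw [eventually_nhdsWithin_iff, Metric.eventually_nhds_iff] at h1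
    obtain ⟨r, hr, h1⟩ := h1
    refine ⟨r, hr, fun y hy hyr => h1 ?_ ?_⟩
    · rw [Complex.dist_eq]
      simpa [abs_of_pos hy] using hyr
    · simpa [UHP] using hy
  obtain ⟨r1, hr1, hr1'⟩ := hend (t + ρ) (by simp [abs_of_pos hρ])
  obtain ⟨r2, hr2, hr2'⟩ := hend (t - ρ) (by simp [abs_of_pos hρ])
  set r := min 1 (min r1 r2) with hr
  have hr0 : 0 < r := lt_min one_pos (lt_min hr1 hr2)
  have hrle1 : r ≤ 1 := min_le_left _ _
  have hrr1 : r ≤ r1 := (min_le_right _ _).trans (min_le_left _ _)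
  have hrr2 : r ≤ r2 := (min_le_right _ _).trans (min_le_right _ _)
  set A := C' / r with hA
  have hA0 : 0 ≤ A := div_nonneg hC'0 hr0.le
  have hAr : A * r = C' := by rw [hA]; field_simp
  set U : Set ℂ := {z | |z.re - t| < ρ ∧ 0 < z.im ∧ z.im < 1} with hU
  have hcr : Continuous (fun z : ℂ => |z.re - t|) := by fun_prop
  have hcA : Continuous (fun z : ℂ => A * z.im) := by fun_prop
  have hUo : IsOpen U := by
    refine (isOpen_lt hcr continuous_const).inter
      ((isOpen_lt continuous_const Complex.continuous_im).inter
        (isOpen_lt Complex.continuous_im continuous_const))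
  have hUs : U ⊆ UHP := fun z hz => hz.2.1
  have hUcl : closure U ⊆ {z | |z.re - t| ≤ ρ ∧ 0 ≤ z.im ∧ z.im ≤ 1} := by
    apply closure_minimal
    · intro z hz
      exact ⟨hz.1.le, hz.2.1.le, hz.2.2.le⟩
    · exact (isClosed_le hcr continuous_const).inter
        ((isClosed_le continuous_const Complex.continuous_im).inter
          (isClosed_le Complex.continuous_im continuous_const))
  have hUnorm : ∀ z ∈ U, 0 < ‖z - t‖ ∧ ‖z - t‖ ≤ ρ + 1 := by
    intro z hz
    constructor
    · rw [norm_pos_iff]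
      intro h
      have := congrArg Complex.im h
      simp at this
      linarith [hz.2.1]
    · refine (Complex.norm_le_abs_re_add_abs_im _).trans ?_
      simp only [sub_re, ofReal_re, sub_im, ofReal_im, sub_zero]
      rw [abs_of_pos hz.2.1]
      linarith [hz.1, hz.2.2]
  have main : ∀ η > 0, ∀ z ∈ U,
      (f z).im - b / 2 - A * z.im + η * Real.log (‖z - t‖ / (ρ + 1)) ≤ 0 := by
    intro η hη
    set φ : ℂ → ℂ := fun z => f z - ((b / 2 : ℝ) : ℂ) * I - (A : ℂ) * z +
      (η : ℂ) * I * Complex.log ((z - t) / ((ρ + 1 : ℝ) : ℂ)) with hφ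
    have hφim : ∀ z, (φ z).im = (f z).im - b / 2 - A * z.im +
        η * Real.log (‖z - t‖ / (ρ + 1)) := by
      intro z
      simp only [hφ, add_im, sub_im, mul_im, ofReal_re, ofReal_im, I_re, I_im, mul_re,
        Complex.log_re, norm_div, Complex.norm_real]
      rw [Real.norm_of_nonneg (by linarith : (0:ℝ) ≤ ρ + 1)]
      ring
    have hlog : ∀ z ∈ U, Real.log (‖z - t‖ / (ρ + 1)) ≤ 0 := by
      intro z hz
      apply Real.log_nonpos (by positivity)
      rw [div_le_one (by linarith)]
      exact (hUnorm z hz).2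
    have hφd : DifferentiableOn ℂ φ U := by
      have h1 : DifferentiableOn ℂ (fun z : ℂ => Complex.log ((z - t) / ((ρ + 1 : ℝ) : ℂ))) U := by
        apply DifferentiableOn.clog (by fun_prop)
        intro z hz
        right
        rw [Complex.div_ofReal_im]
        simp only [sub_im, ofReal_im, sub_zero]
        have := hz.2.1
        positivity
      exact (((hf.mono hUs).sub_const _).sub (by fun_prop)).add (h1.const_mul _)
    intro z hz
    rw [← hφim]
    refine mixed_max hUo hUs hφd (B := 0) ?_ ?_ z hz
    · intro p hp
      left
      intro b1 hb1
      rw [hUo.frontier_eq] at hp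
      obtain ⟨hpc, hpU⟩ := hp
      obtain ⟨hp1, hp2, hp3⟩ := hUcl hpc
      have hself : ∀ᶠ z in 𝓝[U] p, z ∈ U := self_mem_nhdsWithin
      rcases eq_or_lt_of_le hp2 with hp0 | hp0
      · have e : p = (p.re : ℂ) := Complex.ext (by simp) (by simpa using hp0.symm)
        by_cases hpt : p.re = t
        · have hpt' : p = (t : ℂ) := by rw [e, hpt]
          set δ := (ρ + 1) * Real.exp (-C' / η) with hδ
          have hδ0 : 0 < δ := by positivity
          have hball : ∀ᶠ z in 𝓝[U] p, z ∈ ball p δ :=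
            mem_nhdsWithin_of_mem_nhds (ball_mem_nhds _ hδ0)
          filter_upwards [hself, hball] with z hz hzb
          rw [hφim]
          rw [mem_ball, Complex.dist_eq, hpt'] at hzb
          have h1 : Real.log (‖z - t‖ / (ρ + 1)) ≤ -C' / η := by
            rw [Real.log_le_iff_le_exp (by have := (hUnorm z hz).1; positivity)]
            rw [div_le_iff₀ (by linarith)]
            rw [mul_comm]; exact hzb.le
          have h2 : η * Real.log (‖z - t‖ / (ρ + 1)) ≤ -C' := by
            calc _ ≤ η * (-C' / η) := mul_le_mul_of_nonneg_left h1 hη.le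
              _ = -C' := by field_simp
          have h3 := hC'1 z (hUs hz)
          have h4 : 0 ≤ A * z.im := mul_nonneg hA0 hz.2.1.le
          linarith
        · have h1 := (h0 p.re hp1 hpt).eventually (gt_mem_nhds (half_pos hb))
          rw [← e] at h1
          filter_upwards [hself, h1.filter_mono (nhdsWithin_mono _ hUs)] with z hz hz1
          rw [hφim]
          have h4 : 0 ≤ A * z.im := mul_nonneg hA0 hz.2.1.le
          have h5 := mul_nonpos_of_nonneg_of_nonpos hη.le (hlog z hz)
          linarith
      · have hpH : p ∈ UHP := hp0
        have hval : (f p).im - b / 2 - A * p.im < b1 := by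
          have hcase : A * p.im ≥ C' → (f p).im - b / 2 - A * p.im < b1 := by
            intro h
            have := hC'1 p hpH
            linarith
          by_cases hpr : r ≤ p.im
          · apply hcase
            rw [← hAr]
            exact mul_le_mul_of_nonneg_left hpr hA0
          · push Not at hpr
            have hpρ : |p.re - t| = ρ := by
              apply le_antisymm hp1
              by_contra hlt
              push Not at hlt
              exact hpU ⟨hlt, hp0, by linarith⟩
            have hAp : 0 ≤ A * p.im := mul_nonneg hA0 hp2
            have e : p = (p.re : ℂ) + p.im * I := (Complex.re_add_im p).symm
            have : (f p).im < b / 2 := by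
              rcases (abs_eq hρ.le).1 hpρ with h | h
              · have h' : p.re = t + ρ := by linarith
                have := hr1' p.im hp0 (by linarith)
                rw [← h', ← e] at this
                exact this
              · have h' : p.re = t - ρ := by linarith
                have := hr2' p.im hp0 (by linarith)
                rw [← h', ← e] at this
                exact this
            linarith
        have hcont : ContinuousAt (fun z : ℂ => (f z).im - b / 2 - A * z.im) p := by
          have h1 := (hf.differentiableAt (isOpen_UHP.mem_nhds hpH)).continuousAt
          have h2 : ContinuousAt (fun z => (f z).im) p := Complex.continuous_im.continuousAt.comp h1
          fun_prop
        have h1 := hcont.eventually (gt_mem_nhds hval)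
        filter_upwards [hself, mem_nhdsWithin_of_mem_nhds h1] with z hz hz1
        rw [hφim]
        have h5 := mul_nonpos_of_nonneg_of_nonpos hη.le (hlog z hz)
        have hz1' : (f z).im - b / 2 - A * z.im < b1 := hz1
        linarith
    · intro b1 hb1
      refine ⟨ρ + 1 + |t|, fun z hz hzR => ?_⟩
      exfalso
      have h1 := (hUnorm z hz).2
      have h2 : ‖z‖ ≤ ‖z - t‖ + ‖(t : ℂ)‖ := by
        have := norm_add_le (z - t) (t : ℂ)
        simpa using this
      rw [Complex.norm_real, Real.norm_eq_abs] at h2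
      linarith
  have main2 : ∀ z ∈ U, (f z).im ≤ b / 2 + A * z.im := by
    intro z hz
    have h1 : Tendsto (fun η : ℝ => (f z).im - b / 2 - A * z.im +
        η * Real.log (‖z - t‖ / (ρ + 1))) (𝓝[>] 0) (𝓝 ((f z).im - b / 2 - A * z.im +
        0 * Real.log (‖z - t‖ / (ρ + 1)))) := by
      have : Continuous (fun η : ℝ => (f z).im - b / 2 - A * z.im +
        η * Real.log (‖z - t‖ / (ρ + 1))) := by fun_prop
      exact (this.tendsto 0).mono_left nhdsWithin_le_nhds
    have h2 := le_of_tendsto h1 (by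
      filter_upwards [self_mem_nhdsWithin] with η hη using main η hη z hz)
    linarith
  have hO : ∀ᶠ z in 𝓝 (t : ℂ), |z.re - t| < ρ ∧ z.im < 1 ∧ A * z.im < b / 2 := by
    have hopen : IsOpen {z : ℂ | |z.re - t| < ρ ∧ z.im < 1 ∧ A * z.im < b / 2} :=
      (isOpen_lt hcr continuous_const).inter
        ((isOpen_lt Complex.continuous_im continuous_const).inter
          (isOpen_lt hcA continuous_const))
    exact hopen.mem_nhds (by simp; exact ⟨hρ, hb⟩)
  rw [eventually_nhdsWithin_iff]
  filter_upwards [hO] with z hz hzU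
  have := main2 z ⟨hz.1, hzU, hz.2.1⟩
  linarith [hz.2.2]

/-- A quantitative Hopf lemma. -/
lemma hopf {f : ℂ → ℂ} (hf : DifferentiableOn ℂ f UHP) {M : ℝ}
    (hM : ∀ z ∈ UHP, (f z).im < M) (a b : ℝ) :
    ∃ κ > 0, ∀ x ∈ Icc a b, ∀ d ∈ Ioc (0:ℝ) 1, (f (x + d * I)).im ≤ M - κ * d := by
  set g : ℂ → ℂ := fun z => (M : ℂ) * I - f z with hg
  have hgim : ∀ z, (g z).im = M - (f z).im := by intro z; simp [hg]
  have hgd : DifferentiableOn ℂ g UHP := hf.const_sub _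
  have hIU : I ∈ UHP := by simp [UHP]
  set p := g I with hp
  set m := p.im with hm
  have hm0 : 0 < m := by rw [hm, hp, hgim]; linarith [hM I hIU]
  have hden : ∀ z ∈ UHP, g z - (starRingEnd ℂ) p ≠ 0 := by
    intro z hz h
    have h1 := congrArg Complex.im h
    rw [sub_im, hgim] at h1
    simp only [conj_im, zero_im] at h1
    linarith [hM z hz]
  have hsq : ∀ z, ‖g z - (starRingEnd ℂ) p‖ ^ 2 - ‖g z - p‖ ^ 2 = 4 * (g z).im * m := by
    intro z
    rw [← Complex.normSq_eq_norm_sq, ← Complex.normSq_eq_norm_sq, normSq_apply, normSq_apply]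
    simp only [sub_re, sub_im, conj_re, conj_im]
    ring
  set T : ℂ → ℂ := fun ζ => I * (1 + ζ) / (1 - ζ) with hT
  have h1ζ : ∀ ζ ∈ ball (0:ℂ) 1, (1 - ζ) ≠ 0 := by
    intro ζ hζ h
    have : ζ = 1 := (sub_eq_zero.1 h).symm
    rw [this] at hζ
    simp at hζ
  have hTU : ∀ ζ ∈ ball (0:ℂ) 1, T ζ ∈ UHP := by
    intro ζ hζ
    have h1 := h1ζ ζ hζ
    have h2 : (T ζ).im = (1 - normSq ζ) / normSq (1 - ζ) := by
      simp only [hT, div_im, mul_im, mul_re, I_re, I_im, add_re, add_im, one_re, one_im, sub_re,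
        sub_im, normSq_apply]
      ring
    simp only [UHP, Set.mem_ofPred_eq, h2]
    apply div_pos
    · rw [Complex.normSq_eq_norm_sq]
      have : ‖ζ‖ < 1 := by simpa using hζ
      nlinarith [norm_nonneg ζ]
    · exact normSq_pos.2 h1
  set q : ℂ → ℂ := fun ζ => (g (T ζ) - p) / (g (T ζ) - (starRingEnd ℂ) p) with hq
  have hqd : DifferentiableOn ℂ q (ball 0 1) := by
    have hTd : DifferentiableOn ℂ T (ball 0 1) := by
      apply DifferentiableOn.div (by fun_prop) (by fun_prop) h1ζ
    have hgT : DifferentiableOn ℂ (fun ζ => g (T ζ)) (ball 0 1) := hgd.comp hTd hTU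
    exact (hgT.sub_const _).div (hgT.sub_const _) (fun ζ hζ => hden _ (hTU ζ hζ))
  have hqm : MapsTo q (ball 0 1) (ball 0 1) := by
    intro ζ hζ
    have h1 := hTU ζ hζ
    have h2 := hsq (T ζ)
    have h3 : 0 < (g (T ζ)).im := by rw [hgim]; linarith [hM _ h1]
    have h4 : 0 < ‖g (T ζ) - (starRingEnd ℂ) p‖ := norm_pos_iff.2 (hden _ h1)
    rw [mem_ball_zero_iff, hq]
    simp only [norm_div]
    rw [div_lt_one h4]
    have h5 : 0 < 4 * (g (T ζ)).im * m := by positivity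
    exact lt_of_pow_lt_pow_left₀ 2 h4.le (by linarith)
  have hq0 : q 0 = 0 := by simp [hq, hT, hp]
  have hL : 0 < a ^ 2 + b ^ 2 + 4 := by positivity
  refine ⟨m / (a ^ 2 + b ^ 2 + 4), div_pos hm0 hL, ?_⟩
  intro x hx d hd
  set z : ℂ := x + d * I with hz
  have hzre : z.re = x := by simp [hz]
  have hzim : z.im = d := by simp [hz]
  have hzU : z ∈ UHP := by simp only [UHP, Set.mem_ofPred_eq, hzim]; exact hd.1
  have hzI : z + I ≠ 0 := by
    intro h
    have := congrArg Complex.im h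
    simp only [add_im, hzim, I_im, zero_im] at this
    linarith [hd.1]
  set ζ := (z - I) / (z + I) with hζ
  have hsq2 : ‖z + I‖ ^ 2 - ‖z - I‖ ^ 2 = 4 * d := by
    rw [← Complex.normSq_eq_norm_sq, ← Complex.normSq_eq_norm_sq, normSq_apply, normSq_apply]
    simp only [add_re, add_im, sub_re, sub_im, hzre, hzim, I_re, I_im]
    ring
  have hzIpos : 0 < ‖z + I‖ := norm_pos_iff.2 hzI
  have hζn : ‖ζ‖ < 1 := by
    rw [hζ, norm_div, div_lt_one hzIpos]
    exact lt_of_pow_lt_pow_left₀ 2 hzIpos.le (by linarith [hd.1])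
  have hTζ : T ζ = z := by
    have h1 := h1ζ ζ (by simpa using hζn)
    simp only [hT]
    rw [div_eq_iff h1, hζ]
    field_simp
    ring
  have hS := Complex.norm_le_norm_of_mapsTo_ball hqd (hqm.mono_right ball_subset_closedBall) hq0 hζn
  simp only [hq, hTζ] at hS
  rw [hζ, norm_div, norm_div] at hS
  have h4 : 0 < ‖g z - (starRingEnd ℂ) p‖ := norm_pos_iff.2 (hden _ hzU)
  rw [div_le_div_iff₀ h4 hzIpos] at hS
  have hS2 : (‖g z - p‖ * ‖z + I‖) ^ 2 ≤ (‖z - I‖ * ‖g z - (starRingEnd ℂ) p‖) ^ 2 :=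
    pow_le_pow_left₀ (by positivity) hS 2
  rw [mul_pow, mul_pow] at hS2
  have hgz : 0 < (g z).im := by rw [hgim]; linarith [hM _ hzU]
  have h6 : m ≤ ‖g z - (starRingEnd ℂ) p‖ := by
    have := Complex.abs_im_le_norm (g z - (starRingEnd ℂ) p)
    simp only [sub_im, conj_im] at this
    have h7 := le_abs_self ((g z).im - -p.im)
    linarith
  have h7 : m ^ 2 ≤ ‖g z - (starRingEnd ℂ) p‖ ^ 2 := pow_le_pow_left₀ hm0.le h6 2
  have h8 : d * ‖g z - (starRingEnd ℂ) p‖ ^ 2 ≤ (g z).im * m * ‖z + I‖ ^ 2 := by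
    have e1 := hsq z
    have e3 : ‖g z - p‖ ^ 2 = ‖g z - (starRingEnd ℂ) p‖ ^ 2 - 4 * (g z).im * m := by linarith
    have e4 : ‖z - I‖ ^ 2 = ‖z + I‖ ^ 2 - 4 * d := by linarith
    rw [e3, e4] at hS2
    nlinarith
  have h9 : ‖z + I‖ ^ 2 ≤ a ^ 2 + b ^ 2 + 4 := by
    rw [← Complex.normSq_eq_norm_sq, normSq_apply]
    simp only [add_re, add_im, hzre, hzim, I_re, I_im]
    have hx2 : x ^ 2 ≤ a ^ 2 + b ^ 2 := by
      rcases le_total 0 x with h | h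
      · nlinarith [hx.2, sq_nonneg a]
      · nlinarith [hx.1, sq_nonneg b]
    nlinarith [hd.1, hd.2]
  have h10 : d * m ^ 2 ≤ (g z).im * m * (a ^ 2 + b ^ 2 + 4) := by
    calc d * m ^ 2 ≤ d * ‖g z - (starRingEnd ℂ) p‖ ^ 2 := mul_le_mul_of_nonneg_left h7 hd.1.le
      _ ≤ (g z).im * m * ‖z + I‖ ^ 2 := h8
      _ ≤ _ := mul_le_mul_of_nonneg_left h9 (by positivity)
  have h11 : m / (a ^ 2 + b ^ 2 + 4) * d ≤ (g z).im := by
    rw [div_mul_eq_mul_div, div_le_iff₀ hL]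
    have : m * (m * d) ≤ m * ((g z).im * (a ^ 2 + b ^ 2 + 4)) := by nlinarith
    exact le_of_mul_le_mul_left this hm0
  rw [hgim] at h11
  linarith

lemma abs_integral_le_of {F : ℝ → ℝ} {a b C : ℝ} (h : ∀ x ∈ uIoc a b, |F x| ≤ C) :
    |∫ x in a..b, F x| ≤ C * |b - a| :=
  intervalIntegral.norm_integral_le_of_norm_le_const (f := F) h

lemma mem_UHP_of {x y : ℝ} (hy : 0 < y) : (x : ℂ) + y * I ∈ UHP := by
  simpa [UHP] using hy

/-- Averages of the real part on a small square next to the boundary. -/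
lemma square {f : ℂ → ℂ} (hf : DifferentiableOn ℂ f UHP) {x₁ x₂ e d c v₀ ω : ℝ}
    (he : 0 < e) (hed : e < d) (hx : x₂ - x₁ = d) (hω : 0 ≤ ω)
    (hbase : ∀ x ∈ Icc x₁ x₂, |(f (x + e * I)).re - c| ≤ ω)
    (hs1 : ∀ y ∈ Icc e d, |(f (x₁ + y * I)).im - v₀| ≤ ω)
    (hs2 : ∀ y ∈ Icc e d, |(f (x₂ + y * I)).im - v₀| ≤ ω) :
    (∃ x ∈ Icc x₁ x₂, (∫ y in e..d, ((f (x + y * I)).re - c)) ≤ 3 * ω * d) ∧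
    (∃ x ∈ Icc x₁ x₂, -(3 * ω * d) ≤ (∫ y in e..d, ((f (x + y * I)).re - c))) := by
  have hd : 0 < d := he.trans hed
  have hx12 : x₁ ≤ x₂ := by linarith
  have hc := hf.continuousOn
  have hcx : ∀ y : ℝ, 0 < y → Continuous (fun x : ℝ => f (x + y * I)) := fun y hy =>
    hc.comp_continuous (by fun_prop) (fun x => mem_UHP_of hy)
  have hcy : ∀ x : ℝ, ContinuousOn (fun y : ℝ => f (x + y * I)) (Icc e d) := fun x =>
    hc.comp (by fun_prop) (fun y hy => mem_UHP_of (he.trans_le hy.1))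
  have hrow : ∀ τ ∈ Icc e d, |∫ x in x₁..x₂, ((f (x + τ * I)).re - c)| ≤ 3 * ω * d := by
    intro τ hτ
    have hsub : Icc x₁ x₂ ×ℂ Icc e τ ⊆ UHP := by
      intro z hz
      rw [mem_reProdIm] at hz
      exact he.trans_le hz.2.1
    have hsub2 : Ioo x₁ x₂ ×ℂ Ioo e τ ⊆ UHP := by
      intro z hz
      rw [mem_reProdIm] at hz
      exact he.trans hz.2.1
    have key := (rect_identity hx12 hτ.1 (hc.mono hsub) (hf.mono hsub2)).2
    have hτ0 : 0 < τ := he.trans_le hτ.1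
    have i1 : ∀ y : ℝ, 0 < y → IntervalIntegrable (fun x : ℝ => (f (x + y * I)).re)
        MeasureTheory.volume x₁ x₂ := fun y hy =>
      (Complex.continuous_re.comp (hcx y hy)).intervalIntegrable _ _
    have i2 : ∀ x : ℝ, IntervalIntegrable (fun y : ℝ => (f (x + y * I)).im)
        MeasureTheory.volume e τ := by
      intro x
      apply ContinuousOn.intervalIntegrable
      rw [uIcc_of_le hτ.1]
      exact Complex.continuous_im.comp_continuousOn
        ((hcy x).mono (Icc_subset_Icc_right hτ.2))
    have b0 : |∫ x in x₁..x₂, ((f (x + e * I)).re - c)| ≤ ω * |x₂ - x₁| := by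
      apply abs_integral_le_of
      intro x hx'
      rw [uIoc_of_le hx12] at hx'
      exact hbase x (Ioc_subset_Icc_self hx')
    have b1 : ∀ x : ℝ, (∀ y ∈ Icc e d, |(f (x + y * I)).im - v₀| ≤ ω) →
        |∫ y in e..τ, ((f (x + y * I)).im - v₀)| ≤ ω * |τ - e| := by
      intro x hx'
      apply abs_integral_le_of
      intro y hy
      rw [uIoc_of_le hτ.1] at hy
      exact hx' y ⟨hy.1.le, hy.2.trans hτ.2⟩
    have b2 := b1 x₁ hs1
    have b3 := b1 x₂ hs2
    rw [intervalIntegral.integral_sub (i2 _) (by simp)] at b2 b3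
    rw [intervalIntegral.integral_sub (i1 e he) (by simp)] at b0
    rw [intervalIntegral.integral_sub (i1 τ hτ0) (by simp)]
    rw [hx, abs_of_pos hd] at b0
    have hle : ω * |τ - e| ≤ ω * d := by
      apply mul_le_mul_of_nonneg_left _ hω
      rw [abs_of_nonneg (by linarith [hτ.1])]
      linarith [hτ.2]
    rw [abs_le] at b0 b2 b3 ⊢
    constructor <;> linarith [b0.1, b0.2, b2.1, b2.2, b3.1, b3.2]
  have hswap : (∫ x in x₁..x₂, ∫ y in e..d, ((f (x + y * I)).re - c)) =
      ∫ y in e..d, ∫ x in x₁..x₂, ((f (x + y * I)).re - c) := by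
    apply MeasureTheory.intervalIntegral_intervalIntegral_swap
    rw [uIoc_of_le hx12, uIoc_of_le hed.le]
    have : ContinuousOn (Function.uncurry fun x y : ℝ => (f (x + y * I)).re - c)
        (Icc x₁ x₂ ×ˢ Icc e d) := by
      have h1 : ContinuousOn (fun q : ℝ × ℝ => f (q.1 + q.2 * I)) (Icc x₁ x₂ ×ˢ Icc e d) :=
        hc.comp (by fun_prop) (fun q hq => mem_UHP_of (he.trans_le hq.2.1))
      exact (Complex.continuous_re.comp_continuousOn h1).sub continuousOn_const
    exact (this.integrableOn_compact (isCompact_Icc.prod isCompact_Icc)).mono_set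
      (prod_mono Ioc_subset_Icc_self Ioc_subset_Icc_self)
  have htot : |∫ x in x₁..x₂, ∫ y in e..d, ((f (x + y * I)).re - c)| ≤ 3 * ω * d * d := by
    rw [hswap]
    have : |∫ y in e..d, ∫ x in x₁..x₂, ((f (x + y * I)).re - c)| ≤ 3 * ω * d * |d - e| := by
      apply abs_integral_le_of
      intro y hy
      rw [uIoc_of_le hed.le] at hy
      exact hrow y (Ioc_subset_Icc_self hy)
    refine this.trans (mul_le_mul_of_nonneg_left ?_ (by positivity))
    rw [abs_of_pos (by linarith)]; linarith
  have hΦc : ContinuousOn (fun x : ℝ => ∫ y in e..d, ((f (x + y * I)).re - c)) (Icc x₁ x₂) := by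
    -- replace `y` by `max e y` to get a globally continuous integrand
    have h1 : Continuous (Function.uncurry fun x y : ℝ => (f (x + (max e y : ℝ) * I)).re - c) := by
      have : Continuous (fun q : ℝ × ℝ => f (q.1 + (max e q.2 : ℝ) * I)) :=
        hc.comp_continuous (by fun_prop) (fun q => mem_UHP_of (he.trans_le (le_max_left _ _)))
      exact (Complex.continuous_re.comp this).sub continuous_const
    have h2 := intervalIntegral.continuous_parametric_intervalIntegral_of_continuous' h1 e d
      (μ := MeasureTheory.volume)
    refine h2.continuousOn.congr ?_
    intro x _
    apply intervalIntegral.integral_congr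
    intro y hy
    rw [uIcc_of_le hed.le] at hy
    simp only [max_eq_right hy.1]
  have hΦi : IntervalIntegrable (fun x : ℝ => ∫ y in e..d, ((f (x + y * I)).re - c))
      MeasureTheory.volume x₁ x₂ := by
    apply ContinuousOn.intervalIntegrable
    rwa [uIcc_of_le hx12]
  rw [abs_le] at htot
  have hxlt : x₁ < x₂ := by linarith
  constructor
  · by_contra hcon
    push Not at hcon
    have := intervalIntegral.integral_lt_integral_of_continuousOn_of_le_of_exists_lt
      (f := fun _ => 3 * ω * d) hxlt continuousOn_const hΦc
      (fun x hx => (hcon x (Ioc_subset_Icc_self hx)).le)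
      ⟨x₁, left_mem_Icc.2 hx12, hcon _ (left_mem_Icc.2 hx12)⟩
    rw [intervalIntegral.integral_const, hx, smul_eq_mul] at this
    linarith [htot.2]
  · by_contra hcon
    push Not at hcon
    have := intervalIntegral.integral_lt_integral_of_continuousOn_of_le_of_exists_lt
      (g := fun _ => -(3 * ω * d)) hxlt hΦc continuousOn_const
      (fun x hx => (hcon x (Ioc_subset_Icc_self hx)).le)
      ⟨x₁, left_mem_Icc.2 hx12, hcon _ (left_mem_Icc.2 hx12)⟩
    rw [intervalIntegral.integral_const, hx, smul_eq_mul] at this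
    linarith [htot.1]

/-- If `Im f` attains its supremum on a boundary segment with equal end values of `Re f`,
then `Im f` attains it inside. -/
lemma key_segment {f : ℂ → ℂ} (hf : DifferentiableOn ℂ f UHP) {M c a b α β : ℝ}
    (hαa : α < a) (hab : a < b) (hbβ : b < β)
    (hl : ∀ p ∈ Ioo α a, Tendsto (fun z => (f z).re) (𝓝[UHP] ((p : ℝ) : ℂ)) (𝓝 c))
    (hr : ∀ p ∈ Ioo b β, Tendsto (fun z => (f z).re) (𝓝[UHP] ((p : ℝ) : ℂ)) (𝓝 c))
    (hm : ∀ p ∈ Icc a b, Tendsto (fun z => (f z).im) (𝓝[UHP] ((p : ℝ) : ℂ)) (𝓝 M))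
    (hM : ∀ z ∈ UHP, (f z).im ≤ M) : ∃ z ∈ UHP, (f z).im = M := by
  by_contra hcon
  push Not at hcon
  have hlt : ∀ z ∈ UHP, (f z).im < M := fun z hz => lt_of_le_of_ne (hM z hz) (hcon z hz)
  obtain ⟨κ, hκ, hhopf⟩ := hopf hf hlt a b
  -- choose ω
  obtain ⟨ω, hω, hωs⟩ : ∃ ω > 0, ω * (b - a) + 15 * ω < κ * (b - a) := by
    have hba : 0 < b - a := by linarith
    refine ⟨κ * (b - a) / (2 * (b - a + 15)), by positivity, ?_⟩
    have h1 : κ * (b - a) / (2 * (b - a + 15)) * (b - a + 15) = κ * (b - a) / 2 := by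
      field_simp
    have h2 : 0 < κ * (b - a) := by positivity
    nlinarith
  -- choose δ
  have hnear : ∀ p ∈ Icc a b, ∃ r > 0, ∀ z ∈ UHP, dist z (p : ℂ) < r → |(f z).im - M| < ω := by
    intro p hp
    have h1 := Metric.tendsto_nhds.1 (hm p hp) ω hω
    rw [eventually_nhdsWithin_iff, Metric.eventually_nhds_iff] at h1
    obtain ⟨r, hr, h1⟩ := h1
    exact ⟨r, hr, fun z hz hzr => h1 hzr hz⟩
  obtain ⟨ra, hra, hra'⟩ := hnear a (left_mem_Icc.2 hab.le)
  obtain ⟨rb, hrb, hrb'⟩ := hnear b (right_mem_Icc.2 hab.le)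
  obtain ⟨d, hd0, hd1, hdra, hdrb, hdα, hdβ⟩ : ∃ d : ℝ, 0 < d ∧ d ≤ 1 ∧ 4 * d ≤ ra ∧ 4 * d ≤ rb ∧
      2 * d < a - α ∧ 2 * d < β - b := by
    have h1 : 0 < a - α := by linarith
    have h2 : 0 < β - b := by linarith
    set D := min (min 1 (min ra rb)) (min (a - α) (β - b)) with hD
    have hDpos : 0 < D := lt_min (lt_min one_pos (lt_min hra hrb)) (lt_min h1 h2)
    have e1 : D ≤ 1 := (min_le_left _ _).trans (min_le_left _ _)
    have e2 : D ≤ ra := (min_le_left _ _).trans ((min_le_right _ _).trans (min_le_left _ _))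
    have e3 : D ≤ rb := (min_le_left _ _).trans ((min_le_right _ _).trans (min_le_right _ _))
    have e4 : D ≤ a - α := (min_le_right _ _).trans (min_le_left _ _)
    have e5 : D ≤ β - b := (min_le_right _ _).trans (min_le_right _ _)
    exact ⟨D / 4, by linarith, by linarith, by linarith, by linarith, by linarith, by linarith⟩
  have hdist : ∀ x y p : ℝ, |x - p| ≤ 2 * d → 0 < y → y ≤ d →
      dist ((x : ℂ) + y * I) (p : ℂ) < 4 * d := by
    intro x y p h1 h2 h3
    rw [Complex.dist_eq]
    refine (Complex.norm_le_abs_re_add_abs_im _).trans_lt ?_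
    simp only [sub_re, add_re, ofReal_re, mul_re, I_re, mul_zero, ofReal_im, I_im, mul_one,
      sub_self, add_zero, sub_im, add_im, mul_im, zero_add, sub_zero]
    rw [abs_of_pos h2]
    linarith
  have hA : ∀ x y : ℝ, |x - a| ≤ 2 * d → 0 < y → y ≤ d → |(f (x + y * I)).im - M| ≤ ω :=
    fun x y h1 h2 h3 => (hra' _ (mem_UHP_of h2) ((hdist x y a h1 h2 h3).trans_le hdra)).le
  have hB : ∀ x y : ℝ, |x - b| ≤ 2 * d → 0 < y → y ≤ d → |(f (x + y * I)).im - M| ≤ ω :=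
    fun x y h1 h2 h3 => (hrb' _ (mem_UHP_of h2) ((hdist x y b h1 h2 h3).trans_le hdrb)).le
  -- choose ε
  have u1 := uniform_level (P := fun z => |(f z).re - c| < ω) (α := a - 2 * d) (β := a - d) (by
    intro p hp
    exact Metric.tendsto_nhds.1 (hl p ⟨by linarith [hp.1], by linarith [hp.2]⟩) ω hω)
  have u2 := uniform_level (P := fun z => |(f z).re - c| < ω) (α := b + d) (β := b + 2 * d) (by
    intro p hp
    exact Metric.tendsto_nhds.1 (hr p ⟨by linarith [hp.1], by linarith [hp.2]⟩) ω hω)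
  have u3 := uniform_level (P := fun z => |(f z).im - M| < ω * d) (α := a) (β := b) (by
    intro p hp
    exact Metric.tendsto_nhds.1 (hm p hp) (ω * d) (by positivity))
  have u4 : ∀ᶠ ε : ℝ in 𝓝[>] (0:ℝ), ε < d :=
    nhdsWithin_le_nhds (gt_mem_nhds hd0)
  have u5 : ∀ᶠ ε : ℝ in 𝓝[>] (0:ℝ), 0 < ε := self_mem_nhdsWithin
  obtain ⟨e, h1, h2, h3, hed, he⟩ := (u1.and (u2.and (u3.and (u4.and u5)))).exists
  -- choose the sides
  obtain ⟨a', ha', ha''⟩ := (square hf he hed (x₁ := a - 2 * d) (x₂ := a - d) (c := c) (v₀ := M)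
    (by ring) hω.le (fun x hx => (h1 x hx).le)
    (fun y hy => hA _ y (by rw [abs_le]; constructor <;> linarith) (he.trans_le hy.1) hy.2)
    (fun y hy => hA _ y (by rw [abs_le]; constructor <;> linarith) (he.trans_le hy.1) hy.2)).1
  obtain ⟨b', hb', hb''⟩ := (square hf he hed (x₁ := b + d) (x₂ := b + 2 * d) (c := c) (v₀ := M)
    (by ring) hω.le (fun x hx => (h2 x hx).le)
    (fun y hy => hB _ y (by rw [abs_le]; constructor <;> linarith) (he.trans_le hy.1) hy.2)
    (fun y hy => hB _ y (by rw [abs_le]; constructor <;> linarith) (he.trans_le hy.1) hy.2)).2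
  have ha'a : a' ≤ a := by linarith [ha'.2]
  have hbb' : b ≤ b' := by linarith [hb'.1]
  have hc := hf.continuousOn
  have key := (rect_identity (f := f) (x₁ := a') (x₂ := b') (by linarith) hed.le
    (hc.mono (by
      intro z hz
      rw [mem_reProdIm] at hz
      exact he.trans_le hz.2.1))
    (hf.mono (by
      intro z hz
      rw [mem_reProdIm] at hz
      exact he.trans hz.2.1))).1
  have hcx : ∀ y : ℝ, 0 < y → Continuous (fun x : ℝ => (f (x + y * I)).im) := fun y hy =>
    Complex.continuous_im.comp (hc.comp_continuous (by fun_prop) (fun x => mem_UHP_of hy))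
  have hix : ∀ y : ℝ, 0 < y → ∀ s t : ℝ, IntervalIntegrable (fun x : ℝ => (f (x + y * I)).im)
    MeasureTheory.volume s t := fun y hy s t => (hcx y hy).intervalIntegrable _ _
  have hiy : ∀ x : ℝ, IntervalIntegrable (fun y : ℝ => (f (x + y * I)).re)
      MeasureTheory.volume e d := by
    intro x
    apply ContinuousOn.intervalIntegrable
    rw [uIcc_of_le hed.le]
    exact Complex.continuous_re.comp_continuousOn
      (hc.comp (by fun_prop) (fun y hy => mem_UHP_of (he.trans_le hy.1)))
  rw [intervalIntegral.integral_sub (hiy _) (by simp)] at ha'' hb''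
  set G : ℝ → ℝ := fun x => (f (x + e * I)).im - (f (x + d * I)).im with hG
  have hGc : Continuous G := (hcx e he).sub (hcx d hd0)
  have hGi : ∀ s t : ℝ, IntervalIntegrable G MeasureTheory.volume s t := fun s t =>
    hGc.intervalIntegrable _ _
  have hGint : (∫ x in a'..b', G x) =
      (∫ x in a'..b', (f (x + e * I)).im) - (∫ x in a'..b', (f (x + d * I)).im) :=
    intervalIntegral.integral_sub (hix e he _ _) (hix d hd0 _ _)
  have hsplit : (∫ x in a'..b', G x) = (∫ x in a'..a, G x) + (∫ x in a..b, G x) +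
      (∫ x in b..b', G x) := by
    rw [intervalIntegral.integral_add_adjacent_intervals (hGi _ _) (hGi _ _),
      intervalIntegral.integral_add_adjacent_intervals (hGi _ _) (hGi _ _)]
  have g1 : -(2 * ω) * (2 * d) ≤ ∫ x in a'..a, G x := by
    have : (∫ x in a'..a, (-(2 * ω))) ≤ ∫ x in a'..a, G x := by
      apply intervalIntegral.integral_mono_on ha'a (by simp) (hGi _ _)
      intro x hx
      have hxa : |x - a| ≤ 2 * d := by
        rw [abs_le]; constructor <;> linarith [hx.1, hx.2, ha'.1]
      have e1 := abs_le.1 (hA x e hxa he hed.le)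
      have e2 := abs_le.1 (hA x d hxa hd0 le_rfl)
      simp only [hG]
      linarith [e1.1, e2.2]
    rw [intervalIntegral.integral_const, smul_eq_mul] at this
    nlinarith [ha'.1]
  have g3 : -(2 * ω) * (2 * d) ≤ ∫ x in b..b', G x := by
    have : (∫ x in b..b', (-(2 * ω))) ≤ ∫ x in b..b', G x := by
      apply intervalIntegral.integral_mono_on hbb' (by simp) (hGi _ _)
      intro x hx
      have hxa : |x - b| ≤ 2 * d := by
        rw [abs_le]; constructor <;> linarith [hx.1, hx.2, hb'.2]
      have e1 := abs_le.1 (hB x e hxa he hed.le)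
      have e2 := abs_le.1 (hB x d hxa hd0 le_rfl)
      simp only [hG]
      linarith [e1.1, e2.2]
    rw [intervalIntegral.integral_const, smul_eq_mul] at this
    nlinarith [hb'.2]
  have g2 : (b - a) * (κ * d - ω * d) ≤ ∫ x in a..b, G x := by
    have : (∫ x in a..b, (κ * d - ω * d)) ≤ ∫ x in a..b, G x := by
      apply intervalIntegral.integral_mono_on hab.le (by simp) (hGi _ _)
      intro x hx
      have e1 := abs_lt.1 (h3 x hx)
      have e2 := hhopf x hx d ⟨hd0, hd1⟩
      simp only [hG]
      linarith [e1.1]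
    rwa [intervalIntegral.integral_const, smul_eq_mul] at this
  have hfinal : (b - a) * (κ * d - ω * d) ≤ 14 * ω * d := by
    linarith
  have : d * (κ * (b - a)) ≤ d * (ω * (b - a) + 14 * ω) := by nlinarith
  have := le_of_mul_le_mul_left this hd0
  linarith

lemma tendsto_arg_pos {x : ℝ} (hx : 0 < x) :
    Tendsto Complex.arg (𝓝[UHP] (x : ℂ)) (𝓝 0) := by
  have h : ContinuousAt Complex.arg (x : ℂ) :=
    Complex.continuousAt_arg (Complex.ofReal_mem_slitPlane.2 hx)
  have h2 := h.tendsto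
  rw [Complex.arg_ofReal_of_nonneg hx.le] at h2
  exact h2.mono_left nhdsWithin_le_nhds

lemma tendsto_arg_neg {x : ℝ} (hx : x < 0) :
    Tendsto Complex.arg (𝓝[UHP] (x : ℂ)) (𝓝 Real.pi) := by
  have h := Complex.tendsto_arg_nhdsWithin_im_nonneg_of_re_neg_of_im_zero (z := (x : ℂ))
    (by simpa using hx) (by simp)
  refine h.mono_left (nhdsWithin_mono _ ?_)
  intro z hz
  exact le_of_lt (show 0 < z.im from hz)

/-- Phragmen-Lindelof type estimate outside a half disc. -/
lemma exterior {f : ℂ → ℂ} (hf : DifferentiableOn ℂ f UHP) {C R m : ℝ} (hR : 0 < R)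
    (hC : ∀ z ∈ UHP, (f z).im ≤ C)
    (hre : ∀ p : ℝ, R < |p| → Tendsto (fun z => (f z).re) (𝓝[UHP] (p : ℂ)) (𝓝 0))
    (him : ∀ p : ℝ, R < |p| → ∃ l : ℝ, Tendsto (fun z => (f z).im) (𝓝[UHP] (p : ℂ)) (𝓝 l))
    (hm : ∀ p : ℂ, ‖p‖ = R → 0 ≤ p.im → ∀ b > m, ∀ᶠ z in 𝓝[UHP] p, (f z).im < b) :
    ∀ z ∈ UHP, R < ‖z‖ → (f z).im ≤ m := by
  intro z₀ hz₀ hRz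
  have hopen : IsOpen {z : ℂ | R < ‖z‖} := isOpen_lt continuous_const continuous_norm
  set U : Set ℂ := {z : ℂ | R < ‖z‖} ∩ UHP with hU
  have hUo : IsOpen U := hopen.inter isOpen_UHP
  have hUs : U ⊆ UHP := inter_subset_right
  have hclU : ∀ p ∈ closure U, R ≤ ‖p‖ ∧ 0 ≤ p.im := by
    intro p hp
    have hcl : IsClosed {z : ℂ | R ≤ ‖z‖ ∧ 0 ≤ z.im} :=
      (isClosed_le continuous_const continuous_norm).inter
        (isClosed_le continuous_const Complex.continuous_im)
    have hsub : U ⊆ {z : ℂ | R ≤ ‖z‖ ∧ 0 ≤ z.im} := fun z hz =>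
      ⟨le_of_lt (show R < ‖z‖ from hz.1), le_of_lt (show 0 < z.im from hz.2)⟩
    exact closure_minimal hsub hcl hp
  -- the estimate for each positive parameter
  have main : ∀ η : ℝ, 0 < η →
      (f z₀).im - η * (Real.log ‖z₀‖ - Real.log R) ≤ m := by
    intro η hη
    let φ : ℂ → ℂ := fun z => f z - I * η * (Complex.log z - (Real.log R : ℝ))
    have hφim : ∀ z, (φ z).im = (f z).im - η * (Real.log ‖z‖ - Real.log R) := by
      intro z
      simp [φ, Complex.log_re]
    have hφre : ∀ z, (φ z).re = (f z).re + η * Complex.arg z := by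
      intro z
      simp [φ, Complex.log_im]
    have hφd : DifferentiableOn ℂ φ U := by
      have hl : DifferentiableOn ℂ Complex.log U := by
        intro z hz
        refine (Complex.differentiableAt_log ?_).differentiableWithinAt
        exact Or.inr (ne_of_gt hz.2)
      exact (hf.mono hUs).sub ((hl.sub_const _).const_mul _)
    have hlog : ∀ z ∈ U, (φ z).im ≤ (f z).im := by
      intro z hz
      rw [hφim]
      have : Real.log R ≤ Real.log ‖z‖ := Real.log_le_log hR (le_of_lt hz.1)
      nlinarith
    have key := mixed_max (φ := φ) hUo hUs hφd (B := m) ?_ ?_ z₀ ⟨hRz, hz₀⟩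
    · rw [hφim] at key
      exact key
    · intro p hp
      rw [hUo.frontier_eq] at hp
      obtain ⟨hp1, hp2⟩ := hclU p hp.1
      rcases hp1.eq_or_lt with h | h
      · left
        intro b hb
        have h1 := (hm p h.symm hp2 b hb).filter_mono (nhdsWithin_mono p hUs)
        have h2 : ∀ᶠ z in 𝓝[U] p, z ∈ U := self_mem_nhdsWithin
        filter_upwards [h1, h2] with z h1 h2
        exact (hlog z h2).trans_lt h1
      · right
        have hpim : p.im = 0 := by
          by_contra hne
          exact hp.2 ⟨h, lt_of_le_of_ne hp2 (Ne.symm hne)⟩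
        have hpq : p = ((p.re : ℝ) : ℂ) := by
          apply Complex.ext <;> simp [hpim]
        obtain ⟨q, hq⟩ : ∃ q : ℝ, p = (q : ℂ) := ⟨_, hpq⟩
        subst hq
        rw [Complex.norm_real, Real.norm_eq_abs] at h
        have hout : ∀ x : ℝ, |x - q| < |q| - R → R < |x| := by
          intro x hx
          have := abs_sub_abs_le_abs_sub q x
          rw [abs_sub_comm] at this
          linarith
        have himx : ∀ x : ℝ, |x - q| < |q| - R →
            ∃ l : ℝ, Tendsto (fun z => (φ z).im) (𝓝[UHP] (x : ℂ)) (𝓝 l) := by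
          intro x hx
          have hxR := hout x hx
          obtain ⟨l, hl⟩ := him x hxR
          refine ⟨l - η * (Real.log ‖(x : ℂ)‖ - Real.log R), ?_⟩
          simp only [hφim]
          have hn : Tendsto (fun z : ℂ => Real.log ‖z‖) (𝓝[UHP] (x : ℂ))
              (𝓝 (Real.log ‖(x : ℂ)‖)) := by
            have : ContinuousAt (fun z : ℂ => Real.log ‖z‖) (x : ℂ) := by
              refine ContinuousAt.log continuous_norm.continuousAt ?_
              rw [Complex.norm_real, Real.norm_eq_abs]
              linarith
            exact this.tendsto.mono_left nhdsWithin_le_nhds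
          exact hl.sub ((hn.sub_const _).const_mul η)
        have hball : ball (q : ℂ) (|q| - R) ∩ UHP ⊆ U := by
          rintro z ⟨hz1, hz2⟩
          refine ⟨?_, hz2⟩
          rw [mem_ball, dist_eq_norm] at hz1
          have := norm_sub_norm_le (q : ℂ) z
          rw [norm_sub_rev, Complex.norm_real, Real.norm_eq_abs] at this
          change R < ‖z‖
          linarith
        rcases lt_or_ge 0 q with hq0 | hq0
        · refine ⟨q, |q| - R, 0, rfl, by linarith, hball, ?_, himx⟩
          intro x hx
          have hx0 : 0 < x := by
            rw [abs_of_pos hq0] at hx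
            have := (abs_lt.1 hx).1
            linarith
          have h1 := (hre x (hout x hx)).add ((tendsto_arg_pos hx0).const_mul η)
          simp only [hφre]
          simpa using h1
        · have hq1 : q < 0 := by
            rcases hq0.lt_or_eq with h' | h'
            · exact h'
            · rw [h', abs_zero] at h
              linarith
          refine ⟨q, |q| - R, η * Real.pi, rfl, by linarith, hball, ?_, himx⟩
          intro x hx
          have hx0 : x < 0 := by
            rw [abs_of_neg hq1] at hx
            have := (abs_lt.1 hx).2
            linarith
          have h1 := (hre x (hout x hx)).add ((tendsto_arg_neg hx0).const_mul η)
          simp only [hφre]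
          simpa using h1
    · intro b hb
      refine ⟨R * Real.exp ((C - b) / η + 1), ?_⟩
      intro z hz hzn
      rw [hφim]
      have h1 : Real.log (R * Real.exp ((C - b) / η + 1)) < Real.log ‖z‖ :=
        Real.log_lt_log (by positivity) hzn
      rw [Real.log_mul hR.ne' (Real.exp_ne_zero _), Real.log_exp] at h1
      have h2 : η * ((C - b) / η + 1) < η * (Real.log ‖z‖ - Real.log R) :=
        mul_lt_mul_of_pos_left (by linarith) hη
      have h3 : η * ((C - b) / η + 1) = C - b + η := by field_simp
      have h4 := hC z hz.2
      linarith
  have hlim : Tendsto (fun η : ℝ => (f z₀).im - η * (Real.log ‖z₀‖ - Real.log R)) (𝓝[>] 0)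
      (𝓝 ((f z₀).im - 0 * (Real.log ‖z₀‖ - Real.log R))) := by
    have : Continuous (fun η : ℝ => (f z₀).im - η * (Real.log ‖z₀‖ - Real.log R)) := by
      fun_prop
    exact (this.tendsto 0).mono_left nhdsWithin_le_nhds
  have := le_of_tendsto hlim (by
    filter_upwards [self_mem_nhdsWithin] with η hη
    exact main η hη)
  simpa using this

lemma bound_aux {f : ℂ → ℂ} (hf : DifferentiableOn ℂ f UHP) {C R M p₀ : ℝ} (hR : 0 < R)
    (hC : ∀ z ∈ UHP, (f z).im ≤ C) (hM : 0 ≤ M)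
    (hre : ∀ p : ℝ, R - 1 < |p| → Tendsto (fun z => (f z).re) (𝓝[UHP] (p : ℂ)) (𝓝 0))
    {g : ℂ → ℝ} (hg : ContinuousOn g (closure UHP ∩ sphere 0 R))
    (hgf : ∀ z ∈ UHP, g z = (f z).im)
    (hlim : ∀ p ∈ closure UHP, R - 1 < ‖p‖ →
      Tendsto (fun z => (f z).im) (𝓝[UHP] p) (𝓝 (g p)))
    (hp₀ : Tendsto (fun z => (f z).im) (𝓝[UHP] (p₀ : ℂ)) (𝓝 0))
    (hb : ∀ p : ℝ, (∀ b > M, ∀ᶠ z in 𝓝[UHP] (p : ℂ), (f z).im < b) ∨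
      ∃ ρ > 0, ∃ c : ℝ, ∀ x : ℝ, |x - p| < ρ →
        Tendsto (fun z => (f z).re) (𝓝[UHP] (x : ℂ)) (𝓝 c) ∧
        ∃ l : ℝ, Tendsto (fun z => (f z).im) (𝓝[UHP] (x : ℂ)) (𝓝 l)) :
    ∀ z ∈ UHP, (f z).im ≤ M := by
  have hcpt : IsCompact (closure UHP ∩ sphere (0 : ℂ) R) :=
    (isCompact_sphere 0 R).inter_left isClosed_closure
  have hRmem : (R : ℂ) ∈ closure UHP ∩ sphere (0 : ℂ) R := by
    refine ⟨real_mem_closure_UHP R, ?_⟩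
    simp [abs_of_pos hR]
  obtain ⟨q, ⟨hq1, hq2⟩, hqmax⟩ := hcpt.exists_isMaxOn ⟨_, hRmem⟩ hg
  have hqR : ‖q‖ = R := by simpa using hq2
  have himr : ∀ p : ℝ, R - 1 < |p| →
      ∃ l : ℝ, Tendsto (fun z => (f z).im) (𝓝[UHP] (p : ℂ)) (𝓝 l) := fun p hp =>
    ⟨_, hlim p (real_mem_closure_UHP p) (by simpa using hp)⟩
  have hext : ∀ z ∈ UHP, R < ‖z‖ → (f z).im ≤ g q := by
    refine exterior hf hR hC (fun p hp => hre p (by linarith))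
      (fun p hp => himr p (by linarith)) ?_
    intro p hpR hp0 b hb
    have hpc : p ∈ closure UHP := by rw [closure_UHP_s5]; exact hp0
    have h1 : g p ≤ g q := hqmax ⟨hpc, by simpa using hpR⟩
    exact (hlim p hpc (by linarith)).eventually (gt_mem_nhds (lt_of_le_of_lt h1 hb))
  have hall : ∀ z ∈ UHP, (f z).im ≤ max M (g q) := by
    refine mixed_max isOpen_UHP subset_rfl hf ?_ ?_
    · intro p hp
      have hpr := frontier_UHP hp
      rcases hb p.re with h | ⟨ρ, hρ, c, h⟩
      · left
        intro b hb
        rw [hpr]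
        exact h b (lt_of_le_of_lt (le_max_left _ _) hb)
      · right
        exact ⟨p.re, ρ, c, hpr, hρ, inter_subset_right, fun x hx => (h x hx).1,
          fun x hx => (h x hx).2⟩
    · intro b hb
      refine ⟨R, fun z hz hzR => ?_⟩
      exact lt_of_le_of_lt ((hext z hz hzR).trans (le_max_right _ _)) hb
  by_cases hmM : g q ≤ M
  · rwa [max_eq_left hmM] at hall
  · exfalso
    push Not at hmM
    rw [max_eq_right hmM.le] at hall
    have hex : ∃ z ∈ UHP, (f z).im = g q := by
      by_cases hqU : q ∈ UHP
      · exact ⟨q, hqU, (hgf q hqU).symm⟩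
      · have hqf : q ∈ frontier UHP := by
          rw [isOpen_UHP.frontier_eq]; exact ⟨hq1, hqU⟩
        have hqr := frontier_UHP hqf
        have hqn : |q.re| = R := by
          rw [hqr, Complex.norm_real, Real.norm_eq_abs] at hqR
          exact hqR
        have hnear : ∀ x : ℝ, |x - q.re| < 1 → R - 1 < |x| := by
          intro x hx
          have := abs_sub_abs_le_abs_sub q.re x
          rw [abs_sub_comm] at this
          linarith
        have hlq : Tendsto (fun z => (f z).im) (𝓝[UHP] ((q.re : ℝ) : ℂ)) (𝓝 (g q)) := by
          rw [← hqr]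
          exact hlim q hq1 (by linarith)
        have := neumann (φ := f) (p := q.re) (ρ := 1) (c := 0) (S := g q)
          (hf.mono inter_subset_right) (fun x hx => hre x (hnear x hx))
          (fun x hx => himr x (hnear x hx)) (fun z hz => hall z hz.2) hlq (1 / 2)
          ⟨by norm_num, by norm_num⟩
        exact ⟨_, mem_UHP_of (by norm_num), this⟩
    obtain ⟨z, hz, hzq⟩ := hex
    have hconst := strong_max hf hall hz hzq
    have h1 : Tendsto (fun z => (f z).im) (𝓝[UHP] (p₀ : ℂ)) (𝓝 (g q)) := by
      refine Tendsto.congr' ?_ tendsto_const_nhds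
      filter_upwards [self_mem_nhdsWithin] with z hz
      exact (hconst z hz).symm
    have := tendsto_nhds_unique hp₀ h1
    linarith

lemma exists_near_Ioo {a b p r : ℝ} (hab : a < b) (hp : p ∈ Icc a b) (hr : 0 < r) :
    ∃ q ∈ Ioo a b, |q - p| < r := by
  rw [← closure_Ioo hab.ne] at hp
  obtain ⟨q, hq, h⟩ := Metric.mem_closure_iff.1 hp r hr
  refine ⟨q, hq, ?_⟩
  rwa [dist_comm, Real.dist_eq] at h

lemma classify (y : ℕ → ℝ) (p : ℝ) (n : ℕ) (hn : 1 ≤ n) :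
    p < y 1 ∨ y (2 * n) < p ∨ (∃ i, 1 ≤ i ∧ i ≤ n ∧ p ∈ Icc (y (2 * i - 1)) (y (2 * i))) ∨
      ∃ i, 1 ≤ i ∧ i + 1 ≤ n ∧ p ∈ Ioo (y (2 * i)) (y (2 * i + 1)) := by
  induction n, hn using Nat.le_induction with
  | base =>
    by_cases h1 : p < y 1
    · exact Or.inl h1
    by_cases h2 : y (2 * 1) < p
    · exact Or.inr (Or.inl h2)
    push Not at h1 h2
    exact Or.inr (Or.inr (Or.inl ⟨1, le_rfl, le_rfl, h1, h2⟩))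
  | succ n hn ih =>
    rcases ih with h | h | ⟨i, h1, h2, h3⟩ | ⟨i, h1, h2, h3⟩
    · exact Or.inl h
    · by_cases h1 : p < y (2 * n + 1)
      · exact Or.inr (Or.inr (Or.inr ⟨n, hn, le_rfl, h, h1⟩))
      by_cases h2 : y (2 * (n + 1)) < p
      · exact Or.inr (Or.inl h2)
      push Not at h1 h2
      refine Or.inr (Or.inr (Or.inl ⟨n + 1, by omega, le_rfl, ?_, h2⟩))
      have : 2 * (n + 1) - 1 = 2 * n + 1 := by omega
      rwa [this]
    · exact Or.inr (Or.inr (Or.inl ⟨i, h1, by omega, h3⟩))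
    · exact Or.inr (Or.inr (Or.inr ⟨i, h1, by omega, h3⟩))

lemma main_le (N : ℕ) (hN : 2 ≤ N) (y : ℕ → ℝ)
    (hy : ∀ i j : ℕ, 1 ≤ i → i < j → j ≤ 2 * N → y i < y j)
    (t s : ℝ) (ht : y (2 * N - 1) < t) (hts : t < s) (hs : s < y (2 * N))
    {f : ℂ → ℂ} (hf : DifferentiableOn ℂ f UHP)
    (hre0 : ∀ p : ℝ, (p < y 1 ∨ y (2 * N) < p) →
      Tendsto (fun z => (f z).re) (𝓝[UHP] (p : ℂ)) (𝓝 0))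
    {c : ℝ} (hc : ∀ i : ℕ, 1 ≤ i → i ≤ N - 1 → ∀ p ∈ Set.Ioo (y (2 * i)) (y (2 * i + 1)),
      Tendsto (fun z => (f z).re) (𝓝[UHP] (p : ℂ)) (𝓝 c))
    {ci : ℕ → ℝ} (hci : ∀ i : ℕ, 1 ≤ i → i ≤ N - 1 → ∀ p ∈ Set.Ioo (y (2 * i - 1)) (y (2 * i)),
      Tendsto (fun z => (f z).im) (𝓝[UHP] (p : ℂ)) (𝓝 (ci i)))
    (h0 : ∀ p ∈ Set.Ioo (y 1) (y 2), Tendsto (fun z => (f z).im) (𝓝[UHP] (p : ℂ)) (𝓝 0))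
    (hN0 : ∀ p ∈ Set.Ioo (y (2 * N - 1)) (y (2 * N)), p ≠ t → p ≠ s →
      Tendsto (fun z => (f z).im) (𝓝[UHP] (p : ℂ)) (𝓝 0))
    {C : ℝ} (hC : ∀ z ∈ UHP, (f z).im ≤ C)
    {g : ℂ → ℝ} (hg : ContinuousOn g (closure UHP \ {(t : ℂ), (s : ℂ)}))
    (hgf : ∀ z ∈ UHP, g z = (f z).im) :
    ∀ z ∈ UHP, (f z).im ≤ 0 := by
  have hyle : ∀ i j : ℕ, 1 ≤ i → i ≤ j → j ≤ 2 * N → y i ≤ y j := by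
    intro i j h1 h2 h3
    rcases h2.eq_or_lt with h | h
    · rw [h]
    · exact (hy i j h1 h h3).le
  have hnotU : ∀ x : ℝ, ∀ z ∈ UHP, z ≠ (x : ℂ) := by
    intro x z hz h
    have : 0 < z.im := hz
    rw [h] at this
    simp at this
  have limg : ∀ p ∈ closure UHP, p ≠ (t : ℂ) → p ≠ (s : ℂ) →
      Tendsto (fun z => (f z).im) (𝓝[UHP] p) (𝓝 (g p)) := by
    intro p hp hpt hps
    have h1 : ContinuousWithinAt g (closure UHP \ {(t : ℂ), (s : ℂ)}) p :=
      hg p ⟨hp, by simp [hpt, hps]⟩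
    have h2 : ContinuousWithinAt g UHP p := h1.mono (fun z hz => ⟨subset_closure hz, by
      simp [hnotU t z hz, hnotU s z hz]⟩)
    refine Tendsto.congr' ?_ h2.tendsto
    filter_upwards [self_mem_nhdsWithin] with z hz
    exact hgf z hz
  have limr : ∀ p : ℝ, p ≠ t → p ≠ s →
      Tendsto (fun z => (f z).im) (𝓝[UHP] (p : ℂ)) (𝓝 (g p)) := by
    intro p h1 h2
    exact limg p (real_mem_closure_UHP p) (by exact_mod_cast h1) (by exact_mod_cast h2)
  have segt : ∀ (a b l p : ℝ), a < b → p ∈ Icc a b → p ≠ t → p ≠ s →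
      (∀ q ∈ Ioo a b, Tendsto (fun z => (f z).im) (𝓝[UHP] (q : ℂ)) (𝓝 l)) →
      Tendsto (fun z => (f z).im) (𝓝[UHP] (p : ℂ)) (𝓝 l) := by
    intro a b l p hab hp h1 h2 h
    have h3 := limr p h1 h2
    have h4 : g p = l := by
      refine limit_unique_near h3 ?_
      intro r hr
      obtain ⟨q, hq, hqr⟩ := exists_near_Ioo hab hp hr
      exact ⟨q, hqr, h q hq⟩
    rwa [h4] at h3
  have hseg : ∀ i, 1 ≤ i → i ≤ N - 1 → ∀ p ∈ Icc (y (2 * i - 1)) (y (2 * i)),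
      Tendsto (fun z => (f z).im) (𝓝[UHP] (p : ℂ)) (𝓝 (ci i)) := by
    intro i h1 h2 p hp
    have h3 : p < t := (hp.2.trans (hyle (2 * i) (2 * N - 1) (by omega) (by omega)
      (by omega))).trans_lt ht
    exact segt _ _ _ p (hy _ _ (by omega) (by omega) (by omega)) hp h3.ne (h3.trans hts).ne
      (hci i h1 h2)
  have hlast : ∀ p ∈ Icc (y (2 * N - 1)) (y (2 * N)), p ≠ t → p ≠ s →
      Tendsto (fun z => (f z).im) (𝓝[UHP] (p : ℂ)) (𝓝 0) := by
    intro p hp hpt hps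
    rcases lt_or_gt_of_ne hpt with h | h
    · exact segt (y (2 * N - 1)) t 0 p ht ⟨hp.1, h.le⟩ hpt hps fun q hq =>
        hN0 q ⟨hq.1, (hq.2.trans hts).trans hs⟩ hq.2.ne (hq.2.trans hts).ne
    rcases lt_or_gt_of_ne hps with h' | h'
    · exact hN0 p ⟨ht.trans h, h'.trans hs⟩ hpt hps
    · exact segt s (y (2 * N)) 0 p hs ⟨h'.le, hp.2⟩ hpt hps fun q hq =>
        hN0 q ⟨(ht.trans hts).trans hq.1, hq.2⟩ (hts.trans hq.1).ne' hq.1.ne'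
  have hpt : ∀ b > 0, ∀ᶠ z in 𝓝[UHP] (t : ℂ), (f z).im < b := by
    refine puncture hf hC (ρ := min (t - y (2 * N - 1)) (s - t) / 2)
      (half_pos (lt_min (by linarith) (by linarith))) ?_
    intro q hq hqt
    have h1 := min_le_left (t - y (2 * N - 1)) (s - t)
    have h2 := min_le_right (t - y (2 * N - 1)) (s - t)
    have h3 := abs_le.1 hq
    refine hlast q ⟨by linarith, by linarith⟩ hqt ?_
    intro h
    linarith
  have hps : ∀ b > 0, ∀ᶠ z in 𝓝[UHP] (s : ℂ), (f z).im < b := by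
    refine puncture hf hC (ρ := min (s - t) (y (2 * N) - s) / 2)
      (half_pos (lt_min (by linarith) (by linarith))) ?_
    intro q hq hqs
    have h1 := min_le_left (s - t) (y (2 * N) - s)
    have h2 := min_le_right (s - t) (y (2 * N) - s)
    have h3 := abs_le.1 hq
    refine hlast q ⟨by linarith, by linarith⟩ ?_ hqs
    intro h
    linarith
  have hy12 : y 1 < y 2 := hy 1 2 le_rfl (by omega) (by omega)
  have hmid : (y 1 + y 2) / 2 ∈ Ioo (y 1) (y 2) := ⟨by linarith, by linarith⟩
  have hp₀ := h0 _ hmid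
  have hci1 : ci 1 = 0 := tendsto_nhds_unique (hci 1 le_rfl (by omega) _ (by simpa using hmid)) hp₀
  obtain ⟨i₀, hi₀, hmax⟩ := Finset.exists_max_image (Finset.Icc 1 (N - 1)) ci
    ⟨1, Finset.mem_Icc.2 ⟨le_rfl, by omega⟩⟩
  rw [Finset.mem_Icc] at hi₀
  have hM : 0 ≤ ci i₀ := by
    rw [← hci1]
    exact hmax 1 (Finset.mem_Icc.2 ⟨le_rfl, by omega⟩)
  have hy1t : y 1 < t := (hyle 1 (2 * N - 1) le_rfl (by omega) (by omega)).trans_lt ht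
  have hout : ∀ p : ℝ, |y 1| + |y (2 * N)| < |p| → p < y 1 ∨ y (2 * N) < p := by
    intro p hp
    by_contra hcon
    push Not at hcon
    have : |p| ≤ |y 1| + |y (2 * N)| := by
      rw [abs_le]
      constructor
      · linarith [neg_abs_le (y 1), abs_nonneg (y (2 * N)), hcon.1]
      · linarith [le_abs_self (y (2 * N)), abs_nonneg (y 1), hcon.2]
    linarith
  have hout' : ∀ x : ℝ, y 1 < x → x < y (2 * N) → ∀ p : ℂ, |y 1| + |y (2 * N)| < ‖p‖ →
      p ≠ (x : ℂ) := by
    intro x h1 h2 p hp h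
    rw [h, Complex.norm_real, Real.norm_eq_abs] at hp
    rcases hout x hp with h' | h' <;> linarith
  have hle : ∀ z ∈ UHP, (f z).im ≤ ci i₀ := by
    refine bound_aux hf (R := |y 1| + |y (2 * N)| + 1) (by positivity) hC hM ?_ (g := g) ?_ hgf
      ?_ hp₀ ?_
    · intro p hp
      exact hre0 p (hout p (by linarith))
    · refine hg.mono ?_
      rintro z ⟨hz1, hz2⟩
      have hz3 : ‖z‖ = |y 1| + |y (2 * N)| + 1 := by simpa using hz2
      refine ⟨hz1, ?_⟩
      have e1 := hout' t hy1t (hts.trans hs) z (by linarith)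
      have e2 := hout' s (hy1t.trans hts) hs z (by linarith)
      simp [e1, e2]
    · intro p hp hpn
      exact limg p hp (hout' t hy1t (hts.trans hs) p (by linarith))
        (hout' s (hy1t.trans hts) hs p (by linarith))
    · intro p
      rcases classify y p N (by omega) with h | h | ⟨i, h1, h2, h3⟩ | ⟨i, h1, h2, h3⟩
      · right
        refine ⟨y 1 - p, by linarith, 0, fun x hx => ?_⟩
        have hx1 : x < y 1 := by linarith [(abs_lt.1 hx).2]
        exact ⟨hre0 x (Or.inl hx1), _, limr x (by linarith) (by linarith)⟩
      · right
        refine ⟨p - y (2 * N), by linarith, 0, fun x hx => ?_⟩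
        have hx1 : y (2 * N) < x := by linarith [(abs_lt.1 hx).1]
        exact ⟨hre0 x (Or.inr hx1), _, limr x (by linarith) (by linarith)⟩
      · left
        intro b hb
        rcases h2.eq_or_lt with h | h
        · subst h
          by_cases e1 : p = t
          · rw [e1]
            exact hpt b (by linarith)
          by_cases e2 : p = s
          · rw [e2]
            exact hps b (by linarith)
          exact (hlast p h3 e1 e2).eventually (gt_mem_nhds (by linarith))
        · have := hmax i (Finset.mem_Icc.2 ⟨h1, by omega⟩)
          exact (hseg i h1 (by omega) p h3).eventually (gt_mem_nhds (by linarith))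
      · right
        refine ⟨min (p - y (2 * i)) (y (2 * i + 1) - p), lt_min (by linarith [h3.1])
          (by linarith [h3.2]), c, fun x hx => ?_⟩
        have hx1 := (abs_lt.1 (hx.trans_le (min_le_left _ _))).1
        have hx2 := (abs_lt.1 (hx.trans_le (min_le_right _ _))).2
        have hx3 : x < t := by
          have := hyle (2 * i + 1) (2 * N - 1) (by omega) (by omega) (by omega)
          linarith
        exact ⟨hc i h1 (by omega) x ⟨by linarith, by linarith⟩, _,
          limr x (by linarith) (by linarith)⟩
  by_cases hM0 : ci i₀ = 0
  · rwa [hM0] at hle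
  exfalso
  have hi1 : i₀ ≠ 1 := by
    intro h
    rw [h] at hM0
    exact hM0 hci1
  have hi2 : 2 ≤ i₀ := by omega
  obtain ⟨z, hz, hzM⟩ := key_segment hf (M := ci i₀) (c := c) (a := y (2 * i₀ - 1))
    (b := y (2 * i₀)) (α := y (2 * (i₀ - 1))) (β := y (2 * i₀ + 1))
    (hy _ _ (by omega) (by omega) (by omega)) (hy _ _ (by omega) (by omega) (by omega))
    (hy _ _ (by omega) (by omega) (by omega))
    (by
      have e := hc (i₀ - 1) (by omega) (by omega)
      have e2 : 2 * (i₀ - 1) + 1 = 2 * i₀ - 1 := by omega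
      rwa [e2] at e)
    (hc i₀ hi₀.1 hi₀.2) (hseg i₀ hi₀.1 hi₀.2) hle
  have hconst := strong_max hf hle hz hzM
  have h1 : Tendsto (fun z => (f z).im) (𝓝[UHP] (((y 1 + y 2) / 2 : ℝ) : ℂ)) (𝓝 (ci i₀)) := by
    refine Tendsto.congr' ?_ tendsto_const_nhds
    filter_upwards [self_mem_nhdsWithin] with z hz
    exact (hconst z hz).symm
  exact hM0 (tendsto_nhds_unique h1 hp₀)

lemma const_of_im_zero {f : ℂ → ℂ} (hf : DifferentiableOn ℂ f UHP)
    (h : ∀ z ∈ UHP, (f z).im = 0) : ∀ z ∈ UHP, ∀ w ∈ UHP, f z = f w := by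
  have han : AnalyticOnNhd ℂ f UHP := hf.analyticOnNhd isOpen_UHP
  rcases han.is_constant_or_isOpen convex_UHP.isPreconnected with ⟨w, hw⟩ | hop
  · intro z hz z' hz'
    rw [hw z hz, hw z' hz']
  · exfalso
    have ho := hop UHP subset_rfl isOpen_UHP
    have hmem : f I ∈ f '' UHP := ⟨I, by simp [UHP], rfl⟩
    obtain ⟨ε, hε, hb⟩ := Metric.isOpen_iff.1 ho _ hmem
    have h1 : f I + (ε / 2 : ℝ) * I ∈ ball (f I) ε := by
      rw [mem_ball, dist_eq_norm]
      simp [abs_of_pos hε]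
      exact hε
    obtain ⟨z, hz, hzf⟩ := hb h1
    have h2 := h z hz
    have h3 := h I (by simp [UHP])
    rw [hzf] at h2
    simp [h3] at h2
    linarith

/-- Uniqueness of the holomorphic observable solving the mixed boundary-value problem
with Dirichlet-1 window `(t,s) ⊂ (y_{2N-1}, y_{2N})`. -/
theorem bvp_unique (N : ℕ) (hN : 2 ≤ N) (y : ℕ → ℝ)
    (hy : ∀ i j : ℕ, 1 ≤ i → i < j → j ≤ 2 * N → y i < y j)
    (t s : ℝ) (ht : y (2 * N - 1) < t) (hts : t < s) (hs : s < y (2 * N))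
    (h k : ℂ → ℂ) (hh : SolvesBVP N y t s h) (hk : SolvesBVP N y t s k) :
    Set.EqOn h k UHP := by
  have hle : ∀ h k : ℂ → ℂ, SolvesBVP N y t s h → SolvesBVP N y t s k →
      ∀ z ∈ UHP, (h z - k z).im ≤ 0 := by
    intro h k hh hk
    obtain ⟨a0, a1, ⟨ca, a2⟩, a3, a4, a5, ⟨Ca, a6⟩, ga, a7, a8⟩ := hh
    obtain ⟨b0, b1, ⟨cb, b2⟩, b3, b4, b5, ⟨Cb, b6⟩, gb, b7, b8⟩ := hk
    have key : ∀ i : ℕ, ∃ c : ℝ, 1 ≤ i → i ≤ N - 1 → ∀ p ∈ Set.Ioo (y (2 * i - 1)) (y (2 * i)),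
        Tendsto (fun z => (h z - k z).im) (𝓝[UHP] (p : ℂ)) (𝓝 c) := by
      intro i
      by_cases hi : 1 ≤ i ∧ i ≤ N - 1
      · obtain ⟨c1, h1⟩ := a3 i hi.1 hi.2
        obtain ⟨c2, h2⟩ := b3 i hi.1 hi.2
        refine ⟨c1 - c2, fun _ _ p hp => ?_⟩
        simp only [Complex.sub_im]
        exact (h1 p hp).sub (h2 p hp)
      · exact ⟨0, fun h1 h2 => absurd ⟨h1, h2⟩ hi⟩
    choose ci hci using key
    refine main_le N hN y hy t s ht hts hs (f := fun z => h z - k z) (a0.sub b0) ?_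
      (c := ca - cb) ?_ hci ?_ ?_ (C := Ca + Cb) ?_ (a7.sub b7) ?_
    · intro p hp
      simp only [Complex.sub_re]
      simpa using (a1 p hp).sub (b1 p hp)
    · intro i h1 h2 p hp
      simp only [Complex.sub_re]
      exact (a2 i h1 h2 p hp).sub (b2 i h1 h2 p hp)
    · intro p hp
      simp only [Complex.sub_im]
      simpa using (a4 p (Or.inl (Or.inl hp))).sub (b4 p (Or.inl (Or.inl hp)))
    · intro p hp hpt hps
      simp only [Complex.sub_im]
      rcases lt_or_gt_of_ne hpt with h1 | h1
      · have hm : p ∈ Set.Ioo (y 1) (y 2) ∪ Set.Ioo (y (2 * N - 1)) t ∪ Set.Ioo s (y (2 * N)) :=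
          Or.inl (Or.inr ⟨hp.1, h1⟩)
        simpa using (a4 p hm).sub (b4 p hm)
      rcases lt_or_gt_of_ne hps with h2 | h2
      · simpa using (a5 p ⟨h1, h2⟩).sub (b5 p ⟨h1, h2⟩)
      · have hm : p ∈ Set.Ioo (y 1) (y 2) ∪ Set.Ioo (y (2 * N - 1)) t ∪ Set.Ioo s (y (2 * N)) :=
          Or.inr ⟨h2, hp.2⟩
        simpa using (a4 p hm).sub (b4 p hm)
    · intro z hz
      have h1 := (abs_le.1 (a6 z hz)).2
      have h2 := (abs_le.1 (b6 z hz)).1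
      simp only [Complex.sub_im]
      linarith
    · intro z hz
      simp [a8 z hz, b8 z hz]
  have him : ∀ z ∈ UHP, (h z - k z).im = 0 := by
    intro z hz
    have h1 := hle h k hh hk z hz
    have h2 := hle k h hk hh z hz
    simp only [Complex.sub_im] at h1 h2 ⊢
    linarith
  have hconst := const_of_im_zero (hh.1.sub hk.1) him
  intro z hz
  have hlim : Tendsto (fun w => (h w - k w).re) (𝓝[UHP] ((y 1 - 1 : ℝ) : ℂ)) (𝓝 0) := by
    have hp : y 1 - 1 < y 1 ∨ y (2 * N) < y 1 - 1 := Or.inl (by linarith)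
    simp only [Complex.sub_re]
    simpa using (hh.2.1 _ hp).sub (hk.2.1 _ hp)
  have hlim2 : Tendsto (fun w => (h w - k w).re) (𝓝[UHP] ((y 1 - 1 : ℝ) : ℂ))
      (𝓝 (h z - k z).re) := by
    refine Tendsto.congr' ?_ tendsto_const_nhds
    filter_upwards [self_mem_nhdsWithin] with w hw
    have := hconst z hz w hw
    simp only [Pi.sub_apply] at this
    rw [this]
  have hre := tendsto_nhds_unique hlim2 hlim
  exact sub_eq_zero.1 (Complex.ext hre (him z hz))
end
end
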